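/- For every s ≥ 1 and n ≥ 1, the multicolored matching arc complex sMA(K_n) on the disk with n marked points is (⌊(n−2)/3⌋ − 1)-connected. -/

import Mathlib

open scoped Classical

/-- An abstract simplicial complex, recorded by its set of (finite, nonempty) faces. -/
structure SComplex (V : Type*) where
  faces : Set (Finset V)

/-- The geometric realization of a simplicial complex: barycentric-coordinate
functions supported on a face. -/
def SComplex.realization {V : Type*} (K : SComplex V) : Type _ :=
  {f : V → ℝ // (∀ v, 0 ≤ f v) ∧ (∑ᶠ v, f v = 1) ∧ ∃ σ ∈ K.faces, ∀ v, f v ≠ 0 → v ∈ σ}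

instance {V : Type*} (K : SComplex V) : TopologicalSpace K.realization :=
  inferInstanceAs (TopologicalSpace
    {f : V → ℝ // (∀ v, 0 ≤ f v) ∧ (∑ᶠ v, f v = 1) ∧ ∃ σ ∈ K.faces, ∀ v, f v ≠ 0 → v ∈ σ})

/-- The simplicial join of two complexes. -/
def SComplex.join {V W : Type*} (K : SComplex V) (L : SComplex W) : SComplex (V ⊕ W) where
  faces := {σ | σ.Nonempty ∧ ∃ (a : Finset V) (b : Finset W),
    (a ∈ K.faces ∨ a = ∅) ∧ (b ∈ L.faces ∨ b = ∅) ∧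
    σ = a.image Sum.inl ∪ b.image Sum.inr}

/-- `X` is `m`-connected: nonempty, path-connected, and `π_i X = 0` for `1 ≤ i ≤ m`.
For `m = -1` this just means nonempty; for `m < -1` it is vacuous. -/
def NConnectedSpace (m : ℤ) (X : Type*) [TopologicalSpace X] : Prop :=
  (-1 ≤ m → Nonempty X) ∧ (0 ≤ m → PathConnectedSpace X) ∧
    ∀ i : ℕ, 0 < i → (i : ℤ) ≤ m → ∀ x : X, Subsingleton (HomotopyGroup (Fin i) X x)

/-- `ν(n) = ⌊(n-2)/3⌋`. -/
def nuZ (n : ℕ) : ℤ := Int.fdiv ((n : ℤ) - 2) 3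

/-- `η(n) = ⌊(n-2)/2^s⌋`. -/
def etaZ (s n : ℕ) : ℤ := Int.fdiv ((n : ℤ) - 2) (2 ^ s)

/-- A coloured arc in the unit disk `S ⊆ ℂ` with marked point set `P`: a simple
path in the interior of the disk meeting `P` exactly at its two distinct
endpoints, together with a colour in `{1, …, s}`. -/
structure ColoredArc (s n : ℕ) (P : Fin n → ℂ) : Type where
  color : Fin s
  toFun : C(unitInterval, ℂ)
  inj : Function.Injective toFun
  mem_ball : ∀ t, toFun t ∈ Metric.ball (0 : ℂ) 1
  src : ∃ i, toFun 0 = P i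
  tgt : ∃ i, toFun 1 = P i
  ends_ne : toFun 0 ≠ toFun 1
  middle : ∀ t : unitInterval, t ≠ 0 → t ≠ 1 → toFun t ∉ Set.range P

/-- Homotopy of coloured arcs relative to `P`: same colour, and the underlying
paths are homotopic with endpoints fixed, staying in the interior of the disk
and avoiding `P` except at the endpoints. -/
def ArcHomotopic {s n : ℕ} {P : Fin n → ℂ} (α β : ColoredArc s n P) : Prop :=
  α.color = β.color ∧
  ∃ H : C(unitInterval × unitInterval, ℂ),
    (∀ t, H (0, t) = α.toFun t) ∧ (∀ t, H (1, t) = β.toFun t) ∧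
    (∀ u, H (u, 0) = α.toFun 0) ∧ (∀ u, H (u, 1) = α.toFun 1) ∧
    (∀ u t, H (u, t) ∈ Metric.ball (0 : ℂ) 1) ∧
    (∀ u t, t ≠ 0 → t ≠ 1 → H (u, t) ∉ Set.range P)

/-- Homotopy classes, relative to `P`, of coloured arcs. -/
def ArcClass (s n : ℕ) (P : Fin n → ℂ) : Type := Quot (@ArcHomotopic s n P)

/-- Two coloured arcs are disjoint (including at their endpoints). -/
def ArcsDisjoint {s n : ℕ} {P : Fin n → ℂ} (α β : ColoredArc s n P) : Prop :=
  ∀ t u : unitInterval, α.toFun t ≠ β.toFun u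

/-- The multicoloured matching arc complex `sMA(K_n)` on the disk with marked
points `P`: faces are the collections of homotopy classes of coloured arcs
admitting representatives that are pairwise disjoint, including at their
endpoints. -/
def sMA (s n : ℕ) (P : Fin n → ℂ) : SComplex (ArcClass s n P) :=
  ⟨{σ | σ.Nonempty ∧ ∃ rep : {x // x ∈ σ} → ColoredArc s n P,
      (∀ x, Quot.mk _ (rep x) = x.1) ∧
      ∀ x y, x ≠ y → ArcsDisjoint (rep x) (rep y)}⟩


open scoped Classical
namespace MA
open Set Topology Metric

abbrev Sph (d : ℕ) := ↥(sphere (0 : Fin d → ℝ) 1)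

/-- `f` on the sphere is fillable in `S`. -/
def Fill (d : ℕ) {Y : Type*} [TopologicalSpace Y] (S : Set Y) (f : Sph d → Y) : Prop :=
  ∃ g : (Fin d → ℝ) → Y, Continuous g ∧ (∀ x, g x ∈ S) ∧ ∀ x : Sph d, g x = f x

def EP (d : ℕ) {Y : Type*} [TopologicalSpace Y] (S : Set Y) : Prop :=
  ∀ f : Sph d → Y, Continuous f → (∀ x, f x ∈ S) → Fill d S f

structure Cell (d : ℕ) where
  lo : Fin d → ℤ
  S : Finset (Fin d)

namespace Cell
variable {d : ℕ}

def ind (c : Cell d) (i : Fin d) : ℤ := if i ∈ c.S then 1 else 0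

def box (c : Cell d) : Set (Fin d → ℝ) :=
  {x | ∀ i, (c.lo i : ℝ) ≤ x i ∧ x i ≤ ((c.lo i + c.ind i : ℤ) : ℝ)}

def fc (c c' : Cell d) : Prop :=
  ∀ i, c'.lo i ≤ c.lo i ∧ c.lo i + c.ind i ≤ c'.lo i + c'.ind i

lemma ind_mem {c : Cell d} {i} (h : i ∈ c.S) : c.ind i = 1 := by simp [ind, h]
lemma ind_nmem {c : Cell d} {i} (h : i ∉ c.S) : c.ind i = 0 := by simp [ind, h]
lemma ind_cases (c : Cell d) (i) : (i ∈ c.S ∧ c.ind i = 1) ∨ (i ∉ c.S ∧ c.ind i = 0) := by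
  by_cases h : i ∈ c.S <;> simp [ind, h]

lemma fc.subset {c c' : Cell d} (h : c.fc c') : c.S ⊆ c'.S := by
  intro i hi
  have := h i
  rw [ind_mem hi] at this
  rcases c'.ind_cases i with h' | h'
  · exact h'.1
  · omega

lemma fc.eq {c c' : Cell d} (h : c.fc c') (hc : c'.S.card ≤ c.S.card) : c = c' := by
  have hS := Finset.eq_of_subset_of_card_le h.subset hc
  obtain ⟨lo, S⟩ := c
  obtain ⟨lo', S'⟩ := c'
  simp only at hS
  subst hS
  have : lo = lo' := by
    ext i
    have := h i
    simp only [ind] at this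
    omega
  rw [this]

lemma fc.box {c c' : Cell d} (h : c.fc c') : c.box ⊆ c'.box := by
  intro x hx i
  have h1 : (c'.lo i : ℝ) ≤ c.lo i := by exact_mod_cast (h i).1
  have h2 : ((c.lo i + c.ind i : ℤ) : ℝ) ≤ ((c'.lo i + c'.ind i : ℤ) : ℝ) := by
    exact_mod_cast (h i).2
  exact ⟨h1.trans (hx i).1, (hx i).2.trans h2⟩

def bd (c : Cell d) (x : Fin d → ℝ) : Prop := ∃ i ∈ c.S, x i = c.lo i ∨ x i = c.lo i + 1

lemma fc_of_int {c c' : Cell d} {x} (hx : x ∈ c.box) (hb : ¬ c.bd x) (hx' : x ∈ c'.box) :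
    c.fc c' := by
  intro i
  have h1 := hx i
  have h2 := hx' i
  rcases c.ind_cases i with ⟨h, h'⟩ | ⟨h, h'⟩
  · have hb' : x i ≠ c.lo i ∧ x i ≠ c.lo i + 1 := by
      constructor
      · intro h3; exact hb ⟨i, h, Or.inl h3⟩
      · intro h3; exact hb ⟨i, h, Or.inr h3⟩
    rw [h'] at h1 ⊢
    push_cast at h1
    have h3 : (c.lo i : ℝ) < x i := lt_of_le_of_ne h1.1 (Ne.symm hb'.1)
    have h4 : x i < c.lo i + 1 := lt_of_le_of_ne h1.2 hb'.2
    have h5 : (c'.lo i : ℝ) < ((c.lo i + 1 : ℤ) : ℝ) := by push_cast; linarith [h2.1]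
    have h6 : (c.lo i : ℝ) < ((c'.lo i + c'.ind i : ℤ) : ℝ) := by linarith [h2.2]
    have h5' := Int.cast_lt.1 h5
    have h6' := Int.cast_lt.1 h6
    omega
  · rw [h'] at h1 ⊢
    have h3 : x i = c.lo i := by
      have := h1.2; push_cast at this; linarith [h1.1]
    rw [h3] at h2
    have := Int.cast_le.1 h2.1
    have := Int.cast_le.1 h2.2
    omega

/-- lower / upper facets -/
lemma bd_face {c : Cell d} {x} (hx : x ∈ c.box) (hb : c.bd x) :
    ∃ c' : Cell d, c'.fc c ∧ c'.S.card < c.S.card ∧ x ∈ c'.box := by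
  obtain ⟨i, hi, h⟩ := hb
  obtain ⟨b, hb0, hb1, hb⟩ : ∃ b : ℤ, 0 ≤ b ∧ b ≤ 1 ∧ x i = ((c.lo i + b : ℤ) : ℝ) := by
    rcases h with h | h
    · exact ⟨0, by simp, by simp, by simpa using h⟩
    · exact ⟨1, by simp, by simp, by simpa using h⟩
  refine ⟨⟨fun j => if j = i then c.lo i + b else c.lo j, c.S.erase i⟩, ?_,
    Finset.card_erase_lt_of_mem hi, ?_⟩
  · intro j
    by_cases hj : j = i
    · subst hj; simp [ind, hi]; omega
    · simp [ind, hj]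
  · intro j
    by_cases hj : j = i
    · subst hj; simp [ind]; simp [hb]
    · simpa [ind, hj] using hx j

lemma isClosed_box (c : Cell d) : IsClosed c.box := by
  have : c.box = ⋂ i, {x | (c.lo i : ℝ) ≤ x i ∧ x i ≤ ((c.lo i + c.ind i : ℤ) : ℝ)} := by
    ext x; simp [box]
  rw [this]
  refine isClosed_iInter fun i => ?_
  exact (isClosed_le continuous_const (continuous_apply i)).inter
    (isClosed_le (continuous_apply i) continuous_const)

lemma fc_refl (c : Cell d) : c.fc c := fun _ => ⟨le_rfl, le_rfl⟩
lemma fc_trans {a b c : Cell d} (h : a.fc b) (h' : b.fc c) : a.fc c :=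
  fun i => ⟨(h' i).1.trans (h i).1, (h i).2.trans (h' i).2⟩

lemma extend {Y : Type*} [TopologicalSpace Y] {C : Set Y} (c : Cell d) (hC : EP c.S.card C)
    (g : (Fin d → ℝ) → Y) (hg : ContinuousOn g {x | x ∈ c.box ∧ c.bd x})
    (hgC : ∀ x ∈ c.box, c.bd x → g x ∈ C) :
    ∃ h : (Fin d → ℝ) → Y, Continuous h ∧ (∀ x, h x ∈ C) ∧ ∀ x ∈ c.box, c.bd x → h x = g x := by
  let e := c.S.equivFin
  let A : (Fin d → ℝ) → (Fin c.S.card → ℝ) := fun x j => 2 * (x (e.symm j) - c.lo (e.symm j)) - 1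
  let B : (Fin c.S.card → ℝ) → (Fin d → ℝ) := fun y i =>
    if h : i ∈ c.S then c.lo i + (y (e ⟨i, h⟩) + 1) / 2 else c.lo i
  have hAc : Continuous A := by fun_prop
  have hBc : Continuous B := by
    refine continuous_pi fun i => ?_
    by_cases h : i ∈ c.S <;> simp only [B, h, dite_true, dite_false] <;> fun_prop
  have hBA : ∀ x ∈ c.box, B (A x) = x := by
    intro x hx
    ext i
    by_cases h : i ∈ c.S
    · simp [B, A, h]
    · have := hx i
      rw [ind_nmem h] at this
      simp only [B, h, dite_false]
      push_cast at this
      linarith [this.1, this.2]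
  have hBb : ∀ y ∈ sphere (0 : Fin c.S.card → ℝ) 1, B y ∈ c.box ∧ c.bd (B y) := by
    intro y hy
    have hy1 : ‖y‖ = 1 := by simpa using hy
    have hy2 : ∀ j, |y j| ≤ 1 := fun j => by
      have := norm_le_pi_norm y j; rwa [hy1] at this
    constructor
    · intro i
      by_cases h : i ∈ c.S
      · have := abs_le.1 (hy2 (e ⟨i, h⟩))
        rw [ind_mem h]
        simp only [B, h, dite_true]
        push_cast
        constructor <;> linarith [this.1, this.2]
      · rw [ind_nmem h]
        simp [B, h]
    · by_contra hb
      have : ‖y‖ < 1 := by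
        rw [pi_norm_lt_iff one_pos]
        intro j
        refine lt_of_le_of_ne (hy2 j) fun h1 => hb ?_
        refine ⟨e.symm j, (e.symm j).2, ?_⟩
        rcases (abs_eq one_pos.le).1 h1 with h | h
        · right; simp [B, h]
        · left; simp [B, h]
      linarith
  have hAs : ∀ x ∈ c.box, c.bd x → A x ∈ sphere (0 : Fin c.S.card → ℝ) 1 := by
    rintro x hx ⟨i, hi, h⟩
    rw [mem_sphere_zero_iff_norm]
    apply le_antisymm
    · rw [pi_norm_le_iff_of_nonneg zero_le_one]
      intro j
      have := hx (e.symm j)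
      rw [ind_mem (e.symm j).2] at this
      push_cast at this
      rw [Real.norm_eq_abs, abs_le]
      simp only [A]
      constructor <;> linarith [this.1, this.2]
    · have h1 := norm_le_pi_norm (A x) (e ⟨i, hi⟩)
      have h2 : ‖A x (e ⟨i, hi⟩)‖ = 1 := by
        simp only [A, Equiv.symm_apply_apply]
        rcases h with h | h <;> simp [h]; norm_num
      rwa [h2] at h1
  obtain ⟨h, hc, hS, hh⟩ := hC (fun y => g (B y))
    (hg.comp_continuous (hBc.comp continuous_subtype_val) fun y => hBb y y.2)
    (fun y => hgC _ (hBb y y.2).1 (hBb y y.2).2)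
  refine ⟨h ∘ A, hc.comp hAc, fun x => hS _, fun x hx hb => ?_⟩
  have := hh ⟨A x, hAs x hx hb⟩
  simp only [Function.comp]
  rw [this]
  show g (B (A x)) = g x
  rw [hBA x hx]

end Cell

lemma continuousOn_biUnion_of_finite {X Y ι : Type*} [TopologicalSpace X] [TopologicalSpace Y]
    {s : Set ι} (hs : s.Finite) {F : ι → Set X} (hF : ∀ i ∈ s, IsClosed (F i)) {g : X → Y}
    (hg : ∀ i ∈ s, ContinuousOn g (F i)) : ContinuousOn g (⋃ i ∈ s, F i) := by
  induction s, hs using Set.Finite.induction_on with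
  | empty => simp
  | @insert a s ha hs ih =>
    rw [biUnion_insert]
    refine ContinuousOn.union_of_isClosed (hg a (mem_insert _ _))
      (ih (fun i hi => hF i (mem_insert_of_mem _ hi)) fun i hi => hg i (mem_insert_of_mem _ hi))
      (hF a (mem_insert _ _)) (hs.isClosed_biUnion fun i hi => hF i (mem_insert_of_mem _ hi))

/-- Grid carrier extension. -/
lemma grid_extension {d : ℕ} {Y : Type*} [TopologicalSpace Y] (𝒞 𝒜 : Set (Cell d))
    (hfin : 𝒞.Finite) (hC : ∀ c ∈ 𝒞, ∀ c' : Cell d, c'.fc c → c' ∈ 𝒞)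
    (hA : ∀ c ∈ 𝒜, ∀ c' : Cell d, c'.fc c → c' ∈ 𝒜) (hAC : 𝒜 ⊆ 𝒞)
    (K : Cell d → Set Y) (hK : ∀ c ∈ 𝒞, c ∉ 𝒜 → ∀ c' : Cell d, c'.fc c → c' ∉ 𝒜 → K c' ⊆ K c)
    (g₀ : (Fin d → ℝ) → Y) (hg₀ : ∀ c ∈ 𝒜, ContinuousOn g₀ c.box)
    (hgK : ∀ c ∈ 𝒞, c ∉ 𝒜 → ∀ c' ∈ 𝒜, c'.fc c → ∀ x ∈ c'.box, g₀ x ∈ K c)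
    (hEP : ∀ c ∈ 𝒞, c ∉ 𝒜 → EP c.S.card (K c)) (k : ℕ) :
    ∃ g : (Fin d → ℝ) → Y,
      (∀ c ∈ 𝒞, (c ∈ 𝒜 ∨ c.S.card < k) → ContinuousOn g c.box) ∧
      (∀ c ∈ 𝒜, ∀ x ∈ c.box, g x = g₀ x) ∧
      (∀ c ∈ 𝒞, c ∉ 𝒜 → c.S.card < k → ∀ x ∈ c.box, g x ∈ K c) := by
  induction k with
  | zero => exact ⟨g₀, fun c _ h => hg₀ c (by simpa using h), fun _ _ _ _ => rfl, by simp⟩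
  | succ k ih =>
    obtain ⟨g, h1, h2, h3⟩ := ih
    let X : Set (Cell d) := {c | c ∈ 𝒞 ∧ (c ∈ 𝒜 ∨ c.S.card < k)}
    have hXfin : X.Finite := hfin.subset fun c hc => hc.1
    have hXc : ContinuousOn g (⋃ c ∈ X, c.box) :=
      continuousOn_biUnion_of_finite hXfin (fun c _ => c.isClosed_box) fun c hc => h1 c hc.1 hc.2
    have hN : ∀ c : Cell d, ∃ h : (Fin d → ℝ) → Y, (c ∈ 𝒞 → c ∉ 𝒜 → c.S.card = k →
        (Continuous h ∧ (∀ x, h x ∈ K c) ∧ ∀ x ∈ c.box, c.bd x → h x = g x)) := by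
      intro c
      by_cases hc : c ∈ 𝒞 ∧ c ∉ 𝒜 ∧ c.S.card = k
      · obtain ⟨hc1, hc2, hc3⟩ := hc
        have := c.extend (hEP c hc1 hc2) g (hXc.mono ?_) ?_
        · obtain ⟨h, hh⟩ := this
          exact ⟨h, fun _ _ _ => hh⟩
        · rintro x ⟨hx, hb⟩
          obtain ⟨c', hc', hcc, hx'⟩ := Cell.bd_face hx hb
          exact mem_biUnion (show c' ∈ X from ⟨hC c hc1 c' hc', Or.inr (by omega)⟩) hx'
        · intro x hx hb
          obtain ⟨c', hc', hcc, hx'⟩ := Cell.bd_face hx hb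
          by_cases hc'A : c' ∈ 𝒜
          · rw [h2 c' hc'A x hx']
            exact hgK c hc1 hc2 c' hc'A hc' x hx'
          · exact hK c hc1 hc2 c' hc' hc'A (h3 c' (hC c hc1 c' hc') hc'A (by omega) x hx')
      · exact ⟨g, fun a b c => absurd ⟨a, b, c⟩ hc⟩
    choose h hh using hN
    let Q : (Fin d → ℝ) → Cell d → Prop := fun x c => c ∈ 𝒞 ∧ c ∉ 𝒜 ∧ c.S.card = k ∧ x ∈ c.box
    let g' : (Fin d → ℝ) → Y := fun x =>
      if x ∈ ⋃ c ∈ X, c.box then g x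
      else if hx : ∃ c, Q x c then h hx.choose x else g x
    have e1 : ∀ c ∈ X, ∀ x ∈ c.box, g' x = g x := by
      intro c hc x hx
      have : x ∈ ⋃ c ∈ X, c.box := mem_biUnion hc hx
      simp only [g', this, if_true]
    have e2 : ∀ c ∈ 𝒞, c ∉ 𝒜 → c.S.card = k → ∀ x ∈ c.box, g' x = h c x := by
      intro c hc hcA hck x hx
      by_cases hxX : x ∈ ⋃ c ∈ X, c.box
      · simp only [g', hxX, if_true]
        by_cases hb : c.bd x
        · exact ((hh c hc hcA hck).2.2 x hx hb).symm
        · exfalso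
          simp only [mem_iUnion] at hxX
          obtain ⟨c', hc', hx'⟩ := hxX
          have hf := Cell.fc_of_int hx hb hx'
          rcases hc'.2 with h5 | h5
          · exact hcA (hA c' h5 c hf)
          · have := Finset.card_le_card hf.subset
            omega
      · have hxe : ∃ c, Q x c := ⟨c, hc, hcA, hck, hx⟩
        simp only [g', hxX, if_false, hxe, dite_true]
        have hq := hxe.choose_spec
        have hb : ¬ c.bd x := by
          intro hb
          obtain ⟨c', hc', hcc, hx'⟩ := Cell.bd_face hx hb
          exact hxX (mem_biUnion (show c' ∈ X from ⟨hC c hc c' hc', Or.inr (by omega)⟩) hx')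
        have hf := Cell.fc_of_int hx hb hq.2.2.2
        have := hf.eq (by rw [hq.2.2.1, hck])
        rw [← this]
    refine ⟨g', ?_, ?_, ?_⟩
    · intro c hc h5
      by_cases hX : c ∈ X
      · exact (h1 c hX.1 hX.2).congr (e1 c hX)
      · have hcA : c ∉ 𝒜 := fun h6 => hX ⟨hc, Or.inl h6⟩
        have hck : c.S.card = k := by
          have : ¬ c.S.card < k := fun h6 => hX ⟨hc, Or.inr h6⟩
          rcases h5 with h5 | h5
          · exact absurd h5 hcA
          · omega
        exact (hh c hc hcA hck).1.continuousOn.congr (e2 c hc hcA hck)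
    · intro c hc x hx
      rw [e1 c ⟨hAC hc, Or.inl hc⟩ x hx, h2 c hc x hx]
    · intro c hc hcA hck x hx
      by_cases h5 : c.S.card < k
      · rw [e1 c ⟨hc, Or.inr h5⟩ x hx]; exact h3 c hc hcA h5 x hx
      · have h6 : c.S.card = k := by omega
        rw [e2 c hc hcA h6 x hx]; exact (hh c hc hcA h6).2.1 x

end MA

open scoped Classical
namespace MA
open Set Topology Metric

lemma Cell.lo_mem {d : ℕ} (c : Cell d) : (fun i => (c.lo i : ℝ)) ∈ c.box := by
  intro i
  refine ⟨le_rfl, ?_⟩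
  push_cast
  rcases c.ind_cases i with h | h <;> simp [h.2]

lemma Cell.dist_le {d : ℕ} (c : Cell d) {x y : Fin d → ℝ} (hx : x ∈ c.box) (hy : y ∈ c.box) :
    dist x y ≤ 1 := by
  rw [dist_pi_le_iff zero_le_one]
  intro i
  rw [Real.dist_eq, abs_le]
  have h1 := hx i
  have h2 := hy i
  push_cast at h1 h2
  rcases c.ind_cases i with ⟨_, h⟩ | ⟨_, h⟩ <;> rw [h] at h1 h2 <;> push_cast at h1 h2 <;>
    constructor <;> linarith [h1.1, h1.2, h2.1, h2.2]

lemma exists_abs_eq_norm {d : ℕ} (x : Fin d → ℝ) (hx : 0 < ‖x‖) : ∃ i, |x i| = ‖x‖ := by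
  by_contra h
  push Not at h
  have : ‖x‖ < ‖x‖ := by
    rw [pi_norm_lt_iff hx]
    intro i
    exact lt_of_le_of_ne (norm_le_pi_norm x i) (h i)
  exact lt_irrefl _ this

lemma sphere_patch {d : ℕ} {Y ι : Type*} [TopologicalSpace Y] (G : Set (Sph d))
    (O : ι → Set (Sph d)) (hG : IsOpen G) (hO : ∀ a, IsOpen (O a))
    (hdisj : ∀ a b, a ≠ b → Disjoint (O a) (O b)) (hcov : ∀ x, x ∈ G ∨ ∃ a, x ∈ O a)
    (ρ : Sph d → Y) (hρ : ContinuousOn ρ G) (S : ι → Set Y)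
    (hρS : ∀ a, ∀ x ∈ O a, x ∈ G → ρ x ∈ S a) (hEP : ∀ a, ∀ j < d, EP j (S a)) :
    ∃ g : Sph d → Y, Continuous g ∧ ∀ x, (x ∈ G ∧ g x = ρ x) ∨ ∃ a, x ∈ O a ∧ g x ∈ S a := by
  by_cases hne : IsEmpty (Sph d)
  · exact ⟨ρ, continuous_of_discreteTopology, fun x => hne.elim x⟩
  rw [not_isEmpty_iff] at hne
  have hd : 0 < d := by
    rcases Nat.eq_zero_or_pos d with h | h
    · subst h
      obtain ⟨x⟩ := hne
      have h1 : ‖(x : Fin 0 → ℝ)‖ = 1 := mem_sphere_zero_iff_norm.1 x.2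
      have h2 : (x : Fin 0 → ℝ) = 0 := Subsingleton.elim _ _
      rw [h2, norm_zero] at h1
      norm_num at h1
    · exact h
  have huniq : ∀ a b x, x ∈ O a → x ∈ O b → a = b := by
    intro a b x ha hb
    by_contra hab
    exact (Set.disjoint_left.1 (hdisj a b hab)) ha hb
  let cv : Option ι → Set (Sph d) := fun o => o.elim G O
  obtain ⟨δ, hδ, hleb⟩ := lebesgue_number_lemma_of_metric (isCompact_univ (X := Sph d))
    (c := cv) (by rintro (_ | a); exacts [hG, hO a]) (by
      intro x _
      rcases hcov x with h | ⟨a, h⟩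
      · exact mem_iUnion.2 ⟨none, h⟩
      · exact mem_iUnion.2 ⟨some a, h⟩)
  obtain ⟨M, hM⟩ := exists_nat_gt (1 / δ)
  have hM0 : (0 : ℝ) < M := lt_trans (by positivity) hM
  have hMδ : (M : ℝ)⁻¹ < δ := by
    rw [inv_lt_comm₀ hM0 hδ]; simpa using hM
  let p : (Fin d → ℝ) → Sph d := fun x =>
    if h : (M : ℝ)⁻¹ • x ∈ sphere (0 : Fin d → ℝ) 1 then ⟨_, h⟩ else Classical.arbitrary _
  have hsc : ∀ x : Fin d → ℝ, ‖x‖ = M → (M : ℝ)⁻¹ • x ∈ sphere (0 : Fin d → ℝ) 1 := by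
    intro x hx
    rw [mem_sphere_zero_iff_norm, norm_smul, hx]
    simp [hM0.ne']
  have hp : ∀ x : Fin d → ℝ, ‖x‖ = M → (p x : Fin d → ℝ) = (M : ℝ)⁻¹ • x := by
    intro x hx
    simp only [p, hsc x hx, dite_true]
  have hpc : ContinuousOn p {x | ‖x‖ = M} := by
    rw [Topology.IsInducing.subtypeVal.continuousOn_iff]
    refine ContinuousOn.congr (f := fun x => (M : ℝ)⁻¹ • x) (by fun_prop) ?_
    intro x hx
    exact hp x hx
  let 𝒞 : Set (Cell d) := {c | ∀ x ∈ c.box, ‖x‖ = M}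
  let 𝒜 : Set (Cell d) := {c | c ∈ 𝒞 ∧ ∀ x ∈ c.box, p x ∈ G}
  have hfin : 𝒞.Finite := by
    have hinj : Function.Injective (fun c : Cell d => (c.lo, c.S)) := by
      rintro ⟨a, b⟩ ⟨a', b'⟩ h
      simpa using h
    refine Set.Finite.of_finite_image (f := fun c : Cell d => (c.lo, c.S)) ?_ hinj.injOn
    refine Set.Finite.subset (s := (Set.univ.pi fun _ => Set.Icc (-(M : ℤ)) M) ×ˢ Set.univ)
      ((Set.Finite.pi fun _ => Set.finite_Icc _ _).prod (Set.toFinite _)) ?_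
    rintro _ ⟨c, hc, rfl⟩
    refine ⟨fun i _ => ?_, mem_univ _⟩
    have h1 := hc _ c.lo_mem
    have h2 := norm_le_pi_norm (fun i => (c.lo i : ℝ)) i
    rw [h1, Real.norm_eq_abs, abs_le] at h2
    constructor
    · have := h2.1; simp only; exact_mod_cast this
    · have := h2.2; simp only; exact_mod_cast this
  have hcell : ∀ c ∈ 𝒞, c ∉ 𝒜 → ∃ a, ∀ x ∈ c.box, p x ∈ O a := by
    intro c hc hcA
    obtain ⟨o, ho⟩ := hleb (p fun i => c.lo i) (mem_univ _)
    have hin : ∀ x ∈ c.box, p x ∈ cv o := by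
      intro x hx
      apply ho
      rw [mem_ball, Subtype.dist_eq, hp _ (hc _ hx), hp _ (hc _ c.lo_mem), dist_smul₀,
        Real.norm_eq_abs, abs_of_pos (inv_pos.2 hM0)]
      calc (M : ℝ)⁻¹ * _ ≤ (M : ℝ)⁻¹ * 1 :=
            mul_le_mul_of_nonneg_left (c.dist_le hx c.lo_mem) (inv_pos.2 hM0).le
        _ < δ := by simpa using hMδ
    rcases o with _ | a
    · exact absurd ⟨hc, hin⟩ hcA
    · exact ⟨a, hin⟩
  let K : Cell d → Set Y := fun c => {y | ∃ a, (∀ x ∈ c.box, p x ∈ O a) ∧ y ∈ S a}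
  have hKeq : ∀ c a, (∀ x ∈ Cell.box c, p x ∈ O a) → K c = S a := by
    intro c a ha
    ext y
    constructor
    · rintro ⟨b, hb, hy⟩
      rwa [huniq a b _ (ha _ c.lo_mem) (hb _ c.lo_mem)]
    · intro hy; exact ⟨a, ha, hy⟩
  have hdim : ∀ c ∈ 𝒞, c.S.card < d := by
    intro c hc
    by_contra hcd
    have hu : c.S = Finset.univ := by
      apply Finset.eq_univ_of_card
      have := Finset.card_le_univ c.S
      simp at this ⊢; omega
    have hmem : (fun i => (c.lo i : ℝ) + 1 / 2) ∈ c.box := by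
      intro i
      rw [Cell.ind_mem (by simp [hu])]
      push_cast
      constructor <;> linarith
    have h1 := hc _ hmem
    obtain ⟨i, hi⟩ := exists_abs_eq_norm _ (by rw [h1]; exact hM0)
    rw [h1] at hi
    rcases (abs_eq hM0.le).1 hi with h | h
    · have : ((2 * c.lo i + 1 : ℤ) : ℝ) = ((2 * M : ℤ) : ℝ) := by push_cast; linarith
      have := Int.cast_inj.1 this
      omega
    · have : ((2 * c.lo i + 1 : ℤ) : ℝ) = ((-(2 * M) : ℤ) : ℝ) := by push_cast; linarith
      have := Int.cast_inj.1 this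
      omega
  obtain ⟨g, g1, g2, g3⟩ := grid_extension 𝒞 𝒜 hfin
    (fun c hc c' hf x hx => hc x (hf.box hx))
    (fun c hc c' hf => ⟨fun x hx => hc.1 x (hf.box hx), fun x hx => hc.2 x (hf.box hx)⟩)
    (fun c hc => hc.1) K
    (by
      rintro c hc hcA c' hf hcA' y ⟨a, ha, hy⟩
      obtain ⟨b, hb⟩ := hcell c hc hcA
      have := huniq a b _ (ha _ c'.lo_mem) (hb _ (hf.box c'.lo_mem))
      subst this
      exact ⟨a, hb, hy⟩)
    (fun x => ρ (p x))
    (by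
      intro c hc
      exact hρ.comp (hpc.mono fun x hx => hc.1 x hx) fun x hx => hc.2 x hx)
    (by
      intro c hc hcA c' hc' hf x hx
      obtain ⟨b, hb⟩ := hcell c hc hcA
      exact ⟨b, hb, hρS b _ (hb _ (hf.box hx)) (hc'.2 x hx)⟩)
    (by
      intro c hc hcA
      obtain ⟨b, hb⟩ := hcell c hc hcA
      rw [hKeq c b hb]
      exact hEP b _ (hdim c hc))
    d
  have hcover : ∀ x : Sph d, ∃ c ∈ 𝒞, (M : ℝ) • (x : Fin d → ℝ) ∈ c.box := by
    intro x
    have hx : ‖(x : Fin d → ℝ)‖ = 1 := mem_sphere_zero_iff_norm.1 x.2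
    have hxi : ∀ i, |(x : Fin d → ℝ) i| ≤ 1 := fun i => by
      have := norm_le_pi_norm (x : Fin d → ℝ) i; rwa [hx] at this
    let y : Fin d → ℝ := (M : ℝ) • (x : Fin d → ℝ)
    have hyi : ∀ i, -(M : ℝ) ≤ y i ∧ y i ≤ M := fun i => by
      have := abs_le.1 (hxi i)
      simp only [y, Pi.smul_apply, smul_eq_mul]
      constructor <;> nlinarith [this.1, this.2]
    let c : Cell d := ⟨fun i => ⌊y i⌋, Finset.univ.filter fun i => y i ≠ ⌊y i⌋⟩
    have hfl : ∀ i, -(M : ℤ) ≤ ⌊y i⌋ ∧ ⌊y i⌋ + c.ind i ≤ M := fun i => by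
      refine ⟨Int.le_floor.2 (by push_cast; exact (hyi i).1), ?_⟩
      rcases c.ind_cases i with ⟨h, h'⟩ | ⟨h, h'⟩
      · rw [h']
        have hne : y i ≠ ⌊y i⌋ := by simpa [c] using h
        have h1 : (⌊y i⌋ : ℝ) < y i := lt_of_le_of_ne (Int.floor_le _) hne.symm
        have h2 : (⌊y i⌋ : ℝ) < ((M : ℤ) : ℝ) := by push_cast; linarith [(hyi i).2]
        have := Int.cast_lt.1 h2
        omega
      · rw [h', add_zero]
        have h2 : (⌊y i⌋ : ℝ) ≤ ((M : ℤ) : ℝ) := by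
          push_cast; linarith [(hyi i).2, Int.floor_le (y i)]
        exact Int.cast_le.1 h2
    refine ⟨c, ?_, ?_⟩
    · intro z hz
      apply le_antisymm
      · rw [pi_norm_le_iff_of_nonneg hM0.le]
        intro i
        rw [Real.norm_eq_abs, abs_le]
        have h1 : ((-(M : ℤ) : ℤ) : ℝ) ≤ ⌊y i⌋ := Int.cast_le.2 (hfl i).1
        have h2 : ((⌊y i⌋ + c.ind i : ℤ) : ℝ) ≤ ((M : ℤ) : ℝ) := Int.cast_le.2 (hfl i).2
        have h3 := hz i
        push_cast at h1 h2 h3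
        exact ⟨h1.trans h3.1, h3.2.trans h2⟩
      · obtain ⟨i, hi⟩ := exists_abs_eq_norm (x : Fin d → ℝ) (by rw [hx]; exact one_pos)
        rw [hx] at hi
        have hyz : ∃ m : ℤ, y i = m ∧ |(m : ℝ)| = M := by
          rcases (abs_eq one_pos.le).1 hi with h | h
          · exact ⟨M, by simp [y, h], by simp⟩
          · exact ⟨-M, by simp [y, h], by simp⟩
        obtain ⟨m, hm, hmM⟩ := hyz
        have h3 := hz i
        have h4 : c.ind i = 0 := Cell.ind_nmem (by simp [c, hm])
        rw [h4] at h3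
        have h5 : c.lo i = m := by simp [c, hm]
        rw [h5] at h3
        push_cast at h3
        have h6 : z i = m := by linarith [h3.1, h3.2]
        rw [← hmM, ← h6]
        exact norm_le_pi_norm z i
    · intro i
      refine ⟨Int.floor_le _, ?_⟩
      rcases c.ind_cases i with ⟨h, h'⟩ | ⟨h, h'⟩
      · rw [h']; push_cast; exact (Int.lt_floor_add_one (y i)).le
      · rw [h']
        have : y i = ⌊y i⌋ := by
          by_contra h3
          exact h (by simpa [c] using h3)
        push_cast; rw [add_zero]; exact this.le
  have hpM : ∀ x : Sph d, p ((M : ℝ) • (x : Fin d → ℝ)) = x := by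
    intro x
    have hx : ‖(x : Fin d → ℝ)‖ = 1 := mem_sphere_zero_iff_norm.1 x.2
    apply Subtype.ext
    rw [hp _ (by rw [norm_smul, hx]; simp), smul_smul, inv_mul_cancel₀ hM0.ne', one_smul]
  refine ⟨fun x => g ((M : ℝ) • (x : Fin d → ℝ)), ?_, ?_⟩
  · have : ContinuousOn g (⋃ c ∈ 𝒞, c.box) :=
      continuousOn_biUnion_of_finite hfin (fun c _ => c.isClosed_box)
        fun c hc => g1 c hc (Or.inr (hdim c hc))
    refine this.comp_continuous (by fun_prop) fun x => ?_
    obtain ⟨c, hc, hx⟩ := hcover x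
    exact mem_biUnion hc hx
  · intro x
    obtain ⟨c, hc, hx⟩ := hcover x
    by_cases hcA : c ∈ 𝒜
    · left
      have h1 := hcA.2 _ hx
      rw [hpM] at h1
      refine ⟨h1, ?_⟩
      simp only
      rw [g2 c hcA _ hx, hpM]
    · right
      obtain ⟨a, ha, hy⟩ := g3 c hc hcA (hdim c hc) _ hx
      refine ⟨a, ?_, hy⟩
      have := ha _ hx
      rwa [hpM] at this
end MA

open scoped Classical
namespace MA
open Set Topology Metric

section Rdef
variable {V : Type*}

/-- closed simplex -/
def Del (σ : Finset V) : Set (V → ℝ) :=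
  {f | (∀ v, 0 ≤ f v) ∧ (∀ v, v ∉ σ → f v = 0) ∧ ∑ v ∈ σ, f v = 1}

def RR (F : Set (Finset V)) : Set (V → ℝ) := {f | ∃ σ ∈ F, f ∈ Del σ}

def DownC (F : Set (Finset V)) : Prop :=
  (∀ σ ∈ F, σ.Nonempty) ∧ ∀ σ ∈ F, ∀ τ : Finset V, τ ⊆ σ → τ.Nonempty → τ ∈ F

lemma Del.mono {σ τ : Finset V} (h : σ ⊆ τ) : Del σ ⊆ Del τ := by
  rintro f ⟨h0, h1, h2⟩
  refine ⟨h0, fun v hv => h1 v fun h' => hv (h h'), ?_⟩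
  rw [← h2]
  exact (Finset.sum_subset h fun v _ hv => h1 v hv).symm

lemma Del.sum_of_subset {σ τ : Finset V} {f : V → ℝ} (hf : f ∈ Del σ)
    (h : ∀ v, f v ≠ 0 → v ∈ τ) : f ∈ Del τ := by
  obtain ⟨h0, h1, h2⟩ := hf
  refine ⟨h0, fun v hv => ?_, ?_⟩
  · by_contra h3; exact hv (h v h3)
  · rw [← h2]
    have e1 : ∑ v ∈ σ, f v = ∑ v ∈ σ ∪ τ, f v :=
      Finset.sum_subset Finset.subset_union_left fun v _ hv => h1 v hv
    have e2 : ∑ v ∈ τ, f v = ∑ v ∈ σ ∪ τ, f v :=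
      Finset.sum_subset Finset.subset_union_right fun v _ hv => by
        by_contra h3; exact hv (h v h3)
    rw [e1, e2]

/-- exact support face -/
lemma RR.exists_supp {F : Set (Finset V)} (hF : DownC F) {f : V → ℝ} (hf : f ∈ RR F) :
    ∃ σ ∈ F, f ∈ Del σ ∧ ∀ v, v ∈ σ ↔ f v ≠ 0 := by
  obtain ⟨σ, hσ, hf⟩ := hf
  let τ := σ.filter fun v => f v ≠ 0
  have hτ : ∀ v, v ∈ τ ↔ f v ≠ 0 := by
    intro v
    simp only [τ, Finset.mem_filter, and_iff_right_iff_imp]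
    intro h; by_contra h'; exact h (hf.2.1 v h')
  have hfτ := Del.sum_of_subset hf fun v hv => (hτ v).2 hv
  refine ⟨τ, hF.2 σ hσ τ (Finset.filter_subset _ _) ?_, hfτ, hτ⟩
  rw [Finset.nonempty_iff_ne_empty]
  intro h0
  have := hfτ.2.2
  rw [h0] at this
  simp at this

lemma Del.convex_comb {σ : Finset V} {f g : V → ℝ} (hf : f ∈ Del σ) (hg : g ∈ Del σ) {t : ℝ}
    (h0 : 0 ≤ t) (h1 : t ≤ 1) : (fun v => (1 - t) * f v + t * g v) ∈ Del σ := by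
  refine ⟨fun v => ?_, fun v hv => ?_, ?_⟩
  · have := hf.1 v; have := hg.1 v; have : 0 ≤ 1 - t := by linarith
    positivity
  · simp only [hf.2.1 v hv, hg.2.1 v hv]; ring
  · rw [Finset.sum_add_distrib, ← Finset.mul_sum, ← Finset.mul_sum, hf.2.2, hg.2.2]; ring

lemma RR.mono {F F' : Set (Finset V)} (h : F ⊆ F') : RR F ⊆ RR F' := by
  rintro f ⟨σ, hσ, hf⟩; exact ⟨σ, h hσ, hf⟩

lemma Del.le_one {σ : Finset V} {f : V → ℝ} (hf : f ∈ Del σ) (s : Finset V) :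
    ∑ v ∈ s, f v ≤ 1 := by
  rw [← (Del.mono (Finset.subset_union_left (s₁ := σ) (s₂ := s)) hf).2.2]
  exact Finset.sum_le_sum_of_subset_of_nonneg Finset.subset_union_right fun v _ _ => hf.1 v

end Rdef

noncomputable section
/-- radial projection -/
def rad {d : ℕ} [Nonempty (Sph d)] (x : Fin d → ℝ) : Sph d :=
  if h : ‖x‖⁻¹ • x ∈ sphere (0 : Fin d → ℝ) 1 then ⟨_, h⟩ else Classical.arbitrary _

lemma rad_mem {d : ℕ} {x : Fin d → ℝ} (hx : x ≠ 0) : ‖x‖⁻¹ • x ∈ sphere (0 : Fin d → ℝ) 1 := by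
  rw [mem_sphere_zero_iff_norm, norm_smul, norm_inv, norm_norm, inv_mul_cancel₀]
  exact norm_ne_zero_iff.2 hx

lemma rad_val {d : ℕ} [Nonempty (Sph d)] {x : Fin d → ℝ} (hx : x ≠ 0) :
    (rad x : Fin d → ℝ) = ‖x‖⁻¹ • x := by
  unfold rad; rw [dif_pos (rad_mem hx)]

lemma rad_cont {d : ℕ} [Nonempty (Sph d)] : ContinuousOn (rad (d := d)) {x | x ≠ 0} := by
  rw [Topology.IsInducing.subtypeVal.continuousOn_iff]
  refine ContinuousOn.congr (f := fun x => ‖x‖⁻¹ • x) ?_ fun x hx => rad_val hx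
  refine ContinuousOn.smul (ContinuousOn.inv₀ continuous_norm.continuousOn ?_) continuousOn_id
  intro x hx; exact norm_ne_zero_iff.2 hx

lemma rad_sph {d : ℕ} [Nonempty (Sph d)] (x : Sph d) (t : ℝ) (ht : 0 < t) :
    rad (t • (x : Fin d → ℝ)) = x := by
  have hx : ‖(x : Fin d → ℝ)‖ = 1 := mem_sphere_zero_iff_norm.1 x.2
  have hx0 : (x : Fin d → ℝ) ≠ 0 := by intro h; rw [h, norm_zero] at hx; norm_num at hx
  apply Subtype.ext
  rw [rad_val (smul_ne_zero ht.ne' hx0), norm_smul, hx, smul_smul, Real.norm_eq_abs,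
    abs_of_pos ht, mul_one, inv_mul_cancel₀ ht.ne', one_smul]

/-- homotopy extension, general homotopy -/
lemma Fill.of_homotopy {d : ℕ} {Y : Type*} [TopologicalSpace Y] {S : Set Y} {f g : Sph d → Y}
    (H : ℝ × Sph d → Y) (hH : ContinuousOn H (Icc 0 1 ×ˢ univ))
    (hS : ∀ t ∈ Icc (0 : ℝ) 1, ∀ x, H (t, x) ∈ S) (h0 : ∀ x, H (0, x) = g x)
    (h1 : ∀ x, H (1, x) = f x) (hg : Fill d S g) : Fill d S f := by
  obtain ⟨G, hG, hGS, hGg⟩ := hg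
  by_cases hne : IsEmpty (Sph d)
  · exact ⟨G, hG, hGS, fun x => hne.elim x⟩
  rw [not_isEmpty_iff] at hne
  let τ : (Fin d → ℝ) → ℝ := fun x => max 0 (min 1 (2 * ‖x‖ - 1))
  have hτ : ∀ x, τ x ∈ Icc (0 : ℝ) 1 := fun x => ⟨le_max_left _ _, by simp [τ]⟩
  have hτc : Continuous τ := by fun_prop
  refine ⟨fun x => if ‖x‖ ≤ 1 / 2 then G ((2 : ℝ) • x) else H (τ x, rad x), ?_, ?_, ?_⟩
  · refine continuous_if_le continuous_norm continuous_const (by fun_prop) ?_ ?_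
    · refine hH.comp (hτc.continuousOn.prodMk (rad_cont.mono ?_)) fun x _ => ⟨hτ x, mem_univ _⟩
      intro x hx h0
      simp only [mem_ofPred_eq] at hx
      rw [h0, norm_zero] at hx; norm_num at hx
    · intro x hx
      have hx0 : x ≠ 0 := by intro h; rw [h, norm_zero] at hx; norm_num at hx
      have : τ x = 0 := by simp [τ, hx]
      rw [this, h0, ← hGg, rad_val hx0, hx]; norm_num
  · intro x
    beta_reduce; split_ifs
    · exact hGS _
    · exact hS _ (hτ x) _
  · intro x
    have hx : ‖(x : Fin d → ℝ)‖ = 1 := mem_sphere_zero_iff_norm.1 x.2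
    have h2 : ¬ ‖(x : Fin d → ℝ)‖ ≤ 1 / 2 := by rw [hx]; norm_num
    have h3 : τ x = 1 := by simp only [τ, hx]; norm_num
    have h4 := rad_sph x 1 one_pos
    rw [one_smul] at h4
    simp only [h2, if_false, h3, h4, h1]

lemma Fill.contig {d : ℕ} {V : Type*} {F : Set (Finset V)} {f g : Sph d → V → ℝ}
    (hf : Continuous f) (hg : Continuous g) (h : ∀ x, ∃ σ ∈ F, f x ∈ Del σ ∧ g x ∈ Del σ)
    (hG : Fill d (RR F) g) : Fill d (RR F) f := by
  refine Fill.of_homotopy (fun p v => (1 - p.1) * g p.2 v + p.1 * f p.2 v) ?_ ?_ ?_ ?_ hG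
  · apply Continuous.continuousOn
    refine continuous_pi fun v => ?_
    have h1 : Continuous fun p : ℝ × Sph d => g p.2 v :=
      (continuous_apply v).comp (hg.comp continuous_snd)
    have h2 : Continuous fun p : ℝ × Sph d => f p.2 v :=
      (continuous_apply v).comp (hf.comp continuous_snd)
    fun_prop
  · intro t ht x
    obtain ⟨σ, hσ, h1, h2⟩ := h x
    exact ⟨σ, hσ, Del.convex_comb h2 h1 ht.1 ht.2⟩
  · intro x; ext v; simp
  · intro x; ext v; simp

section trunc
variable {V : Type*}

def trunc (W : Finset V) (f : V → ℝ) : V → ℝ := fun v => if v ∈ W then f v / ∑ w ∈ W, f w else 0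

lemma exists_trunc {X : Type*} [TopologicalSpace X] [CompactSpace X] {F : Set (Finset V)}
    {f : X → V → ℝ} (hf : Continuous f) (hF : ∀ x, f x ∈ RR F) :
    ∃ W : Finset V, ∀ W', W ⊆ W' → ∀ x, 0 < ∑ w ∈ W', f x w := by
  have hpos : ∀ x v, 0 ≤ f x v := fun x v => by
    obtain ⟨σ, _, h⟩ := hF x; exact h.1 v
  obtain ⟨W, hW⟩ := (isCompact_univ (X := X)).elim_finite_subcover (fun v => {x | 0 < f x v})
    (fun v => isOpen_lt continuous_const ((continuous_apply v).comp hf)) (by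
      intro x _
      obtain ⟨σ, _, h⟩ := hF x
      by_contra hx
      have : ∑ v ∈ σ, f x v = 0 := Finset.sum_eq_zero fun v _ => by
        by_contra h0
        exact hx (mem_iUnion.2 ⟨v, lt_of_le_of_ne (hpos x v) (Ne.symm h0)⟩)
      rw [h.2.2] at this; norm_num at this)
  refine ⟨W, fun W' hWW x => ?_⟩
  have := hW (mem_univ x)
  simp only [mem_iUnion] at this
  obtain ⟨v, hv, hx⟩ := this
  exact Finset.sum_pos' (fun w _ => hpos x w) ⟨v, hWW hv, hx⟩

lemma trunc_mem {W σ : Finset V} {f : V → ℝ} (hf : f ∈ Del σ) (h : 0 < ∑ w ∈ W, f w) :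
    trunc W f ∈ Del (σ ∩ W) := by
  have h1 : trunc W f ∈ Del W := by
    refine ⟨fun v => ?_, fun v hv => by simp [trunc, hv], ?_⟩
    · unfold trunc; split_ifs
      · exact div_nonneg (hf.1 v) h.le
      · exact le_rfl
    · have : ∑ v ∈ W, trunc W f v = ∑ v ∈ W, f v / ∑ w ∈ W, f w :=
        Finset.sum_congr rfl fun v hv => by simp [trunc, hv]
      rw [this, ← Finset.sum_div, div_self h.ne']
  refine Del.sum_of_subset h1 fun v hv => ?_
  by_contra h2
  apply hv
  unfold trunc
  split_ifs with h3
  · have : f v = 0 := hf.2.1 v fun h4 => h2 (Finset.mem_inter.2 ⟨h4, h3⟩)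
    simp [this]
  · rfl

lemma trunc_cont {X : Type*} [TopologicalSpace X] {W : Finset V} {f : X → V → ℝ}
    (hf : Continuous f) (h : ∀ x, 0 < ∑ w ∈ W, f x w) : Continuous fun x => trunc W (f x) := by
  refine continuous_pi fun v => ?_
  have hv : ∀ w, Continuous fun x => f x w := fun w => (continuous_apply w).comp hf
  by_cases hw : v ∈ W
  · simp only [trunc, hw, if_true]
    exact (hv v).div (continuous_finsetSum _ fun w _ => hv w) fun x => (h x).ne'
  · simp only [trunc, hw, if_false]; exact continuous_const

lemma trunc_eq {W σ : Finset V} {f : V → ℝ} (hf : f ∈ Del σ) (h : ∀ v, f v ≠ 0 → v ∈ W) :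
    trunc W f = f := by
  have h1 := (Del.sum_of_subset hf h).2.2
  ext v
  unfold trunc
  split_ifs with h2
  · rw [h1, div_one]
  · by_contra h3; exact h2 (h v (Ne.symm h3))

/-- reduce to finite support -/
lemma Fill.of_trunc {d : ℕ} {F : Set (Finset V)} {f : Sph d → V → ℝ} (hf : Continuous f)
    (hF : ∀ x, f x ∈ RR F) {W : Finset V} (hW : ∀ x, 0 < ∑ w ∈ W, f x w)
    (h : Fill d (RR F) fun x => trunc W (f x)) : Fill d (RR F) f := by
  refine Fill.contig hf (trunc_cont hf hW) (fun x => ?_) h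
  obtain ⟨σ, hσ, hx⟩ := hF x
  exact ⟨σ, hσ, hx, Del.mono Finset.inter_subset_left (trunc_mem hx (hW x))⟩

end trunc

section link
variable {V : Type*} {d : ℕ} {F : Set (Finset V)} {A : Finset V}

def phi (A : Finset V) (f : V → ℝ) : ℝ := ∑ a ∈ A, f a
def rho (A : Finset V) (f : V → ℝ) : V → ℝ := fun v => if v ∈ A then 0 else f v / (1 - phi A f)

def NonAdj (F : Set (Finset V)) (A : Finset V) : Prop :=
  ∀ σ ∈ F, ∀ a ∈ A, ∀ b ∈ A, a ∈ σ → b ∈ σ → a = b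

lemma phi_cont {f : Sph d → V → ℝ} (hf : Continuous f) : Continuous fun x => phi A (f x) :=
  continuous_finsetSum _ fun a _ => (continuous_apply a).comp hf

lemma rho_mem {σ : Finset V} {f : V → ℝ} (hf : f ∈ Del σ) (h : phi A f < 1) :
    rho A f ∈ Del (σ \ A) := by
  have h1 : 0 < 1 - phi A f := by linarith
  refine ⟨fun v => ?_, fun v hv => ?_, ?_⟩
  · unfold rho; split_ifs
    · exact le_rfl
    · exact div_nonneg (hf.1 v) h1.le
  · unfold rho; split_ifs with h2
    · rfl
    · rw [hf.2.1 v fun h3 => hv (Finset.mem_sdiff.2 ⟨h3, h2⟩), zero_div]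
  · have e1 : ∑ v ∈ σ \ A, rho A f v = ∑ v ∈ σ \ A, f v / (1 - phi A f) :=
      Finset.sum_congr rfl fun v hv => by simp [rho, (Finset.mem_sdiff.1 hv).2]
    have e2 : ∑ v ∈ σ \ A, f v + phi A f = 1 := by
      rw [← (Del.mono (Finset.subset_union_left (s₁ := σ) (s₂ := A)) hf).2.2,
        ← Finset.sdiff_union_self_eq_union, Finset.sum_union Finset.sdiff_disjoint]
      rfl
    rw [e1, ← Finset.sum_div, div_eq_one_iff_eq h1.ne']
    linarith

/-- link homotopy, part b -/
lemma Fill.link_iff (hdown : DownC F) (hA : NonAdj F A) {f g : Sph d → V → ℝ}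
    (hf : Continuous f) (hfF : ∀ x, f x ∈ RR F) (hg : Continuous g)
    (h : ∀ x, (phi A (f x) < 1 ∧ g x = rho A (f x)) ∨
      ∃ a ∈ A, 1 / 2 < phi A (f x) ∧ 0 < f x a ∧ ∃ τ, insert a τ ∈ F ∧ g x ∈ Del τ) :
    Fill d (RR F) g ↔ Fill d (RR F) f := by
  let θ : ℝ → ℝ := fun p => max 0 (min 1 (4 * p - 1))
  let α : ℝ → ℝ := fun p => (1 - θ p) + θ p / max p (1 / 4)
  have hm : ∀ p : ℝ, 0 < max p (1 / 4) := fun p => lt_of_lt_of_le (by norm_num) (le_max_right _ _)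
  have hθc : Continuous θ := by fun_prop
  have hαc : Continuous α :=
    (continuous_const.sub hθc).add (hθc.div (by fun_prop) fun p => (hm p).ne')
  have hθ0 : ∀ p, 0 ≤ θ p := fun p => le_max_left _ _
  have hθ1 : ∀ p, θ p ≤ 1 := fun p => by simp [θ]
  let f1 : Sph d → V → ℝ := fun x v =>
    f x v * (if v ∈ A then α (phi A (f x)) else 1 - θ (phi A (f x)))
  have hphi := phi_cont (A := A) hf
  have hf1c : Continuous f1 := by
    refine continuous_pi fun v => ?_
    have hv : Continuous fun x => f x v := (continuous_apply v).comp hf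
    by_cases hw : v ∈ A
    · simp only [f1, hw, if_true]; exact hv.mul (hαc.comp hphi)
    · simp only [f1, hw, if_false]; exact hv.mul (continuous_const.sub (hθc.comp hphi))
  have hf1 : ∀ x σ, f x ∈ Del σ → f1 x ∈ Del σ := by
    intro x σ hx
    set p := phi A (f x) with hp
    refine ⟨fun v => ?_, fun v hv => by simp [f1, hx.2.1 v hv], ?_⟩
    · refine mul_nonneg (hx.1 v) ?_
      split_ifs
      · have := hθ0 p; have := hθ1 p; have := hm p
        have : 0 ≤ 1 - θ p := by linarith
        positivity
      · linarith [hθ1 p]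
    · have h1 : f1 x ∈ {k : V → ℝ | True} := trivial
      have hU := Del.mono (Finset.subset_union_left (s₁ := σ) (s₂ := A)) hx
      have e0 : ∑ v ∈ σ, f1 x v = ∑ v ∈ σ ∪ A, f1 x v :=
        Finset.sum_subset Finset.subset_union_left fun v _ hv => by simp [f1, hx.2.1 v hv]
      have e1 : ∑ v ∈ σ \ A, f x v + p = 1 := by
        rw [← hU.2.2, ← Finset.sdiff_union_self_eq_union, Finset.sum_union Finset.sdiff_disjoint]
        rfl
      rw [e0, ← Finset.sdiff_union_self_eq_union, Finset.sum_union Finset.sdiff_disjoint]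
      have e2 : ∑ v ∈ σ \ A, f1 x v = (∑ v ∈ σ \ A, f x v) * (1 - θ p) := by
        rw [Finset.sum_mul]
        exact Finset.sum_congr rfl fun v hv => by simp [f1, (Finset.mem_sdiff.1 hv).2, hp]
      have e3 : ∑ v ∈ A, f1 x v = p * α p := by
        rw [hp, phi, Finset.sum_mul]
        exact Finset.sum_congr rfl fun v hv => by simp [f1, hv, phi]
      rw [e2, e3]
      have e4 : ∑ v ∈ σ \ A, f x v = 1 - p := by linarith
      have e5 : θ p * (p / max p (1 / 4)) = θ p := by
        by_cases h4 : p ≤ 1 / 4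
        · have : θ p = 0 := by
            apply max_eq_left
            exact (min_le_right _ _).trans (by linarith)
          rw [this]; ring
        · have : max p (1 / 4) = p := max_eq_left (by linarith)
          rw [this, div_self (by intro h0; rw [h0] at h4; norm_num at h4), mul_one]
      rw [e4]
      have : p * α p = p * (1 - θ p) + θ p * (p / max p (1 / 4)) := by simp only [α]; ring
      rw [this, e5]; ring
  have c1 : ∀ x, ∃ σ ∈ F, f x ∈ Del σ ∧ f1 x ∈ Del σ := by
    intro x
    obtain ⟨σ, hσ, hx⟩ := hfF x
    exact ⟨σ, hσ, hx, hf1 x σ hx⟩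
  have c2 : ∀ x, ∃ σ ∈ F, f1 x ∈ Del σ ∧ g x ∈ Del σ := by
    intro x
    rcases h x with ⟨h1, h2⟩ | ⟨a, ha, h1, h2, τ, hτ, h3⟩
    · obtain ⟨σ, hσ, hx⟩ := hfF x
      refine ⟨σ, hσ, hf1 x σ hx, ?_⟩
      rw [h2]
      exact Del.mono Finset.sdiff_subset (rho_mem hx h1)
    · obtain ⟨σ, hσ, hx, hσs⟩ := RR.exists_supp hdown (hfF x)
      refine ⟨insert a τ, hτ, ?_, Del.mono (Finset.subset_insert _ _) h3⟩
      refine Del.sum_of_subset (hf1 x σ hx) fun v hv => ?_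
      have hθ : θ (phi A (f x)) = 1 := by
        have : min 1 (4 * phi A (f x) - 1) = 1 := min_eq_left (by linarith)
        simp only [θ, this]; norm_num
      have hvA : v ∈ A := by
        by_contra hvA
        apply hv; simp [f1, hvA, hθ]
      have hfv : f x v ≠ 0 := fun h0 => hv (by simp [f1, h0])
      have := hA σ hσ a ha v hvA ((hσs a).2 h2.ne') ((hσs v).2 hfv)
      rw [this]; exact Finset.mem_insert_self _ _
  refine ⟨fun hG => Fill.contig hf hf1c c1 (Fill.contig hf1c hg c2 hG), fun hG => ?_⟩
  refine Fill.contig hg hf1c (fun x => ?_) (Fill.contig hf1c hf (fun x => ?_) hG)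
  · obtain ⟨σ, h1, h2, h3⟩ := c2 x; exact ⟨σ, h1, h3, h2⟩
  · obtain ⟨σ, h1, h2, h3⟩ := c1 x; exact ⟨σ, h1, h3, h2⟩

lemma Fill.link (hdown : DownC F) (hA : NonAdj F A) {f g : Sph d → V → ℝ}
    (hf : Continuous f) (hfF : ∀ x, f x ∈ RR F) (hg : Continuous g)
    (h : ∀ x, (phi A (f x) < 1 ∧ g x = rho A (f x)) ∨
      ∃ a ∈ A, 1 / 2 < phi A (f x) ∧ 0 < f x a ∧ ∃ τ, insert a τ ∈ F ∧ g x ∈ Del τ)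
    (hG : Fill d (RR F) g) : Fill d (RR F) f := (Fill.link_iff hdown hA hf hfF hg h).1 hG

/-- link homotopy, part a : existence of `g`. -/
lemma exists_link (hdown : DownC F) (hA : NonAdj F A) {f : Sph d → V → ℝ}
    (hf : Continuous f) (hfF : ∀ x, f x ∈ RR F) (M : V → Set (Finset V))
    (hM : ∀ a ∈ A, ∀ j < d, EP j (RR (M a)))
    (hfM : ∀ x, ∀ a ∈ A, 0 < f x a → ∀ σ ∈ F, (∀ v, v ∈ σ ↔ f x v ≠ 0) →
      (σ.erase a).Nonempty → σ.erase a ∈ M a) :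
    ∃ g : Sph d → V → ℝ, Continuous g ∧
      ∀ x, (phi A (f x) < 1 ∧ g x = rho A (f x)) ∨
        ∃ a ∈ A, 1 / 2 < phi A (f x) ∧ 0 < f x a ∧ g x ∈ RR (M a) := by
  have hphi := phi_cont (A := A) hf
  have hv : ∀ v, Continuous fun x => f x v := fun v => (continuous_apply v).comp hf
  obtain ⟨g, hg, h⟩ := sphere_patch (ι := {a // a ∈ A}) {x : Sph d | phi A (f x) < 1}
    (fun a => {x | 1 / 2 < phi A (f x) ∧ 0 < f x a})
    (isOpen_lt hphi continuous_const)
    (fun a => (isOpen_lt continuous_const hphi).inter (isOpen_lt continuous_const (hv a)))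
    (by
      intro a b hab
      rw [Set.disjoint_left]
      rintro x ⟨_, h1⟩ ⟨_, h2⟩
      obtain ⟨σ, hσ, hx, hσs⟩ := RR.exists_supp hdown (hfF x)
      exact hab (Subtype.ext (hA σ hσ a a.2 b b.2 ((hσs a).2 h1.ne') ((hσs b).2 h2.ne'))))
    (by
      intro x
      obtain ⟨σ, hσ, hx, hσs⟩ := RR.exists_supp hdown (hfF x)
      by_cases h1 : phi A (f x) < 1
      · exact Or.inl h1
      · right
        have h2 : 0 < phi A (f x) := by linarith
        obtain ⟨a, ha, h3⟩ := Finset.exists_ne_zero_of_sum_ne_zero h2.ne'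
        exact ⟨⟨a, ha⟩, by show (1 : ℝ) / 2 < phi A (f x); linarith,
          lt_of_le_of_ne (hx.1 a) (Ne.symm h3)⟩)
    (fun x => rho A (f x))
    (by
      rw [continuousOn_pi]
      intro v
      by_cases hw : v ∈ A
      · simp only [rho, hw, if_true]; exact continuousOn_const
      · simp only [rho, hw, if_false]
        refine (hv v).continuousOn.div (continuous_const.sub hphi).continuousOn fun x hx => ?_
        simp only [mem_ofPred_eq] at hx
        linarith)
    (fun a => RR (M a))
    (by
      rintro ⟨a, ha⟩ x ⟨_, h1⟩ h2
      obtain ⟨σ, hσ, hx, hσs⟩ := RR.exists_supp hdown (hfF x)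
      have h3 := rho_mem hx h2
      have h4 : σ \ A = σ.erase a := by
        ext v
        simp only [Finset.mem_sdiff, Finset.mem_erase]
        constructor
        · rintro ⟨h5, h6⟩; exact ⟨fun h7 => h6 (h7 ▸ ha), h5⟩
        · rintro ⟨h5, h6⟩
          exact ⟨h6, fun h7 => h5 (hA σ hσ v h7 a ha h6 ((hσs a).2 h1.ne'))⟩
      rw [h4] at h3
      refine ⟨σ.erase a, hfM x a ha h1 σ hσ hσs ?_, h3⟩
      rw [Finset.nonempty_iff_ne_empty]
      intro h5
      have := h3.2.2
      rw [h5] at this; simp at this)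
    (fun a j hj => hM a a.2 j hj)
  refine ⟨g, hg, fun x => ?_⟩
  rcases h x with h1 | ⟨a, h1, h2⟩
  · exact Or.inl h1
  · exact Or.inr ⟨a, a.2, h1.1, h1.2, h2⟩
end link

lemma EP.congr_set {d : ℕ} {Y : Type*} [TopologicalSpace Y] {S T : Set Y} (h : S = T)
    (hS : EP d S) : EP d T := h ▸ hS

/-- a cone is fillable -/
lemma Fill.cone {d : ℕ} {V : Type*} {F : Set (Finset V)} (a : V) {f : Sph d → V → ℝ}
    (hf : Continuous f) (h : ∀ x, ∃ σ, insert a σ ∈ F ∧ f x ∈ Del σ) (ha : {a} ∈ F) :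
    Fill d (RR F) f := by
  have h1 : (fun v => if v = a then (1 : ℝ) else 0) ∈ Del {a} := by
    refine ⟨fun v => ?_, fun v hv => ?_, by simp⟩
    · beta_reduce; split_ifs <;> norm_num
    · simp at hv; simp [hv]
  refine Fill.contig (g := fun _ v => if v = a then (1 : ℝ) else 0) hf continuous_const ?_
    ⟨fun _ v => if v = a then (1 : ℝ) else 0, continuous_const, fun _ => ⟨{a}, ha, h1⟩,
      fun _ => rfl⟩
  intro x
  obtain ⟨σ, hσ, hx⟩ := h x
  exact ⟨_, hσ, Del.mono (Finset.subset_insert _ _) hx, Del.mono (by simp) h1⟩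

end
end MA

open scoped Classical
namespace MA
open Set Topology Metric

lemma sph1_abs (p : Sph 1) : |(p : Fin 1 → ℝ) 0| = 1 := by
  have h : ‖(p : Fin 1 → ℝ)‖ = 1 := mem_sphere_zero_iff_norm.1 p.2
  obtain ⟨i, hi⟩ := exists_abs_eq_norm (p : Fin 1 → ℝ) (by rw [h]; exact one_pos)
  rw [Subsingleton.elim i 0] at hi
  exact hi.trans h

lemma cont_coord {d : ℕ} (k : Fin d) : Continuous fun p : Sph d => (p : Fin d → ℝ) k :=
  (continuous_apply k).comp continuous_subtype_val

lemma joined_of_EP {Y : Type*} [TopologicalSpace Y] {S : Set Y} (h : EP 1 S) (x y : S) :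
    Joined x y := by
  obtain ⟨g, hg, hgS, hgf⟩ := h (fun p => if (p : Fin 1 → ℝ) 0 ≤ 0 then (x : Y) else y)
    (by
      refine Continuous.if_le continuous_const continuous_const (cont_coord 0) continuous_const ?_
      intro p hp
      have := sph1_abs p
      rw [hp] at this; norm_num at this)
    (by intro p; beta_reduce; split_ifs; exacts [x.2, y.2])
  refine ⟨⟨⟨fun t => ⟨g fun _ => 2 * (t : ℝ) - 1, hgS _⟩, ?_⟩, ?_, ?_⟩⟩
  · exact (hg.comp (by fun_prop)).subtype_mk _
  · apply Subtype.ext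
    have := hgf ⟨fun _ => -1, by rw [mem_sphere_zero_iff_norm]; simp [pi_norm_const]⟩
    simp only at this
    simpa using this
  · apply Subtype.ext
    have := hgf ⟨fun _ => 1, by rw [mem_sphere_zero_iff_norm]; simp [pi_norm_const]⟩
    simp only at this
    have h2 : ¬ ((1 : ℝ) ≤ 0) := by norm_num
    simp only [h2, if_false] at this
    show g (fun _ => 2 * (1 : ℝ) - 1) = _
    norm_num
    exact this

noncomputable def cl (t : ℝ) : unitInterval := projIcc 0 1 zero_le_one ((t + 1) / 2)
lemma cl_cont : Continuous cl := by unfold cl; exact continuous_projIcc.comp (by fun_prop)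
lemma cl_val (t : unitInterval) : cl (2 * (t : ℝ) - 1) = t := by
  unfold cl
  have : (2 * (t : ℝ) - 1 + 1) / 2 = t := by ring
  rw [this]; exact projIcc_val _ t

lemma pi_trivial_of_EP {Y : Type*} [TopologicalSpace Y] {S : Set Y} (i : ℕ)
    (h : EP (i + 1) S) (x : S) : Subsingleton (HomotopyGroup (Fin i) S x) := by
  refine ⟨fun a b => ?_⟩
  have key : ∀ f : GenLoop (Fin i) S x, GenLoop.Homotopic f GenLoop.const := by
    intro f
    let q : (Fin (i + 1) → ℝ) → (Fin i → unitInterval) := fun p j => cl (p j.succ)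
    have hq : Continuous q := continuous_pi fun j => cl_cont.comp (continuous_apply _)
    let F0 : Sph (i + 1) → Y := fun p =>
      if (p : Fin (i + 1) → ℝ) 0 = -1 then (f (q p) : Y) else x
    let A : Set (Sph (i + 1)) := {p | (p : Fin (i + 1) → ℝ) 0 = -1}
    let B : Set (Sph (i + 1)) := {p | (p : Fin (i + 1) → ℝ) 0 = 1} ∪
      ⋃ j : Fin i, {p | |(p : Fin (i + 1) → ℝ) j.succ| = 1}
    have hA : IsClosed A := isClosed_eq (cont_coord _) continuous_const
    have hB : IsClosed B := (isClosed_eq (cont_coord _) continuous_const).union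
      (isClosed_iUnion_of_finite fun j => isClosed_eq (cont_coord _).abs continuous_const)
    have hFA : ∀ p ∈ A, F0 p = f (q p) := fun p hp => by
      have hp' : (p : Fin (i + 1) → ℝ) 0 = -1 := hp
      simp only [F0, hp', if_true]
    have hbd : ∀ p : Fin (i + 1) → ℝ, (∃ j : Fin i, |p j.succ| = 1) → f (q p) = x := by
      rintro p ⟨j, hj⟩
      apply f.2
      refine ⟨j, ?_⟩
      rcases (abs_eq one_pos.le).1 hj with h | h
      · right; simp only [q, h]; unfold cl; apply projIcc_of_right_le; norm_num
      · left; simp only [q, h]; unfold cl; apply projIcc_of_le_left; norm_num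
    have hFB : ∀ p ∈ B, F0 p = x := by
      rintro p (hp | hp)
      · have hp' : (p : Fin (i + 1) → ℝ) 0 = 1 := hp
        simp only [F0, hp']; norm_num
      · simp only [mem_iUnion] at hp
        simp only [F0]
        split_ifs
        · rw [hbd _ hp]
        · rfl
    have hcov : A ∪ B = univ := by
      rw [eq_univ_iff_forall]
      intro p
      have hn : ‖(p : Fin (i + 1) → ℝ)‖ = 1 := mem_sphere_zero_iff_norm.1 p.2
      obtain ⟨k, hk⟩ := exists_abs_eq_norm (p : Fin (i + 1) → ℝ) (by rw [hn]; exact one_pos)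
      rw [hn] at hk
      induction k using Fin.cases with
      | zero =>
        rcases (abs_eq one_pos.le).1 hk with h | h
        · exact Or.inr (Or.inl h)
        · exact Or.inl h
      | succ j => exact Or.inr (Or.inr (mem_iUnion.2 ⟨j, hk⟩))
    have hF0 : Continuous F0 := by
      rw [← continuousOn_univ, ← hcov]
      refine ContinuousOn.union_of_isClosed ?_ ?_ hA hB
      · refine ContinuousOn.congr (Continuous.continuousOn ?_) hFA
        exact continuous_subtype_val.comp
          (f.1.continuous.comp (hq.comp continuous_subtype_val))
      · exact continuousOn_const.congr hFB
    obtain ⟨g, hg, hgS, hgf⟩ := h F0 hF0 (by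
      intro p; simp only [F0]; split_ifs
      · exact Subtype.coe_prop _
      · exact x.2)
    let e : unitInterval × (Fin i → unitInterval) → (Fin (i + 1) → ℝ) := fun p =>
      Fin.cons (2 * (p.1 : ℝ) - 1) fun j => 2 * (p.2 j : ℝ) - 1
    have he : Continuous e := by
      refine continuous_pi fun k => ?_
      induction k using Fin.cases with
      | zero => simp only [e, Fin.cons_zero]; fun_prop
      | succ j => simp only [e, Fin.cons_succ]; fun_prop
    have hq' : ∀ p, q (e p) = p.2 := by
      intro p; ext j; simp [q, e, cl_val]
    have hI : ∀ t : unitInterval, |2 * (t : ℝ) - 1| ≤ 1 := fun t => by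
      rw [abs_le]; constructor <;> linarith [t.2.1, t.2.2]
    have hle : ∀ p, ∀ k, |e p k| ≤ 1 := by
      intro p k
      induction k using Fin.cases with
      | zero => exact hI _
      | succ j => exact hI _
    have hsph : ∀ p k, |e p k| = 1 → e p ∈ sphere (0 : Fin (i + 1) → ℝ) 1 := by
      intro p k hk
      rw [mem_sphere_zero_iff_norm]
      apply le_antisymm
      · rw [pi_norm_le_iff_of_nonneg zero_le_one]; exact hle p
      · rw [← hk]; exact norm_le_pi_norm (e p) k
    have v0 : ∀ y, g (e (0, y)) = f y := by
      intro y
      have h1 : e (0, y) 0 = -1 := by simp [e]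
      have := hgf ⟨e (0, y), hsph _ 0 (by rw [h1]; norm_num)⟩
      simp only at this
      rw [this, hFA _ (by exact h1)]
      simp only [hq']
    have v1 : ∀ y, g (e (1, y)) = x := by
      intro y
      have h1 : e (1, y) 0 = 1 := by simp [e]; norm_num
      have := hgf ⟨e (1, y), hsph _ 0 (by rw [h1]; norm_num)⟩
      simp only at this
      rw [this, hFB _ (Or.inl (by exact h1))]
    have vb : ∀ t, ∀ y ∈ Cube.boundary (Fin i), g (e (t, y)) = x := by
      rintro t y ⟨j, hj⟩
      have h1 : |e (t, y) j.succ| = 1 := by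
        simp only [e, Fin.cons_succ]
        rcases hj with hj | hj <;> rw [hj] <;> norm_num
      have := hgf ⟨e (t, y), hsph _ j.succ h1⟩
      simp only at this
      rw [this, hFB _ (Or.inr (mem_iUnion.2 ⟨j, h1⟩))]
    refine ⟨⟨⟨⟨fun p => ⟨g (e p), hgS _⟩, (hg.comp he).subtype_mk _⟩, ?_, ?_⟩, ?_⟩⟩
    · intro y; apply Subtype.ext; exact v0 y
    · intro y; apply Subtype.ext; exact v1 y
    · intro t y hy
      have h2 : f y = x := f.2 y hy
      apply Subtype.ext
      show g (e (t, y)) = _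
      rw [vb t y hy]
      exact congrArg Subtype.val h2.symm
  induction a using Quotient.inductionOn with
  | h f =>
    induction b using Quotient.inductionOn with
    | h f' =>
      exact Quotient.sound ((key f).trans (key f').symm)

lemma nconn_of_EP {Y : Type*} [TopologicalSpace Y] {S : Set Y} (m : ℤ)
    (h : ∀ d : ℕ, (d : ℤ) ≤ m + 1 → EP d S) : NConnectedSpace m S := by
  have hne : -1 ≤ m → Nonempty S := by
    intro hm
    have : IsEmpty (Sph 0) := ⟨fun x => by
      have h1 : ‖(x : Fin 0 → ℝ)‖ = 1 := mem_sphere_zero_iff_norm.1 x.2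
      have h2 : (x : Fin 0 → ℝ) = 0 := Subsingleton.elim _ _
      rw [h2, norm_zero] at h1
      norm_num at h1⟩
    obtain ⟨g, _, hgS, _⟩ := h 0 (by push_cast; omega) (fun x => this.elim x)
      (continuous_of_discreteTopology) (fun x => this.elim x)
    exact ⟨⟨g 0, hgS 0⟩⟩
  refine ⟨hne, fun hm => ?_, fun i _ him x => pi_trivial_of_EP i (h _ (by push_cast; omega)) x⟩
  have := hne (by omega)
  exact ⟨this, fun x y => joined_of_EP (h 1 (by push_cast; omega)) x y⟩

lemma real_eq_RR {V : Type*} (F : Set (Finset V)) :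
    {f : V → ℝ | (∀ v, 0 ≤ f v) ∧ (∑ᶠ v, f v = 1) ∧ ∃ σ ∈ F, ∀ v, f v ≠ 0 → v ∈ σ} = RR F := by
  have hfs : ∀ (f : V → ℝ) (σ : Finset V), (∀ v, f v ≠ 0 → v ∈ σ) →
      ∑ᶠ v, f v = ∑ v ∈ σ, f v := fun f σ h =>
    finsum_eq_sum_of_support_subset _ fun v hv => by simpa using h v hv
  ext f
  constructor
  · rintro ⟨h0, h1, σ, hσ, h2⟩
    refine ⟨σ, hσ, h0, fun v hv => ?_, ?_⟩
    · by_contra h3; exact hv (h2 v h3)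
    · rw [← h1, hfs f σ h2]
  · rintro ⟨σ, hσ, h0, h1, h2⟩
    have h3 : ∀ v, f v ≠ 0 → v ∈ σ := fun v hv => by by_contra h4; exact hv (h1 v h4)
    exact ⟨h0, by rw [hfs f σ h3, h2], σ, hσ, h3⟩

lemma nconn_realization {V : Type*} (K : SComplex V) (m : ℤ)
    (h : ∀ d : ℕ, (d : ℤ) ≤ m + 1 → EP d (RR K.faces)) : NConnectedSpace m K.realization := by
  have h' : ∀ d : ℕ, (d : ℤ) ≤ m + 1 → EP d {f : V → ℝ | (∀ v, 0 ≤ f v) ∧ (∑ᶠ v, f v = 1) ∧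
      ∃ σ ∈ K.faces, ∀ v, f v ≠ 0 → v ∈ σ} := fun d hd => by
    rw [real_eq_RR]; exact h d hd
  exact nconn_of_EP m h'

end MA

open scoped Classical
namespace MA
open Set Topology Metric

lemma log_lift {E : Type*} [NormedAddCommGroup E] [NormedSpace ℝ E] (g : E → ℂ)
    (hg : Continuous g) (h0 : ∀ x, g x ≠ 0) :
    ∃ w : E → ℂ, Continuous w ∧ ∀ x, Complex.exp (w x) = g x := by
  obtain ⟨f, hf, -⟩ := (Complex.isCoveringMapOn_exp.existsUnique_continuousMap_lifts
    (A := E) ⟨g, hg⟩ (a₀ := 0) (Complex.exp_log (h0 0)) (fun x => h0 x))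
  exact ⟨f, f.continuous, fun x => congrFun hf.2 x⟩

lemma two_pi_I_ne : (2 * (Real.pi : ℂ) * Complex.I) ≠ 0 := Complex.two_pi_I_ne_zero

/-- a continuous function on a preconnected set with values in `2πiℤ` is constant. -/
lemma const_of_exp_one {X : Type*} [TopologicalSpace X] {s : Set X} (hs : IsPreconnected s)
    {f : X → ℂ} (hf : ContinuousOn f s) (h : ∀ x ∈ s, Complex.exp (f x) = 1) :
    ∀ x ∈ s, ∀ y ∈ s, f x = f y := by
  have h1 : ∀ x ∈ s, ∃ n : ℤ, f x = n * (2 * Real.pi * Complex.I) := fun x hx =>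
    Complex.exp_eq_one_iff.1 (h x hx)
  let S : Set ℂ := range fun n : ℤ => (n : ℂ) * (2 * Real.pi * Complex.I)
  have hmaps : MapsTo f s S := fun x hx => by obtain ⟨n, hn⟩ := h1 x hx; exact ⟨n, hn.symm⟩
  have hpre := hs.image f hf
  have hre : IsPreconnected ((fun z : ℂ => z.im / (2 * Real.pi)) '' (f '' s)) :=
    hpre.image _ (by fun_prop)
  intro x hx y hy
  obtain ⟨n, hn⟩ := h1 x hx
  obtain ⟨m, hm⟩ := h1 y hy
  have hpi : (2 * Real.pi) ≠ 0 := by positivity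
  have hval : ∀ k : ℤ, ((k : ℂ) * (2 * Real.pi * Complex.I)).im / (2 * Real.pi) = k := by
    intro k; simp
  have hsub : ∀ r ∈ ((fun z : ℂ => z.im / (2 * Real.pi)) '' (f '' s)), ∃ k : ℤ, r = k := by
    rintro _ ⟨_, ⟨z, hz, rfl⟩, rfl⟩
    obtain ⟨k, hk⟩ := h1 z hz
    exact ⟨k, by simp only [hk, hval]⟩
  have hn' : (n : ℝ) ∈ ((fun z : ℂ => z.im / (2 * Real.pi)) '' (f '' s)) :=
    ⟨_, ⟨x, hx, rfl⟩, by simp only [hn, hval]⟩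
  have hm' : (m : ℝ) ∈ ((fun z : ℂ => z.im / (2 * Real.pi)) '' (f '' s)) :=
    ⟨_, ⟨y, hy, rfl⟩, by simp only [hm, hval]⟩
  have key : ∀ a b : ℤ, (a : ℝ) ∈ ((fun z : ℂ => z.im / (2 * Real.pi)) '' (f '' s)) →
      (b : ℝ) ∈ ((fun z : ℂ => z.im / (2 * Real.pi)) '' (f '' s)) → ¬ a < b := by
    intro a b ha hb hab
    have h3 : (a : ℝ) + 1 / 2 ∈ ((fun z : ℂ => z.im / (2 * Real.pi)) '' (f '' s)) := by
      refine hre.ordConnected.out ha hb ⟨by linarith, ?_⟩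
      have : (a : ℝ) + 1 ≤ b := by exact_mod_cast hab
      linarith
    obtain ⟨k, hk⟩ := hsub _ h3
    have : ((2 * a + 1 : ℤ) : ℝ) = ((2 * k : ℤ) : ℝ) := by push_cast; linarith
    have := Int.cast_inj.1 this
    omega
  have : n = m := by
    rcases lt_trichotomy n m with h | h | h
    · exact absurd h (key n m hn' hm')
    · exact h
    · exact absurd h (key m n hm' hn')
  rw [hn, hm, this]

/-- Mayer–Vietoris on the plane. -/
lemma preconn_diff {U K : Set ℂ} (hU : IsOpen U) (hUc : IsPreconnected U) (hK : IsClosed K)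
    (hKU : K ⊆ U) (hKc : IsPreconnected Kᶜ) : IsPreconnected (U \ K) := by
  apply isPreconnected_of_forall_constant
  intro b hb
  let χ : ℂ → ℝ := fun z => if b z then 1 else 0
  have hbool : Continuous (fun c : Bool => (if c then (1 : ℝ) else 0)) := continuous_of_discreteTopology
  have hχ : ContinuousOn χ (U \ K) := hbool.comp_continuousOn hb
  have hχb : ∀ z, |χ z| ≤ 1 := fun z => by simp only [χ]; split_ifs <;> norm_num
  obtain ⟨l, hl0, hl1, hl⟩ := exists_continuous_zero_one_of_isClosed hK hU.isClosed_compl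
    (by rw [Set.disjoint_left]; intro x hx hx'; exact hx' (hKU hx))
  have hO : IsOpen (U \ K) := hU.sdiff hK
  -- product with a function vanishing outside
  have hmul : ∀ (m : ℂ → ℝ), Continuous m → ∀ z, m z = 0 →
      ContinuousAt (fun z => m z * χ z) z := by
    intro m hm z hz
    rw [ContinuousAt]
    have : m z * χ z = 0 := by rw [hz, zero_mul]
    rw [this]
    refine squeeze_zero_norm (a := fun z => |m z|) (fun y => ?_) ?_
    · rw [norm_mul, Real.norm_eq_abs, Real.norm_eq_abs]
      calc _ ≤ |m y| * 1 := mul_le_mul_of_nonneg_left (hχb y) (abs_nonneg _)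
        _ = _ := mul_one _
    · have := (hm.abs).tendsto z
      rwa [hz, abs_zero] at this
  have hmulO : ∀ (m : ℂ → ℝ), Continuous m → ∀ z ∈ U \ K,
      ContinuousAt (fun z => m z * χ z) z := fun m hm z hz =>
    hm.continuousAt.mul (hχ.continuousAt (hO.mem_nhds hz))
  let u : ℂ → ℝ := fun z => l z * χ z
  let v : ℂ → ℝ := fun z => (l z - 1) * χ z
  have hu : ∀ z ∈ U, ContinuousAt u z := fun z hz => by
    by_cases hzK : z ∈ K
    · exact hmul _ l.continuous z (hl0 hzK)
    · exact hmulO _ l.continuous z ⟨hz, hzK⟩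
  have hv : ∀ z ∈ Kᶜ, ContinuousAt v z := fun z hz => by
    by_cases hzU : z ∈ U
    · exact hmulO (fun z => l z - 1) (l.continuous.sub continuous_const) z ⟨hzU, hz⟩
    · exact hmul (fun z => l z - 1) (l.continuous.sub continuous_const) z
        (by have h5 : l z = 1 := hl1 hzU
            simp [h5])
  let ex : ℝ → ℂ := fun t => Complex.exp (t * (2 * Real.pi * Complex.I))
  have hex : Continuous ex := by fun_prop
  have hexuv : ∀ z, ex (u z) = ex (v z) := by
    intro z
    have : u z = v z + χ z := by simp only [u, v]; ring
    simp only [ex, this, χ]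
    split_ifs
    · push_cast
      rw [add_mul, one_mul, Complex.exp_add, Complex.exp_two_pi_mul_I, mul_one]
    · simp
  have hG : Continuous fun z => ex (u z) := by
    rw [continuous_iff_continuousAt]
    intro z
    by_cases hzK : z ∈ K
    · exact hex.continuousAt.comp (hu z (hKU hzK))
    · have : (fun z => ex (u z)) = fun z => ex (v z) := funext hexuv
      rw [this]
      exact hex.continuousAt.comp (hv z hzK)
  obtain ⟨w, hw, hwe⟩ := log_lift _ hG fun z => Complex.exp_ne_zero _
  have c1 := const_of_exp_one hUc (f := fun z => (u z : ℂ) * (2 * Real.pi * Complex.I) - w z)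
    (fun z hz => (((Complex.continuous_ofReal.continuousAt.comp (hu z hz)).mul
      continuousAt_const).sub hw.continuousAt).continuousWithinAt)
    (fun z _ => by
      show Complex.exp (_ - _) = 1
      rw [Complex.exp_sub, hwe]; exact div_self (Complex.exp_ne_zero _))
  have c2 := const_of_exp_one hKc (f := fun z => (v z : ℂ) * (2 * Real.pi * Complex.I) - w z)
    (fun z hz => (((Complex.continuous_ofReal.continuousAt.comp (hv z hz)).mul
      continuousAt_const).sub hw.continuousAt).continuousWithinAt)
    (fun z _ => by
      show Complex.exp (_ - _) = 1
      rw [Complex.exp_sub, hwe, hexuv]; exact div_self (Complex.exp_ne_zero _))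
  intro x hx y hy
  have e1 := c1 x hx.1 y hy.1
  have e2 := c2 x hx.2 y hy.2
  have e3 : ((u x : ℂ) - v x) * (2 * Real.pi * Complex.I) =
      ((u y : ℂ) - v y) * (2 * Real.pi * Complex.I) := by linear_combination e1 - e2
  have e4 := mul_right_cancel₀ two_pi_I_ne e3
  have e5 : ∀ z, (u z : ℂ) - v z = (χ z : ℝ) := fun z => by
    simp only [u, v]; push_cast; ring
  rw [e5, e5] at e4
  have e6 : χ x = χ y := by exact_mod_cast e4
  simp only [χ] at e6
  by_cases h1 : b x <;> by_cases h2 : b y <;> simp [h1, h2] at e6 ⊢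

lemma preconn_diff_finite {U K : Set ℂ} (hU : IsOpen U) (hUc : IsPreconnected U) (hK : K.Finite)
    (hKU : K ⊆ U) : IsPreconnected (U \ K) :=
  preconn_diff hU hUc hK.isClosed hKU
    (hK.countable.isConnected_compl_of_one_lt_rank (by simp)).isPreconnected

lemma preconn_outside (R : ℝ) (hR : 0 ≤ R) : IsPreconnected {z : ℂ | R < ‖z‖} := by
  have : {z : ℂ | R < ‖z‖} =
      (fun p : ℝ × ℝ => (p.1 : ℂ) * Complex.exp (p.2 * Complex.I)) '' (Ioi R ×ˢ univ) := by
    ext z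
    constructor
    · intro hz
      exact ⟨(‖z‖, Complex.arg z), ⟨hz, mem_univ _⟩, Complex.norm_mul_exp_arg_mul_I z⟩
    · rintro ⟨⟨r, θ⟩, ⟨hr, _⟩, rfl⟩
      have hr' : R < r := hr
      simp only [mem_ofPred_eq, norm_mul, Complex.norm_exp_ofReal_mul_I, mul_one,
        Complex.norm_real, Real.norm_eq_abs]
      exact lt_of_lt_of_le hr' (le_abs_self r)
  rw [this]
  exact (isPreconnected_Ioi.prod isPreconnected_univ).image _ (by fun_prop)

/-- complement of an arc in the plane -/
lemma preconn_compl_arc (γ : C(unitInterval, ℂ)) (hγ : Function.Injective γ) :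
    IsPreconnected (range γ)ᶜ := by
  set K := range γ with hKdef
  have hK : IsCompact K := isCompact_range γ.continuous
  obtain ⟨R, hR0, hR⟩ := hK.isBounded.exists_pos_norm_le
  have hKO : IsOpen Kᶜ := hK.isClosed.isOpen_compl
  have hout := preconn_outside R hR0.le
  have houtK : {z : ℂ | R < ‖z‖} ⊆ Kᶜ := fun z hz hzK => absurd (hR z hzK) (not_le.2 hz)
  -- every component reaches outside
  have key : ∀ x ∈ Kᶜ, ∃ z ∈ connectedComponentIn Kᶜ x, R < ‖z‖ := by
    intro x hx
    by_contra hcon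
    push Not at hcon
    set C := connectedComponentIn Kᶜ x with hC
    have hxC : x ∈ C := mem_connectedComponentIn hx
    have hCO : IsOpen C := hKO.connectedComponentIn
    have hfr : ∀ z ∈ closure C, z ∉ C → z ∈ K := by
      intro z hz hzC
      by_contra hzK
      have hz' : z ∈ connectedComponentIn Kᶜ z := mem_connectedComponentIn hzK
      obtain ⟨y, hy1, hy2⟩ := mem_closure_iff.1 hz _ (hKO.connectedComponentIn (x := z)) hz'
      have e1 := connectedComponentIn_eq hy1
      have e2 := connectedComponentIn_eq hy2
      apply hzC
      rw [hC, e2, ← e1]; exact hz'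
    -- log on the arc
    have hne : ∀ t, γ t - x ≠ 0 := fun t h => hx ⟨t, sub_eq_zero.1 h⟩
    obtain ⟨w0, hw0, hw0e⟩ := log_lift (fun t : ℝ => γ (projIcc 0 1 zero_le_one t) - x)
      ((γ.continuous.comp continuous_projIcc).sub continuous_const) (fun t => hne _)
    -- Tietze
    have hemb : IsClosedEmbedding γ := γ.continuous.isClosedEmbedding hγ
    have t1 : ∀ f : C(unitInterval, ℝ), ∃ g : C(ℂ, ℝ), ∀ t, g (γ t) = f t := fun f => by
      obtain ⟨g, hg⟩ := ContinuousMap.exists_extension (Y := ℝ) hemb f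
      exact ⟨g, fun t => DFunLike.congr_fun hg t⟩
    obtain ⟨g1, hg1⟩ := t1 ⟨fun t => (w0 t).re, by fun_prop⟩
    obtain ⟨g2, hg2⟩ := t1 ⟨fun t => (w0 t).im, by fun_prop⟩
    let Lg : ℂ → ℂ := fun z => g1 z + g2 z * Complex.I
    have hLg : Continuous Lg := by fun_prop
    have hLgK : ∀ z ∈ K, Complex.exp (Lg z) = z - x := by
      rintro _ ⟨t, rfl⟩
      have : Lg (γ t) = w0 t := by
        simp only [Lg, hg1, hg2]; exact Complex.re_add_im _
      rw [this, hw0e]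
      simp
    let G : ℂ → ℂ := fun z => if z ∈ C then Complex.exp (Lg z) else z - x
    have hG : Continuous G := by
      refine continuous_if (fun z hz => ?_) (Continuous.continuousOn (by fun_prop))
        (Continuous.continuousOn (by fun_prop))
      refine hLgK z (hfr z hz.1 ?_)
      have := hz.2
      change z ∉ interior C at this
      rwa [hCO.interior_eq] at this
    have hG0 : ∀ z, G z ≠ 0 := by
      intro z
      simp only [G]
      split_ifs with h
      · exact Complex.exp_ne_zero _
      · intro h0; exact h (by rw [sub_eq_zero.1 h0]; exact hxC)
    obtain ⟨w, hw, hwe⟩ := log_lift G hG hG0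
    -- big circle
    let ρ : ℝ := R + ‖x‖ + 1
    have hρ : 0 < ρ := by positivity
    have hcirc : ∀ t : ℝ, G (x + ρ * Complex.exp (t * Complex.I)) =
        ρ * Complex.exp (t * Complex.I) := by
      intro t
      have hn : R < ‖x + ρ * Complex.exp (t * Complex.I)‖ := by
        have h1 : ‖(ρ : ℂ) * Complex.exp (t * Complex.I)‖ = ρ := by
          rw [norm_mul, Complex.norm_exp_ofReal_mul_I, mul_one, Complex.norm_real,
            Real.norm_eq_abs, abs_of_pos hρ]
        have h2 := norm_sub_le (x + ρ * Complex.exp (t * Complex.I)) x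
        rw [add_sub_cancel_left, h1] at h2
        simp only [ρ] at h2 ⊢
        linarith
      have : x + ρ * Complex.exp (t * Complex.I) ∉ C := fun h => absurd (hcon _ h) (not_le.2 hn)
      simp only [G, this, if_false]; ring
    have hc := const_of_exp_one (isPreconnected_univ (α := ℝ))
      (f := fun t : ℝ => w (x + ρ * Complex.exp (t * Complex.I)) - t * Complex.I - Real.log ρ)
      (by
        apply Continuous.continuousOn
        have : Continuous fun t : ℝ => w (x + ρ * Complex.exp (t * Complex.I)) :=
          hw.comp (by fun_prop)
        fun_prop)
      (fun t _ => by
        have h3 : ((ρ : ℝ) : ℂ) ≠ 0 := by exact_mod_cast hρ.ne'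
        show Complex.exp (_ - _ - _) = 1
        rw [Complex.exp_sub, Complex.exp_sub, hwe, hcirc, ← Complex.ofReal_exp, Real.exp_log hρ]
        field_simp [Complex.exp_ne_zero])
      0 (mem_univ _) (2 * Real.pi) (mem_univ _)
    push_cast at hc
    rw [Complex.exp_two_pi_mul_I] at hc
    simp at hc
    exact two_pi_I_ne (by linear_combination hc)
  refine isPreconnected_of_forall_pair fun x hx y hy => ?_
  obtain ⟨z, hz, hzR⟩ := key x hx
  obtain ⟨z', hz', hzR'⟩ := key y hy
  refine ⟨(connectedComponentIn Kᶜ x ∪ {z : ℂ | R < ‖z‖}) ∪ connectedComponentIn Kᶜ y,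
    union_subset (union_subset (connectedComponentIn_subset _ _) houtK)
      (connectedComponentIn_subset _ _),
    Or.inl (Or.inl (mem_connectedComponentIn hx)), Or.inr (mem_connectedComponentIn hy), ?_⟩
  refine IsPreconnected.union z' (Or.inr hzR') hz' ?_ isPreconnected_connectedComponentIn
  exact IsPreconnected.union z hz hzR isPreconnected_connectedComponentIn hout

lemma preconn_diff_arc {U : Set ℂ} (hU : IsOpen U) (hUc : IsPreconnected U)
    (γ : C(unitInterval, ℂ)) (hγ : Function.Injective γ) (h : range γ ⊆ U) :
    IsPreconnected (U \ range γ) :=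
  preconn_diff hU hUc (isCompact_range γ.continuous).isClosed h (preconn_compl_arc γ hγ)

lemma arc_interior (γ : C(unitInterval, ℂ)) (hγ : Function.Injective γ) :
    interior (range γ) = ∅ := by
  by_contra hne
  obtain ⟨z0, hz0⟩ := nonempty_iff_ne_empty.2 hne
  obtain ⟨r, hr, hball⟩ := Metric.mem_nhds_iff.1 (isOpen_interior.mem_nhds hz0)
  have hB : ball z0 r ⊆ range γ := hball.trans interior_subset
  have hemb : IsClosedEmbedding γ := γ.continuous.isClosedEmbedding hγ
  have hpo : IsOpen (γ ⁻¹' ball z0 r) := isOpen_ball.preimage γ.continuous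
  obtain ⟨t0, ht0⟩ := hB (mem_ball_self hr)
  -- an interior parameter
  obtain ⟨δ, hδ, hδb⟩ := Metric.mem_nhds_iff.1 (hpo.mem_nhds (show t0 ∈ γ ⁻¹' ball z0 r by
    rw [mem_preimage, ht0]; exact mem_ball_self hr))
  have : ∃ t : unitInterval, γ t ∈ ball z0 r ∧ 0 < (t : ℝ) ∧ (t : ℝ) < 1 := by
    have hε : 0 < min (δ / 2) (1 / 4) := by positivity
    set ε := min (δ / 2) (1 / 4) with hεd
    have h1 : ε ≤ δ / 2 := min_le_left _ _
    have h2 : ε ≤ 1 / 4 := min_le_right _ _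
    rcases le_total (t0 : ℝ) (1 / 2) with h | h
    · refine ⟨⟨t0 + ε, by linarith [t0.2.1], by linarith⟩, hδb ?_, by
        show 0 < (t0 : ℝ) + ε; linarith [t0.2.1], by show (t0 : ℝ) + ε < 1; linarith⟩
      rw [mem_ball, Subtype.dist_eq, Real.dist_eq]
      simp only [add_sub_cancel_left, abs_of_pos hε]; linarith
    · refine ⟨⟨t0 - ε, by linarith, by linarith [t0.2.2]⟩, hδb ?_, by
        show 0 < (t0 : ℝ) - ε; linarith, by show (t0 : ℝ) - ε < 1; linarith [t0.2.2]⟩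
      rw [mem_ball, Subtype.dist_eq, Real.dist_eq]
      have : (t0 : ℝ) - ε - t0 = -ε := by ring
      simp only [this, abs_neg, abs_of_pos hε]; linarith
  obtain ⟨t, htB, ht0', ht1'⟩ := this
  have hpre : IsPreconnected (ball z0 r \ {γ t}) :=
    preconn_diff_finite isOpen_ball (convex_ball z0 r).isPreconnected (finite_singleton _)
      (by simpa using htB)
  have hpre2 : IsPreconnected (γ ⁻¹' (ball z0 r \ {γ t})) := by
    rw [← hemb.isInducing.isPreconnected_image, image_preimage_eq_of_subset]
    · exact hpre
    · exact diff_subset.trans hB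
  have hpre3 := (hpre2.image (Subtype.val) continuous_subtype_val.continuousOn)
  obtain ⟨η, hη, hηb⟩ := Metric.mem_nhds_iff.1 (hpo.mem_nhds htB)
  have hε : 0 < min (η / 2) (min ((t : ℝ) / 2) ((1 - t) / 2)) := by
    refine lt_min (by positivity) (lt_min (by positivity) (by linarith))
  set ε := min (η / 2) (min ((t : ℝ) / 2) ((1 - t) / 2)) with hεd
  have h1 : ε ≤ η / 2 := min_le_left _ _
  have h2 : ε ≤ t / 2 := (min_le_right _ _).trans (min_le_left _ _)
  have h3 : ε ≤ (1 - t) / 2 := (min_le_right _ _).trans (min_le_right _ _)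
  have hp : ∀ e : ℝ, |e| = ε → t + e ∈ Subtype.val '' (γ ⁻¹' (ball z0 r \ {γ t})) := by
    intro e he
    have he' := abs_le.1 he.le
    refine ⟨⟨t + e, by linarith [he'.1], by linarith [he'.2]⟩, ⟨hηb ?_, ?_⟩, rfl⟩
    · rw [mem_ball, Subtype.dist_eq, Real.dist_eq]
      simp only [add_sub_cancel_left, he]; linarith
    · intro h
      have := hγ h
      have := congrArg Subtype.val this
      simp at this
      rw [this] at he; simp at he; linarith
  have := hpre3.ordConnected.out (hp (-ε) (by simp [abs_of_pos hε])) (hp ε (abs_of_pos hε))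
    (show (t : ℝ) ∈ Icc ((t : ℝ) + -ε) (t + ε) from ⟨by linarith, by linarith⟩)
  obtain ⟨t', ⟨_, h5⟩, h6⟩ := this
  have : t' = t := Subtype.ext h6
  rw [this] at h5
  exact h5 rfl

end MA

open scoped Classical
namespace MA
open Set Topology Metric

lemma exists_W {O Q : Set ℂ} {x : ℂ} (hO : IsOpen O) (hOc : IsPreconnected O) (hQ : IsCompact Q)
    (hQO : Q ⊆ O) (hx : x ∉ O) :
    ∃ r > 0, ∃ W, IsOpen W ∧ IsPreconnected W ∧ Q ⊆ W ∧ W ⊆ O ∧ Disjoint W (closedBall x r) := by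
  rcases Q.eq_empty_or_nonempty with rfl | ⟨q0, hq0⟩
  · exact ⟨1, one_pos, ∅, isOpen_empty, isPreconnected_empty, by simp, by simp, by simp⟩
  have hpc : IsPathConnected O := hO.isConnected_iff_isPathConnected.1 ⟨⟨q0, hQO hq0⟩, hOc⟩
  let R : ℕ → ℝ := fun k => 1 / (k + 1)
  have hR : ∀ k, 0 < R k := fun k => by positivity
  have hRm : ∀ k l, k ≤ l → R l ≤ R k := fun k l h => one_div_le_one_div_of_le (by positivity)
    (by have : (k : ℝ) ≤ l := by exact_mod_cast h
        linarith)
  let W : ℕ → Set ℂ := fun k => connectedComponentIn (O \ closedBall x (R k)) q0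
  have hWm : Monotone W := fun k l h => connectedComponentIn_mono _
    (sdiff_subset_sdiff_right (closedBall_subset_closedBall (hRm k l h)))
  obtain ⟨k, hk⟩ := hQ.elim_directed_cover W
    (fun k => (hO.sdiff isClosed_closedBall).connectedComponentIn) (by
      intro q hq
      obtain ⟨γ, hγ⟩ := hpc.joinedIn q0 (hQO hq0) q (hQO hq)
      have hKc : IsCompact (range γ) := isCompact_range γ.continuous
      have hxK : x ∉ range γ := by rintro ⟨t, rfl⟩; exact hx (hγ t)
      obtain ⟨e, he, hdis⟩ := Metric.isOpen_iff.1 hKc.isClosed.isOpen_compl x hxK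
      obtain ⟨k, hk⟩ := exists_nat_one_div_lt he
      refine mem_iUnion.2 ⟨k, ?_⟩
      have hsub : range γ ⊆ O \ closedBall x (R k) := by
        rintro z ⟨t, rfl⟩
        refine ⟨hγ t, fun h => hdis (closedBall_subset_ball hk h) ⟨t, rfl⟩⟩
      exact (isPreconnected_range γ.continuous).subset_connectedComponentIn
        ⟨0, by simp⟩ hsub ⟨1, by simp⟩) hWm.directed_le
  refine ⟨R k, hR k, W k, (hO.sdiff isClosed_closedBall).connectedComponentIn,
    isPreconnected_connectedComponentIn, hk,
    (connectedComponentIn_subset _ _).trans sdiff_subset, ?_⟩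
  rw [Set.disjoint_left]
  intro z hz hz'
  exact (connectedComponentIn_subset _ _ hz).2 hz'

/-- push homeomorphism -/
lemma push (x : ℂ) (r : ℝ) (hr : 0 < r) (v : ℂ) (hv : ‖v‖ < r) :
    ∃ φ : ℂ ≃ₜ ℂ, φ x = x + v ∧ ∀ z, z ∉ ball x r → φ z = z := by
  let f : ℂ → ℂ := fun z => z + (max 0 (1 - ‖z - x‖ / r) : ℝ) • v
  let c : NNReal := ⟨‖v‖ / r, by positivity⟩
  have hf : ApproximatesLinearOn f ((ContinuousLinearEquiv.refl ℝ ℂ : ℂ ≃L[ℝ] ℂ) : ℂ →L[ℝ] ℂ) univ c := by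
    intro a _ b _
    have : f a - f b - ((ContinuousLinearEquiv.refl ℝ ℂ : ℂ ≃L[ℝ] ℂ) : ℂ →L[ℝ] ℂ) (a - b)
        = ((max 0 (1 - ‖a - x‖ / r) - max 0 (1 - ‖b - x‖ / r) : ℝ)) • v := by
      simp only [f, ContinuousLinearEquiv.coe_coe, ContinuousLinearEquiv.refl_apply, sub_smul]; ring
    rw [this, norm_smul, Real.norm_eq_abs]
    have h1 := abs_max_sub_max_le_abs (1 - ‖a - x‖ / r) (1 - ‖b - x‖ / r) 0
    rw [max_comm _ 0, max_comm _ 0] at h1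
    have h2 : |(1 - ‖a - x‖ / r) - (1 - ‖b - x‖ / r)| ≤ ‖a - b‖ / r := by
      have : (1 - ‖a - x‖ / r) - (1 - ‖b - x‖ / r) = (‖b - x‖ - ‖a - x‖) / r := by ring
      rw [this, abs_div, abs_of_pos hr]
      gcongr
      have := abs_norm_sub_norm_le (b - x) (a - x)
      rw [sub_sub_sub_cancel_right, norm_sub_rev b a] at this
      exact this
    show _ ≤ ‖v‖ / r * ‖a - b‖
    calc _ ≤ (‖a - b‖ / r) * ‖v‖ := by gcongr; exact h1.trans h2
      _ = _ := by ring
  have hc : Subsingleton ℂ ∨ c < ‖((ContinuousLinearEquiv.refl ℝ ℂ : ℂ ≃L[ℝ] ℂ).symm : ℂ →L[ℝ] ℂ)‖₊⁻¹ := by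
    right
    have : ((ContinuousLinearEquiv.refl ℝ ℂ : ℂ ≃L[ℝ] ℂ).symm : ℂ →L[ℝ] ℂ) = ContinuousLinearMap.id ℝ ℂ := rfl
    rw [this]
    have : ‖ContinuousLinearMap.id ℝ ℂ‖₊ = 1 := by ext; simp
    rw [this, inv_one]
    show ‖v‖ / r < 1
    rwa [div_lt_one hr]
  refine ⟨ApproximatesLinearOn.toHomeomorph f hf hc, ?_, ?_⟩
  · show f x = _
    simp [f]
  · intro z hz
    show f z = _
    have : max 0 (1 - ‖z - x‖ / r) = 0 := by
      apply max_eq_left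
      rw [mem_ball, dist_eq_norm, not_lt] at hz
      have := (one_le_div hr).2 hz
      linarith
    simp [f, this]

lemma ball_homeo {x y y' : ℂ} {r : ℝ} (hy : y ∈ ball x r) (hy' : y' ∈ ball x r) :
    ∃ φ : ℂ ≃ₜ ℂ, φ y' = y ∧ ∀ z, z ∉ ball x r → φ z = z := by
  have hr : 0 < r := dist_nonneg.trans_lt hy
  obtain ⟨a, ha, ha'⟩ := push x r hr (y - x) (by rwa [← dist_eq_norm])
  obtain ⟨b, hb, hb'⟩ := push x r hr (y' - x) (by rwa [← dist_eq_norm])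
  refine ⟨b.symm.trans a, ?_, ?_⟩
  · simp only [Homeomorph.trans_apply]
    have : b.symm y' = x := by rw [Homeomorph.symm_apply_eq, hb]; ring
    rw [this, ha]; ring
  · intro z hz
    simp only [Homeomorph.trans_apply]
    have : b.symm z = z := by rw [Homeomorph.symm_apply_eq, hb' z hz]
    rw [this, ha' z hz]

lemma ball_homeo_maps {x : ℂ} {r : ℝ} {φ : ℂ ≃ₜ ℂ} (h : ∀ z, z ∉ ball x r → φ z = z) {z : ℂ} :
    φ z ∈ ball x r ↔ z ∈ ball x r := by
  constructor
  · intro hz; by_contra hn; rw [h z hn] at hz; exact hn hz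
  · intro hz; by_contra hn
    have := h _ hn
    rw [φ.injective.eq_iff] at this
    rw [this] at hn; exact hn hz
end MA

open scoped Classical
namespace MA
open Set Topology Metric

structure Arc (s : ℕ) where
  col : Fin s
  fn : C(unitInterval, ℂ)
  inj : Function.Injective fn

variable {s : ℕ}

def Arc.im (a : Arc s) : Set ℂ := range a.fn

def Arc.ok (U P : Set ℂ) (a : Arc s) : Prop :=
  a.im ⊆ U ∧ a.fn 0 ∈ P ∧ a.fn 1 ∈ P ∧ ∀ t, t ≠ 0 → t ≠ 1 → a.fn t ∉ P

def XX (s : ℕ) (U P : Set ℂ) : Set (Finset (Arc s)) :=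
  {σ | σ.Nonempty ∧ (∀ a ∈ σ, a.ok U P) ∧ ∀ a ∈ σ, ∀ b ∈ σ, a ≠ b → Disjoint a.im b.im}

lemma Arc.im_compact (a : Arc s) : IsCompact a.im := isCompact_range a.fn.continuous

lemma Arc.im_ne (a : Arc s) : a.im.Nonempty := ⟨_, ⟨0, rfl⟩⟩

lemma XX_down (U P : Set ℂ) : DownC (XX s U P) :=
  ⟨fun _ h => h.1, fun _ h _ hτ hn => ⟨hn, fun a ha => h.2.1 a (hτ ha),
    fun a ha b hb => h.2.2 a (hτ ha) b (hτ hb)⟩⟩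

lemma Arc.ok.mono {U P U' P' : Set ℂ} {a : Arc s} (h : a.ok U P) (hU : a.im ⊆ U') (hP : P ⊆ P')
    (hPU : P' ∩ a.im ⊆ P) : a.ok U' P' :=
  ⟨hU, hP h.2.1, hP h.2.2.1, fun t h0 h1 ht => h.2.2.2 t h0 h1 (hPU ⟨ht, ⟨t, rfl⟩⟩)⟩

lemma Arc.ok.restrict {U P U' P' : Set ℂ} {a : Arc s} (h : a.ok U P) (hU : a.im ⊆ U') (hP : P' ⊆ P)
    (hPU : P ∩ a.im ⊆ P') : a.ok U' P' :=
  ⟨hU, hPU ⟨h.2.1, ⟨_, rfl⟩⟩, hPU ⟨h.2.2.1, ⟨_, rfl⟩⟩, fun t h0 h1 ht => h.2.2.2 t h0 h1 (hP ht)⟩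

lemma XX_mono {U P U' P' : Set ℂ} (hU : U ⊆ U') (hP : P ⊆ P') (hPU : P' ∩ U ⊆ P) :
    XX s U P ⊆ XX s U' P' := fun _ h => ⟨h.1, fun a ha => (h.2.1 a ha).mono
      ((h.2.1 a ha).1.trans hU) hP fun _ hz => hPU ⟨hz.1, (h.2.1 a ha).1 hz.2⟩, h.2.2⟩

lemma XX_insert {U P W Q : Set ℂ} {a : Arc s} (ha : a.ok U P) {τ : Finset (Arc s)}
    (hτ : τ ∈ XX s W Q) (hW : W ⊆ U) (hQ : Q ⊆ P) (hPW : P ∩ W ⊆ Q) (hd : Disjoint W a.im) :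
    insert a τ ∈ XX s U P := by
  have h := XX_mono hW hQ hPW hτ
  have hd' : ∀ b ∈ τ, Disjoint a.im b.im := fun b hb => (hd.mono_left (hτ.2.1 b hb).1).symm
  refine ⟨Finset.insert_nonempty _ _, fun b hb => ?_, fun b hb c hc hbc => ?_⟩
  · rcases Finset.mem_insert.1 hb with rfl | hb
    · exact ha
    · exact h.2.1 b hb
  · rcases Finset.mem_insert.1 hb with hb' | hb' <;> rcases Finset.mem_insert.1 hc with hc' | hc'
    · exact absurd (hb'.trans hc'.symm) hbc
    · rw [hb']; exact hd' c hc'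
    · rw [hc']; exact (hd' b hb').symm
    · exact h.2.2 b hb' c hc' hbc

lemma Arc.ncard_diff {U P : Set ℂ} {a : Arc s} (ha : a.ok U P) (hP : P.Finite) :
    P.ncard ≤ (P \ a.im).ncard + 2 := by
  have h1 : P ⊆ (P \ a.im) ∪ {a.fn 0, a.fn 1} := by
    intro z hz
    by_cases h : z ∈ a.im
    · obtain ⟨t, rfl⟩ := h
      right
      by_contra hn
      simp only [mem_insert_iff, mem_singleton_iff, not_or] at hn
      exact ha.2.2.2 t (fun h => hn.1 (by rw [h])) (fun h => hn.2 (by rw [h])) hz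
    · exact Or.inl ⟨hz, h⟩
  have h2 := ncard_le_ncard h1 ((hP.sdiff).union (toFinite _))
  have h3 := ncard_union_le (P \ a.im) {a.fn 0, a.fn 1}
  have h4 := ncard_insert_le (a.fn 0) {a.fn 1}
  rw [ncard_singleton] at h4
  omega

lemma nonadj_of_common {U P : Set ℂ} {A : Finset (Arc s)} {x : ℂ} (h : ∀ a ∈ A, x ∈ a.im) :
    NonAdj (XX s U P) A := by
  intro σ hσ a ha b hb haσ hbσ
  by_contra hne
  exact Set.disjoint_left.1 (hσ.2.2 a haσ b hbσ hne) (h a ha) (h b hb)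

def Main (s j : ℕ) : Prop := ∀ U P : Set ℂ, IsOpen U → IsPreconnected U → P.Finite → P ⊆ U →
  3 * j + 2 ≤ P.ncard → EP j (RR (XX s U P))

lemma remove {d : ℕ} (IH : ∀ j < d, Main s j) {U P U0 P0 : Set ℂ} (hU : IsOpen U)
    (hUc : IsPreconnected U) (hP : P.Finite) (hPU : P ⊆ U) {q : ℂ}
    (hcard : 3 * d + 1 ≤ P.ncard) (h0 : U ⊆ U0) (h1 : P ⊆ P0) (h2 : P0 ∩ U ⊆ P)
    {f : Sph d → Arc s → ℝ} (hf : Continuous f) (hfF : ∀ x, f x ∈ RR (XX s U P)) :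
    ∃ g : Sph d → Arc s → ℝ, Continuous g ∧ (∀ x, g x ∈ RR (XX s (U \ {q}) (P \ {q}))) ∧
      (Fill d (RR (XX s U0 P0)) g → Fill d (RR (XX s U0 P0)) f) := by
  have hsub : XX s U P ⊆ XX s U0 P0 := XX_mono h0 h1 h2
  obtain ⟨W, hW⟩ := exists_trunc hf hfF
  have hW' := hW W subset_rfl
  let f' : Sph d → Arc s → ℝ := fun x => trunc W (f x)
  have hf'c : Continuous f' := trunc_cont hf hW'
  have hf'F : ∀ x, f' x ∈ RR (XX s U P) := by
    intro x
    obtain ⟨σ, hσ, hx⟩ := hfF x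
    have := trunc_mem hx (hW' x)
    refine ⟨_, (XX_down U P).2 σ hσ _ Finset.inter_subset_left ?_, this⟩
    by_contra hne
    rw [Finset.not_nonempty_iff_eq_empty] at hne
    have := this.2.2
    rw [hne] at this; simp at this
  have hf'W : ∀ x v, f' x v ≠ 0 → v ∈ W := by
    intro x v hv; by_contra hn; exact hv (by simp [f', trunc, hn])
  let A : Finset (Arc s) := W.filter fun a => a.ok U P ∧ q ∈ a.im
  have hAq : ∀ a ∈ A, q ∈ a.im := fun a ha => (Finset.mem_filter.1 ha).2.2
  have hAok : ∀ a ∈ A, a.ok U P := fun a ha => (Finset.mem_filter.1 ha).2.1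
  obtain ⟨g, hg, hgx⟩ := exists_link (XX_down U P) (nonadj_of_common hAq) hf'c hf'F
    (fun a => XX s (U \ a.im) (P \ a.im))
    (by
      intro a ha j hj
      refine IH j hj _ _ (hU.sdiff a.im_compact.isClosed) (preconn_diff_arc hU hUc a.fn a.inj (hAok a ha).1)
        hP.sdiff (sdiff_subset_sdiff_left hPU) ?_
      have := Arc.ncard_diff (hAok a ha) hP
      omega)
    (by
      intro x a ha hxa σ hσ hσs hne
      refine ⟨hne, fun b hb => ?_, fun b hb c hc => hσ.2.2 b (Finset.mem_of_mem_erase hb) c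
        (Finset.mem_of_mem_erase hc)⟩
      have hb' := Finset.mem_of_mem_erase hb
      have hba := hσ.2.2 b hb' a ((hσs a).2 hxa.ne') (Finset.ne_of_mem_erase hb)
      exact (hσ.2.1 b hb').restrict (fun z hz => ⟨(hσ.2.1 b hb').1 hz, Set.disjoint_left.1 hba hz⟩)
        sdiff_subset fun z hz => ⟨hz.1, Set.disjoint_left.1 hba hz.2⟩)
  refine ⟨g, hg, fun x => ?_, fun hG => ?_⟩
  · rcases hgx x with ⟨h3, h4⟩ | ⟨a, ha, -, -, h5⟩
    · obtain ⟨σ, hσ, hx, hσs⟩ := RR.exists_supp (XX_down U P) (hf'F x)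
      have hm := rho_mem hx h3
      rw [h4]
      refine ⟨_, ⟨?_, fun b hb => ?_, fun b hb c hc => hσ.2.2 b (Finset.sdiff_subset hb) c
        (Finset.sdiff_subset hc)⟩, hm⟩
      · by_contra hne
        rw [Finset.not_nonempty_iff_eq_empty] at hne
        have := hm.2.2
        rw [hne] at this; simp at this
      · rw [Finset.mem_sdiff] at hb
        have hok := hσ.2.1 b hb.1
        have hqb : q ∉ b.im := fun hq => hb.2 (Finset.mem_filter.2
          ⟨hf'W x b ((hσs b).1 hb.1), hok, hq⟩)
        exact hok.restrict (fun z hz => ⟨hok.1 hz, fun h => hqb (by rw [mem_singleton_iff] at h; exact h ▸ hz)⟩)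
          sdiff_subset fun z hz => ⟨hz.1, fun h => hqb (by rw [mem_singleton_iff] at h; exact h ▸ hz.2)⟩
    · refine RR.mono (XX_mono ?_ ?_ ?_) h5
      · rintro z ⟨h6, h7⟩; exact ⟨h6, fun h => h7 (by rw [mem_singleton_iff] at h; rw [h]; exact hAq a ha)⟩
      · rintro z ⟨h6, h7⟩; exact ⟨h6, fun h => h7 (by rw [mem_singleton_iff] at h; rw [h]; exact hAq a ha)⟩
      · rintro z ⟨h6, h7⟩; exact ⟨h6.1, h7.2⟩
  · refine Fill.of_trunc hf (fun x => RR.mono hsub (hfF x)) hW' ?_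
    refine Fill.link (A := A) (XX_down U0 P0) (nonadj_of_common hAq) hf'c (fun x => RR.mono hsub (hf'F x)) hg
      (fun x => ?_) hG
    rcases hgx x with h3 | ⟨a, ha, h4, h5, τ, hτ, h6⟩
    · exact Or.inl h3
    · refine Or.inr ⟨a, ha, h4, h5, τ, hsub (XX_insert (hAok a ha) hτ sdiff_subset sdiff_subset ?_
        disjoint_sdiff_left), h6⟩
      rintro z ⟨h6, h7⟩; exact ⟨h6, h7.2⟩
end MA

open scoped Classical
namespace MA
open Set Topology Metric
variable {s : ℕ}

lemma Arc.ext' {a b : Arc s} (h : a.col = b.col) (h' : ∀ t, a.fn t = b.fn t) : a = b := by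
  cases a with
  | mk c f i =>
    cases b with
    | mk c' f' i' =>
      obtain rfl : c = c' := h
      obtain rfl : f = f' := ContinuousMap.ext h'
      rfl

noncomputable def Arc.map (φ : ℂ ≃ₜ ℂ) (a : Arc s) : Arc s :=
  ⟨a.col, ⟨fun t => φ (a.fn t), φ.continuous.comp a.fn.continuous⟩, fun _ _ h => a.inj (φ.injective h)⟩

noncomputable def arcEquiv (s : ℕ) (φ : ℂ ≃ₜ ℂ) : Arc s ≃ Arc s where
  toFun := Arc.map φ
  invFun := Arc.map φ.symm
  left_inv a := Arc.ext' rfl fun t => by simp [Arc.map]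
  right_inv a := Arc.ext' rfl fun t => by simp [Arc.map]

lemma Arc.map_im (φ : ℂ ≃ₜ ℂ) (a : Arc s) : (a.map φ).im = φ '' a.im := by
  ext z; simp [Arc.im, Arc.map]

lemma Arc.map_eq_self {φ : ℂ ≃ₜ ℂ} {a : Arc s} (h : ∀ z ∈ a.im, φ z = z) : a.map φ = a :=
  Arc.ext' rfl fun t => h _ ⟨t, rfl⟩

lemma Arc.ok.map {U P U' P' : Set ℂ} {a : Arc s} (φ : ℂ ≃ₜ ℂ) (h : a.ok U P)
    (hU : ∀ z ∈ a.im, φ z ∈ U') (hP : ∀ z ∈ P, φ z ∈ P') (hP' : ∀ z ∈ a.im, φ z ∈ P' → z ∈ P) :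
    (a.map φ).ok U' P' := by
  refine ⟨?_, hP _ h.2.1, hP _ h.2.2.1, fun t h0 h1 ht => h.2.2.2 t h0 h1 (hP' _ ⟨t, rfl⟩ ht)⟩
  rw [Arc.map_im]; rintro _ ⟨z, hz, rfl⟩; exact hU z hz

lemma Del_equiv {V : Type*} (e : V ≃ V) {σ : Finset V} {f : V → ℝ} (hf : f ∈ Del σ) :
    (fun v => f (e.symm v)) ∈ Del (σ.map e.toEmbedding) := by
  refine ⟨fun v => hf.1 _, fun v hv => hf.2.1 _ fun h => hv ?_, ?_⟩
  · rw [Finset.mem_map_equiv]; exact h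
  · rw [Finset.sum_map]; simp [hf.2.2]

lemma push_cont {d : ℕ} {V : Type*} (e : V ≃ V) {f : Sph d → V → ℝ} (hf : Continuous f) :
    Continuous fun x v => f x (e.symm v) :=
  continuous_pi fun v => (continuous_apply (e.symm v)).comp hf

lemma Fill.map_equiv {d : ℕ} {V : Type*} (e : V ≃ V) {F F' : Set (Finset V)} {f : Sph d → V → ℝ}
    (h : ∀ σ ∈ F, σ.map e.toEmbedding ∈ F') (hf : Fill d (RR F) f) :
    Fill d (RR F') (fun x v => f x (e.symm v)) := by
  obtain ⟨g, hg, hgF, hgf⟩ := hf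
  refine ⟨fun x v => g x (e.symm v), continuous_pi fun v => (continuous_apply (e.symm v)).comp hg,
    fun x => ?_, fun x => by simp only [hgf]⟩
  obtain ⟨σ, hσ, hx⟩ := hgF x
  exact ⟨_, h σ hσ, Del_equiv e hx⟩

lemma XX_map {U P U' P' : Set ℂ} (φ : ℂ ≃ₜ ℂ) (hU : ∀ z ∈ U, φ z ∈ U')
    (hP : ∀ z, φ z ∈ P' ↔ z ∈ P) :
    ∀ σ ∈ XX s U P, σ.map (arcEquiv s φ).toEmbedding ∈ XX s U' P' := by
  intro σ hσ
  refine ⟨hσ.1.map, fun b hb => ?_, fun b hb c hc hbc => ?_⟩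
  · obtain ⟨a, ha, rfl⟩ := Finset.mem_map.1 hb
    exact (hσ.2.1 a ha).map φ (fun z hz => hU z ((hσ.2.1 a ha).1 hz)) (fun z hz => (hP z).2 hz)
      fun z _ hz => (hP z).1 hz
  · obtain ⟨a, ha, rfl⟩ := Finset.mem_map.1 hb
    obtain ⟨a', ha', rfl⟩ := Finset.mem_map.1 hc
    have := hσ.2.2 a ha a' ha' fun h => hbc (by rw [h])
    show Disjoint (Arc.map φ a).im (Arc.map φ a').im
    rw [Arc.map_im, Arc.map_im]
    exact (Set.disjoint_image_iff φ.injective).2 this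

/-- local constancy -/
lemma local_const {d : ℕ} (IH : ∀ j < d, Main s j) {U P' : Set ℂ} (hU : IsOpen U)
    (hUc : IsPreconnected U) (hP : P'.Finite) (hPU : P' ⊆ U)
    (hcard : 3 * d + 1 ≤ P'.ncard)
    {f : Sph d → Arc s → ℝ} (hf : Continuous f) (F : Finset (Arc s))
    (hF : ∀ a ∈ F, a.ok U P') (hfs : ∀ x v, f x v ≠ 0 → v ∈ F)
    (hfF : ∀ x, f x ∈ RR (XX s U P')) {x : ℂ} (hx : x ∈ U \ P') :
    ∃ r > 0, ball x r ⊆ U \ P' ∧ ∀ y ∈ ball x r, ∀ y' ∈ ball x r, (∀ a ∈ F, y ∉ a.im) →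
      (∀ a ∈ F, y' ∉ a.im) → Fill d (RR (XX s U (insert y' P'))) f →
      Fill d (RR (XX s U (insert y P'))) f := by
  let A := F.filter fun a => x ∈ a.im
  have hAx : ∀ a ∈ A, x ∈ a.im := fun a ha => (Finset.mem_filter.1 ha).2
  have hAF : ∀ a ∈ A, a ∈ F := fun a ha => (Finset.mem_filter.1 ha).1
  have key : ∀ a : Arc s, ∃ r > 0, ∃ W : Set ℂ, a ∈ A → (IsOpen W ∧ IsPreconnected W ∧
      P' \ a.im ⊆ W ∧ (∀ b ∈ F, Disjoint b.im a.im → b.im ⊆ W) ∧ W ⊆ U \ a.im ∧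
      Disjoint W (closedBall x r)) := by
    intro a
    by_cases ha : a ∈ A
    · let Q : Set ℂ := (P' \ a.im) ∪ ⋃ b ∈ F.filter (fun b => Disjoint b.im a.im), b.im
      have hQ : IsCompact Q := hP.sdiff.isCompact.union
        (Finset.isCompact_biUnion _ fun b _ => b.im_compact)
      obtain ⟨r, hr, W, h1, h2, h3, h4, h5⟩ := exists_W (O := U \ a.im) (Q := Q) (x := x)
        (hU.sdiff a.im_compact.isClosed) (preconn_diff_arc hU hUc a.fn a.inj (hF a (hAF a ha)).1) hQ
        (by
          rintro z (hz | hz)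
          · exact ⟨hPU hz.1, hz.2⟩
          · simp only [mem_iUnion] at hz
            obtain ⟨b, hb, hz⟩ := hz
            rw [Finset.mem_filter] at hb
            exact ⟨(hF b hb.1).1 hz, Set.disjoint_left.1 hb.2 hz⟩)
        (fun h => h.2 (hAx a ha))
      refine ⟨r, hr, W, fun _ => ⟨h1, h2, fun z hz => h3 (Or.inl hz), fun b hb hd z hz => h3 (Or.inr ?_), h4, h5⟩⟩
      simp only [mem_iUnion]
      exact ⟨b, Finset.mem_filter.2 ⟨hb, hd⟩, hz⟩
    · exact ⟨1, one_pos, ∅, fun h => absurd h ha⟩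
  choose ra hra W hW using key
  let G : Set ℂ := (U \ P') \ ⋃ b ∈ F.filter (fun b => x ∉ b.im), b.im
  have hG : IsOpen G := (hU.sdiff hP.isClosed).sdiff
    (Finset.isCompact_biUnion _ fun b _ => b.im_compact).isClosed
  have hxG : x ∈ G := ⟨hx, fun h => by
    simp only [mem_iUnion] at h
    obtain ⟨b, hb, hz⟩ := h
    exact (Finset.mem_filter.1 hb).2 hz⟩
  obtain ⟨r0, hr0, hrG⟩ := Metric.isOpen_iff.1 hG x hxG
  obtain ⟨r1, hr1, hr1A⟩ : ∃ r1 > 0, ∀ a ∈ A, r1 ≤ ra a := by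
    clear_value A
    clear hW hAx hAF
    induction A using Finset.induction_on with
    | empty => exact ⟨1, one_pos, by simp⟩
    | insert a A _ ih =>
      obtain ⟨r, hr, h⟩ := ih
      refine ⟨min r (ra a), lt_min hr (hra a), fun b hb => ?_⟩
      rcases Finset.mem_insert.1 hb with h' | h'
      · rw [h']; exact min_le_right _ _
      · exact (min_le_left _ _).trans (h b h')
  set r := min r0 r1 with hrdef
  have hr : 0 < r := lt_min hr0 hr1
  have hballG : ball x r ⊆ G := (ball_subset_ball (min_le_left _ _)).trans hrG
  have hballU : ball x r ⊆ U \ P' := fun z hz => (hballG hz).1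
  have hballF : ∀ b ∈ F, b ∉ A → ∀ z ∈ b.im, z ∉ ball x r := by
    intro b hb hbA z hz hz'
    refine (hballG hz').2 ?_
    simp only [mem_iUnion]
    exact ⟨b, Finset.mem_filter.2 ⟨hb, fun h => hbA (Finset.mem_filter.2 ⟨hb, h⟩)⟩, hz⟩
  have hballW : ∀ a ∈ A, ∀ z ∈ W a, z ∉ ball x r := by
    intro a ha z hz hz'
    exact Set.disjoint_left.1 (hW a ha).2.2.2.2.2 hz
      (ball_subset_closedBall (ball_subset_ball ((min_le_right _ _).trans (hr1A a ha)) hz'))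
  refine ⟨r, hr, hballU, fun y hy y' hy' hyF hy'F hfill => ?_⟩
  obtain ⟨φ, hφ, hφid⟩ := ball_homeo hy hy'
  let e := arcEquiv s φ
  have hsub : ∀ y, (∀ a ∈ F, y ∉ a.im) → ∀ a ∈ F, a.ok U (insert y P') := fun y hy a ha =>
    (hF a ha).mono (hF a ha).1 (subset_insert _ _) (by
      rintro z ⟨hz | hz, hz'⟩
      · rw [hz] at hz'; exact absurd hz' (hy a ha)
      · exact hz)
  have hfF' : ∀ y, (∀ a ∈ F, y ∉ a.im) → ∀ x, f x ∈ RR (XX s U (insert y P')) := by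
    intro y hy x
    obtain ⟨σ, hσ, hx, hσs⟩ := RR.exists_supp (XX_down _ _) (hfF x)
    exact ⟨σ, ⟨hσ.1, fun a ha => hsub y hy a (hfs x a ((hσs a).1 ha)), hσ.2.2⟩, hx⟩
  have hφU : ∀ z ∈ U, φ z ∈ U := by
    intro z hz
    by_cases h : z ∈ ball x r
    · exact (hballU ((ball_homeo_maps hφid).2 h)).1
    · rw [hφid z h]; exact hz
  have hφP : ∀ z, φ z ∈ insert y P' ↔ z ∈ insert y' P' := by
    intro z
    by_cases h : z ∈ ball x r
    · have h' := (ball_homeo_maps hφid).2 h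
      have h1 : φ z ∉ P' := (hballU h').2
      have h2 : z ∉ P' := (hballU h).2
      simp only [mem_insert_iff, h1, h2, or_false]
      rw [← hφ, φ.injective.eq_iff]
    · rw [hφid z h]
      have h1 : z ≠ y := fun e => h (e ▸ hy)
      have h2 : z ≠ y' := fun e => h (e ▸ hy')
      simp [h1, h2]
  have hpush := Fill.map_equiv e (XX_map (U' := U) φ hφU hφP) hfill
  set f2 : Sph d → Arc s → ℝ := fun x v => f x (e.symm v) with hf2
  have hf2c : Continuous f2 := push_cont e hf
  have hf2F : ∀ x, f2 x ∈ RR (XX s U (insert y P')) := by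
    intro x
    obtain ⟨σ, hσ, hx⟩ := hfF' y' hy'F x
    exact ⟨_, XX_map (U' := U) φ hφU hφP σ hσ, Del_equiv e hx⟩
  have hok : ∀ a ∈ A, a.ok U P' := fun a ha => hF a (hAF a ha)
  have hPW : ∀ a ∈ A, P' \ a.im ⊆ P' ∩ W a := fun a ha z hz => ⟨hz.1, (hW a ha).2.2.1 hz⟩
  obtain ⟨g, hg, hgx⟩ := exists_link (A := A) (XX_down U (insert y P')) (nonadj_of_common hAx) hf (hfF' y hyF)
    (fun a => XX s (W a) (P' ∩ W a))
    (by
      intro a ha j hj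
      obtain ⟨h1, h2, h3, h4, h5, h6⟩ := hW a ha
      refine IH j hj _ _ h1 h2 (hP.inter_of_left _) inter_subset_right ?_
      have e1 := Arc.ncard_diff (hok a ha) hP
      have e2 := ncard_le_ncard (hPW a ha) (hP.inter_of_left _)
      omega)
    (by
      intro x a ha hxa σ hσ hσs hne
      refine ⟨hne, fun b hb => ?_, fun b hb c hc => hσ.2.2 b (Finset.mem_of_mem_erase hb) c
        (Finset.mem_of_mem_erase hc)⟩
      have hb' := Finset.mem_of_mem_erase hb
      have hbF := hfs x b ((hσs b).1 hb')
      have hba := hσ.2.2 b hb' a ((hσs a).2 hxa.ne') (Finset.ne_of_mem_erase hb)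
      have hbW := (hW a ha).2.2.2.1 b hbF hba
      exact (hF b hbF).restrict hbW inter_subset_left fun z hz => ⟨hz.1, hbW hz.2⟩)
  have hPy : ∀ a ∈ A, insert y P' ∩ W a ⊆ P' ∩ W a := by
    rintro a ha z ⟨hz | hz, hzW⟩
    · rw [hz] at hzW; exact absurd hy (hballW a ha _ hzW)
    · exact ⟨hz, hzW⟩
  have hfill1 := Fill.link_iff (A := A) (XX_down U (insert y P')) (nonadj_of_common hAx) hf (hfF' y hyF) hg
    (by
      intro x
      rcases hgx x with h3 | ⟨a, ha, h4, h5, τ, hτ, h6⟩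
      · exact Or.inl h3
      · have h7 := (hW a ha).2.2.2.2.1
        exact Or.inr ⟨a, ha, h4, h5, τ, XX_insert (hsub y hyF a (hAF a ha)) hτ (h7.trans sdiff_subset)
          (inter_subset_left.trans (subset_insert _ _)) (hPy a ha)
          (disjoint_sdiff_left.mono_left h7), h6⟩)
  let A' := A.map e.toEmbedding
  have hA' : NonAdj (XX s U (insert y P')) A' := nonadj_of_common (x := φ x) (by
    intro b hb
    obtain ⟨a, ha, rfl⟩ := Finset.mem_map.1 hb
    show φ x ∈ (Arc.map φ a).im
    rw [Arc.map_im]; exact ⟨x, hAx a ha, rfl⟩)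
  have hphi : ∀ x, phi A' (f2 x) = phi A (f x) := by
    intro x
    simp only [phi, A', Finset.sum_map, hf2]
    exact Finset.sum_congr rfl fun a _ => by rw [Equiv.coe_toEmbedding, Equiv.symm_apply_apply]
  have hfix : ∀ b ∈ F, b ∉ A → e b = b := fun b hb hbA =>
    Arc.map_eq_self fun z hz => hφid z (hballF b hb hbA z hz)
  have hrho : ∀ x, rho A' (f2 x) = rho A (f x) := by
    intro x
    have h0 : ∀ v, (v ∉ F ∨ v ∈ A) → rho A (f x) v = 0 := by
      intro v hv
      unfold rho
      split_ifs with h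
      · rfl
      · rcases hv with hv | hv
        · have : f x v = 0 := by by_contra h'; exact hv (hfs x v h')
          rw [this, zero_div]
        · exact absurd hv h
    have h1 : ∀ v, rho A' (f2 x) v = rho A (f x) (e.symm v) := by
      intro v
      have hm : v ∈ A' ↔ e.symm v ∈ A := Finset.mem_map_equiv
      unfold rho
      rw [hphi]
      by_cases h : e.symm v ∈ A
      · rw [if_pos (hm.2 h), if_pos h]
      · rw [if_neg (mt hm.1 h), if_neg h]
    ext v
    rw [h1]
    by_cases hv : v ∈ F ∧ v ∉ A
    · congr 1; rw [Equiv.symm_apply_eq, hfix v hv.1 hv.2]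
    by_cases hv' : e.symm v ∈ F ∧ e.symm v ∉ A
    · congr 1
      have := hfix _ hv'.1 hv'.2
      rw [Equiv.apply_symm_apply] at this; exact this.symm
    rw [h0 v (by tauto), h0 (e.symm v) (by tauto)]
  have hfill2 := Fill.link_iff (A := A') (XX_down U (insert y P')) hA' hf2c hf2F hg
    (by
      intro u
      rcases hgx u with h3 | ⟨a, ha, h4, h5, τ, hτ, h6⟩
      · left; rw [hphi, hrho]; exact h3
      · have h7 := (hW a ha).2.2.2.2.1
        refine Or.inr ⟨e a, Finset.mem_map_of_mem _ ha, by rw [hphi]; exact h4, by simpa [hf2] using h5, τ,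
          XX_insert ?_ hτ (h7.trans sdiff_subset)
          (inter_subset_left.trans (subset_insert _ _)) (hPy a ha) ?_, h6⟩
        · exact (hsub y' hy'F a (hAF a ha)).map φ (fun z hz => hφU z ((hok a ha).1 hz))
            (fun z hz => (hφP z).2 hz) fun z _ hz => (hφP z).1 hz
        · show Disjoint _ (Arc.map φ a).im
          rw [Arc.map_im, Set.disjoint_left]
          rintro _ hz ⟨w, hw, rfl⟩
          have h8 : w ∉ ball x r := fun h => hballW a ha _ hz ((ball_homeo_maps hφid).2 h)
          rw [hφid w h8] at hz
          exact (h7 hz).2 hw)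
  exact hfill1.1 (hfill2.2 hpush)
end MA

open scoped Classical
namespace MA
open Set Topology Metric
variable {s : ℕ}

lemma good_dense (F : Finset (Arc s)) {x : ℂ} {O : Set ℂ} (hO : IsOpen O) (hx : x ∈ O) :
    ∃ y ∈ O, ∀ a ∈ F, y ∉ a.im := by
  have hd : Dense (⋂ a ∈ F, (a.im)ᶜ) := by
    have : ∀ G : Finset (Arc s), Dense (⋂ a ∈ G, (a.im)ᶜ) ∧ IsOpen (⋂ a ∈ G, (a.im)ᶜ) := by
      intro G
      induction G using Finset.induction_on with
      | empty => simp
      | insert a G _ ih =>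
        have ho : IsOpen (a.im)ᶜ := a.im_compact.isClosed.isOpen_compl
        have hde : Dense (a.im)ᶜ := by
          rw [← interior_eq_empty_iff_dense_compl]; exact arc_interior a.fn a.inj
        have e : (⋂ b ∈ insert a G, (b.im)ᶜ) = (a.im)ᶜ ∩ ⋂ b ∈ G, (b.im)ᶜ := by
          ext z; simp
        rw [e]
        exact ⟨hde.inter_of_isOpen_left ih.1 ho, ho.inter ih.2⟩
    exact (this F).1
  obtain ⟨y, hy, hy'⟩ := hd.inter_open_nonempty O hO ⟨x, hx⟩
  simp only [mem_iInter] at hy'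
  exact ⟨y, hy, fun a ha => hy' a ha⟩

noncomputable def seg (p y : ℂ) (h : p ≠ y) (c : Fin s) : Arc s :=
  ⟨c, ⟨fun t => p + (t : ℝ) • (y - p), by fun_prop⟩, fun t u htu => by
    have h1 : ((t : ℝ) • (y - p)) = (u : ℝ) • (y - p) := add_left_cancel htu
    have := smul_left_injective ℝ (sub_ne_zero.2 h.symm) h1
    exact Subtype.ext this⟩

theorem main_all (hs : 1 ≤ s) : ∀ d, Main s d := by
  intro d
  induction d using Nat.strong_induction_on with
  | _ d IH =>
  intro U P hU hUc hP hPU hcard f0 hf0 hf0F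
  have hc1 : 1 < P.ncard := by omega
  obtain ⟨p, hp, q, hq, hpq⟩ := (Set.one_lt_ncard hP).1 hc1
  obtain ⟨f1, hf1, hf1F, hfill1⟩ := remove IH hU hUc hP hPU (q := q) (by omega) subset_rfl subset_rfl
    inter_subset_left hf0 hf0F
  apply hfill1
  have hUq : IsOpen (U \ {q}) := hU.sdiff isClosed_singleton
  have hUqc : IsPreconnected (U \ {q}) := preconn_diff_finite hU hUc (finite_singleton q) (by simpa using hPU hq)
  have hPq : (P \ {q}).Finite := hP.sdiff
  have hcq : 3 * d + 1 ≤ (P \ {q}).ncard := by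
    have := Set.ncard_sdiff_singleton_add_one hq hP
    omega
  obtain ⟨f2, hf2, hf2F, hfill2⟩ := remove IH hUq hUqc hPq (sdiff_subset_sdiff_left hPU) (q := p) hcq
    (U0 := U) (P0 := P) sdiff_subset sdiff_subset (fun z hz => ⟨hz.1, hz.2.2⟩) hf1 hf1F
  apply hfill2
  -- truncate
  obtain ⟨F0, hF0⟩ := exists_trunc hf2 hf2F
  have hW' := hF0 F0 subset_rfl
  have hX2 : XX s ((U \ {q}) \ {p}) ((P \ {q}) \ {p}) ⊆ XX s U P :=
    XX_mono (sdiff_subset.trans sdiff_subset) (sdiff_subset.trans sdiff_subset)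
      (fun z hz => ⟨⟨hz.1, hz.2.1.2⟩, hz.2.2⟩)
  refine Fill.of_trunc hf2 (fun x => RR.mono hX2 (hf2F x)) hW' ?_
  set f : Sph d → Arc s → ℝ := fun x => trunc F0 (f2 x) with hfdef
  have hf : Continuous f := trunc_cont hf2 hW'
  have hfF2 : ∀ x, f x ∈ RR (XX s ((U \ {q}) \ {p}) ((P \ {q}) \ {p})) := by
    intro x
    obtain ⟨σ, hσ, hx⟩ := hf2F x
    have := trunc_mem hx (hW' x)
    refine ⟨_, (XX_down _ _).2 σ hσ _ Finset.inter_subset_left ?_, this⟩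
    by_contra hne
    rw [Finset.not_nonempty_iff_eq_empty] at hne
    have := this.2.2
    rw [hne] at this; simp at this
  let F := F0.filter fun a => a.ok ((U \ {q}) \ {p}) ((P \ {q}) \ {p})
  have hF2 : ∀ a ∈ F, a.ok ((U \ {q}) \ {p}) ((P \ {q}) \ {p}) := fun a ha => (Finset.mem_filter.1 ha).2
  have hfs : ∀ x v, f x v ≠ 0 → v ∈ F := by
    intro x v hv
    obtain ⟨σ, hσ, hx, hσs⟩ := RR.exists_supp (XX_down _ _) (hfF2 x)
    refine Finset.mem_filter.2 ⟨?_, hσ.2.1 v ((hσs v).2 hv)⟩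
    by_contra hn; exact hv (by simp [hfdef, trunc, hn])
  clear_value f
  set P' := P \ {q} with hP'
  have hP'U : P' ⊆ U := sdiff_subset.trans hPU
  have hF : ∀ a ∈ F, a.ok U P' := fun a ha => (hF2 a ha).mono
    ((hF2 a ha).1.trans (sdiff_subset.trans sdiff_subset)) sdiff_subset
    (fun z hz => ⟨hz.1, ((hF2 a ha).1 hz.2).2⟩)
  have hpF : ∀ a ∈ F, p ∉ a.im := fun a ha h => ((hF2 a ha).1 h).2 rfl
  have hqF : ∀ a ∈ F, q ∉ a.im := fun a ha h => ((hF2 a ha).1 h).1.2 rfl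
  have hfF : ∀ x, f x ∈ RR (XX s U P') := fun x => RR.mono
    (XX_mono (sdiff_subset.trans sdiff_subset) sdiff_subset (fun z hz => ⟨hz.1, hz.2.2⟩)) (hfF2 x)
  have hpP' : p ∈ P' := ⟨hp, hpq⟩
  have hPins : insert q P' = P := by rw [hP', insert_sdiff_singleton, insert_eq_of_mem hq]
  have hO : IsOpen (U \ P') := hU.sdiff hPq.isClosed
  have hOc : IsPreconnected (U \ P') := preconn_diff_finite hU hUc hPq hP'U
  let Null : ℂ → Prop := fun y => Fill d (RR (XX s U (insert y P'))) f
  let Good : ℂ → Prop := fun y => ∀ a ∈ F, y ∉ a.im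
  let S : Set ℂ := {x | ∃ r > 0, ∀ y ∈ ball x r, y ∈ U \ P' → Good y → Null y}
  let T : Set ℂ := {x | ∃ r > 0, ∀ y ∈ ball x r, y ∈ U \ P' → Good y → ¬ Null y}
  have hSo : IsOpen S := by
    rw [Metric.isOpen_iff]
    rintro x ⟨r, hr, h⟩
    refine ⟨r / 2, by positivity, fun z hz => ⟨r / 2, by positivity, fun y hy => h y ?_⟩⟩
    rw [mem_ball] at *
    linarith [dist_triangle y z x]
  have hTo : IsOpen T := by
    rw [Metric.isOpen_iff]
    rintro x ⟨r, hr, h⟩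
    refine ⟨r / 2, by positivity, fun z hz => ⟨r / 2, by positivity, fun y hy => h y ?_⟩⟩
    rw [mem_ball] at *
    linarith [dist_triangle y z x]
  have hcov : U \ P' ⊆ S ∪ T := by
    intro x hx
    obtain ⟨r, hr, hrU, h⟩ := local_const IH hU hUc hPq hP'U hcq hf F hF hfs hfF hx
    by_cases hex : ∃ y' ∈ ball x r, Good y' ∧ Null y'
    · obtain ⟨y', hy', hg', hn'⟩ := hex
      exact Or.inl ⟨r, hr, fun y hy _ hg => h y hy y' hy' hg hg' hn'⟩
    · push Not at hex
      exact Or.inr ⟨r, hr, fun y hy _ hg => hex y hy hg⟩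
  have hdisj : ∀ x ∈ U \ P', x ∈ S → x ∉ T := by
    rintro x hx ⟨r, hr, h⟩ ⟨r', hr', h'⟩
    obtain ⟨y, hy, hg⟩ := good_dense F (O := (U \ P') ∩ ball x (min r r')) (hO.inter isOpen_ball)
      ⟨hx, mem_ball_self (lt_min hr hr')⟩
    exact h' y (ball_subset_ball (min_le_right _ _) hy.2) hy.1 hg
      (h y (ball_subset_ball (min_le_left _ _) hy.2) hy.1 hg)
  -- near p
  have hnear : ∃ y, y ∈ U \ P' ∧ y ∈ S := by
    let G : Set ℂ := (U \ (P' \ {p})) \ ⋃ b ∈ F, b.im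
    have hG : IsOpen G := (hU.sdiff hPq.sdiff.isClosed).sdiff
      (Finset.isCompact_biUnion _ fun b _ => b.im_compact).isClosed
    have hpG : p ∈ G := ⟨⟨hPU hp, fun h => h.2 rfl⟩, fun h => by
      simp only [mem_iUnion] at h
      obtain ⟨b, hb, hz⟩ := h
      exact hpF b hb hz⟩
    obtain ⟨r, hr, hrG⟩ := Metric.isOpen_iff.1 hG p hpG
    have hGF : ∀ z ∈ ball p r, ∀ a ∈ F, z ∉ a.im := by
      intro z hz a ha h
      refine (hrG hz).2 ?_
      simp only [mem_iUnion]; exact ⟨a, ha, h⟩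
    have hGP : ∀ z ∈ ball p r, z ≠ p → z ∉ P' := fun z hz hzp h => (hrG hz).1.2 ⟨h, hzp⟩
    have hGU : ∀ z ∈ ball p r, z ∈ U := fun z hz => (hrG hz).1.1
    have hnull : ∀ y ∈ ball p r, y ≠ p → Null y := by
      intro y hy hyp
      let a0 : Arc s := seg p y hyp.symm ⟨0, hs⟩
      have hpt : ∀ t : unitInterval, a0.fn t = p + (t : ℝ) • (y - p) := fun t => rfl
      have ha0 : a0.im ⊆ ball p r := by
        rintro _ ⟨t, rfl⟩
        rw [hpt, mem_ball, dist_eq_norm, add_sub_cancel_left, norm_smul, Real.norm_eq_abs,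
          abs_of_nonneg t.2.1]
        rw [mem_ball, dist_eq_norm] at hy
        exact (mul_le_of_le_one_left (norm_nonneg _) t.2.2).trans_lt hy
      have hs0 : a0.fn 0 = p := by rw [hpt]; simp
      have hs1 : a0.fn 1 = y := by rw [hpt]; simp
      have hok : a0.ok U (insert y P') := by
        refine ⟨fun z hz => hGU z (ha0 hz), ?_, ?_, ?_⟩
        · rw [hs0]; exact Or.inr hpP'
        · rw [hs1]; exact Or.inl rfl
        · intro t h0 h1 ht
          rcases ht with ht | ht
          · rw [← hs1] at ht; exact h1 (a0.inj ht)
          · refine hGP _ (ha0 ⟨t, rfl⟩) (fun h => ?_) ht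
            rw [← hs0] at h; exact h0 (a0.inj h)
      have hFok : ∀ a ∈ F, a.ok U (insert y P') := fun a ha =>
        (hF a ha).mono (hF a ha).1 (subset_insert _ _) (by
          rintro z ⟨hz | hz, hz'⟩
          · rw [hz] at hz'; exact absurd hz' (hGF y hy a ha)
          · exact hz)
      have hFd : ∀ a ∈ F, Disjoint a0.im a.im := fun a ha =>
        Set.disjoint_left.2 fun z hz hz' => hGF z (ha0 hz) a ha hz'
      refine Fill.cone a0 hf (fun x => ?_) ⟨Finset.singleton_nonempty _, ?_, ?_⟩
      · obtain ⟨σ, hσ, hx, hσs⟩ := RR.exists_supp (XX_down _ _) (hfF x)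
        have hσF : ∀ b ∈ σ, b ∈ F := fun b hb => hfs x b ((hσs b).1 hb)
        refine ⟨σ, ⟨Finset.insert_nonempty _ _, fun b hb => ?_, fun b hb c hc hbc => ?_⟩, hx⟩
        · rcases Finset.mem_insert.1 hb with h | h
          · rw [h]; exact hok
          · exact hFok b (hσF b h)
        · rcases Finset.mem_insert.1 hb with hb' | hb' <;> rcases Finset.mem_insert.1 hc with hc' | hc'
          · exact absurd (hb'.trans hc'.symm) hbc
          · rw [hb']; exact hFd c (hσF c hc')
          · rw [hc']; exact (hFd b (hσF b hb')).symm
          · exact hσ.2.2 b hb' c hc' hbc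
      · intro b hb; rw [Finset.mem_singleton.1 hb]; exact hok
      · intro b hb c hc hbc
        exact absurd ((Finset.mem_singleton.1 hb).trans (Finset.mem_singleton.1 hc).symm) hbc
    let y0 : ℂ := p + ((r / 2 : ℝ) : ℂ)
    have hr2 : ‖((r / 2 : ℝ) : ℂ)‖ = r / 2 := by
      rw [Complex.norm_real, Real.norm_eq_abs, abs_of_pos (by positivity)]
    have hy0 : dist y0 p = r / 2 := by rw [dist_eq_norm, add_sub_cancel_left, hr2]
    have hy0b : y0 ∈ ball p r := by rw [mem_ball, hy0]; linarith
    have hy0p : y0 ≠ p := by intro h; rw [h, dist_self] at hy0; linarith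
    refine ⟨y0, ⟨hGU _ hy0b, hGP _ hy0b hy0p⟩, r / 2, by positivity, fun y hy hyU _ => hnull y ?_ ?_⟩
    · rw [mem_ball] at *; linarith [dist_triangle y y0 p]
    · rintro rfl; exact hyU.2 hpP'
  have hqO : q ∈ U \ P' := ⟨hPU hq, fun h => h.2 rfl⟩
  obtain ⟨y0, hy0, hy0S⟩ := hnear
  have hqS : q ∈ S := by
    rcases hcov hqO with h | h
    · exact h
    · exfalso
      obtain ⟨z, hz, hzS, hzT⟩ := hOc S T hSo hTo hcov ⟨y0, hy0, hy0S⟩ ⟨q, hqO, h⟩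
      exact hdisj z hz hzS hzT
  obtain ⟨r, hr, h⟩ := hqS
  have := h q (mem_ball_self hr) hqO hqF
  simp only [Null, hPins] at this
  exact this
end MA

open scoped Classical
namespace MA
open Set Topology Metric

lemma EP.retract {d : ℕ} {V V' : Type*} {F : Set (Finset V)} {F' : Set (Finset V')} (hF : DownC F)
    (hF' : DownC F') (ι : V → V') (κ : V' → V) (hκ : ∀ v, κ (ι v) = v)
    (h1 : ∀ σ ∈ F, σ.image ι ∈ F') (h2 : ∀ τ ∈ F', τ.image κ ∈ F) (hE : EP d (RR F')) :
    EP d (RR F) := by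
  intro f0 hf0 hf0F
  obtain ⟨W, hW⟩ := exists_trunc hf0 hf0F
  have hW' := hW W subset_rfl
  refine Fill.of_trunc hf0 hf0F hW' ?_
  set f : Sph d → V → ℝ := fun x => trunc W (f0 x) with hfdef
  have hf : Continuous f := trunc_cont hf0 hW'
  have hfF : ∀ x, f x ∈ RR F := by
    intro x
    obtain ⟨σ, hσ, hx⟩ := hf0F x
    have := trunc_mem hx (hW' x)
    refine ⟨_, hF.2 σ hσ _ Finset.inter_subset_left ?_, this⟩
    by_contra hne
    rw [Finset.not_nonempty_iff_eq_empty] at hne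
    have := this.2.2
    rw [hne] at this; simp at this
  have hfs : ∀ x v, f x v ≠ 0 → v ∈ W := by
    intro x v hv
    by_contra hn; exact hv (by simp [hfdef, trunc, hn])
  clear_value f
  have hι : Function.Injective ι := fun a b h => by rw [← hκ a, h, hκ]
  let f' : Sph d → V' → ℝ := fun x v => if ι (κ v) = v then f x (κ v) else 0
  have hf'c : Continuous f' := by
    refine continuous_pi fun v => ?_
    by_cases h : ι (κ v) = v
    · simp only [f', h, if_true]; exact (continuous_apply _).comp hf
    · simp only [f', h, if_false]; exact continuous_const
  have hf'ι : ∀ x v, f' x (ι v) = f x v := fun x v => by simp [f', hκ]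
  have hf'0 : ∀ x v, v ∉ range ι → f' x v = 0 := by
    intro x v hv
    have : ι (κ v) ≠ v := fun h => hv ⟨_, h⟩
    simp [f', this]
  have hf'D : ∀ x σ, f x ∈ Del σ → f' x ∈ Del (σ.image ι) := by
    intro x σ hx
    refine ⟨fun v => ?_, fun v hv => ?_, ?_⟩
    · by_cases h : v ∈ range ι
      · obtain ⟨w, rfl⟩ := h; rw [hf'ι]; exact hx.1 w
      · rw [hf'0 x v h]
    · by_cases h : v ∈ range ι
      · obtain ⟨w, rfl⟩ := h; rw [hf'ι]
        exact hx.2.1 w fun h => hv (Finset.mem_image_of_mem _ h)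
      · rw [hf'0 x v h]
    · rw [Finset.sum_image fun a _ b _ h => hι h]
      simp only [hf'ι]; exact hx.2.2
  obtain ⟨g0, hg0, hg0F, hg0f⟩ := hE f' hf'c fun x => by
    obtain ⟨σ, hσ, hx⟩ := hfF x
    exact ⟨_, h1 σ hσ, hf'D x σ hx⟩
  -- compactness
  obtain ⟨W1, hW1⟩ := exists_trunc (X := closedBall (0 : Fin d → ℝ) 1) (f := fun x => g0 x)
    (hg0.comp continuous_subtype_val) fun x => hg0F x
  let V1 := W1 ∪ W.image ι
  let cl : (Fin d → ℝ) → (Fin d → ℝ) := fun x => (max 1 ‖x‖)⁻¹ • x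
  have hcl : Continuous cl := by
    have h1 : Continuous fun x : Fin d → ℝ => max 1 ‖x‖ := by fun_prop
    exact (h1.inv₀ fun x => by positivity).smul continuous_id
  have hclb : ∀ x, cl x ∈ closedBall (0 : Fin d → ℝ) 1 := by
    intro x
    rw [mem_closedBall_zero_iff, norm_smul, norm_inv, Real.norm_eq_abs, abs_of_pos (by positivity),
      inv_mul_le_one₀ (by positivity)]
    exact le_max_right _ _
  have hcls : ∀ x : Sph d, cl x = x := by
    intro x
    have : ‖(x : Fin d → ℝ)‖ = 1 := mem_sphere_zero_iff_norm.1 x.2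
    simp [cl, this]
  have hpos : ∀ x, 0 < ∑ w ∈ V1, g0 (cl x) w := fun x => hW1 V1 Finset.subset_union_left ⟨cl x, hclb x⟩
  let g : (Fin d → ℝ) → V' → ℝ := fun x => trunc V1 (g0 (cl x))
  have hg : Continuous g := trunc_cont (hg0.comp hcl) hpos
  have hgF : ∀ x, ∃ τ ∈ F', τ ⊆ V1 ∧ g x ∈ Del τ := by
    intro x
    obtain ⟨σ, hσ, hx⟩ := hg0F (cl x)
    have := trunc_mem hx (hpos x)
    refine ⟨_, hF'.2 σ hσ _ Finset.inter_subset_left ?_, Finset.inter_subset_right, this⟩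
    by_contra hne
    rw [Finset.not_nonempty_iff_eq_empty] at hne
    have := this.2.2
    rw [hne] at this; simp at this
  have hgf : ∀ x : Sph d, g x = f' x := by
    intro x
    simp only [g, hcls, hg0f]
    obtain ⟨σ, hσ, hx⟩ := hfF x
    refine trunc_eq (hf'D x σ hx) fun v hv => ?_
    by_cases h : v ∈ range ι
    · obtain ⟨w, rfl⟩ := h
      rw [hf'ι] at hv
      exact Finset.mem_union_right _ (Finset.mem_image_of_mem _ (hfs x w hv))
    · exact absurd (hf'0 x v h) hv
  refine ⟨fun x c => ∑ v ∈ V1.filter (fun v => κ v = c), g x v, ?_, fun x => ?_, fun x => ?_⟩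
  · exact continuous_pi fun c => continuous_finsetSum _ fun v _ => (continuous_apply v).comp hg
  · obtain ⟨τ, hτ, hτV, hx⟩ := hgF x
    refine ⟨_, h2 τ hτ, fun c => Finset.sum_nonneg fun v _ => hx.1 v, fun c hc => ?_, ?_⟩
    · refine Finset.sum_eq_zero fun v hv => hx.2.1 v fun h => hc ?_
      rw [← (Finset.mem_filter.1 hv).2]; exact Finset.mem_image_of_mem _ h
    · have e : ∀ c, ∑ v ∈ V1.filter (fun v => κ v = c), g x v = ∑ v ∈ τ.filter (fun v => κ v = c), g x v := by
        intro c
        symm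
        refine Finset.sum_subset (Finset.filter_subset_filter _ hτV) fun v hv hv' => hx.2.1 v fun h => hv' ?_
        exact Finset.mem_filter.2 ⟨h, (Finset.mem_filter.1 hv).2⟩
      simp only [e]
      rw [Finset.sum_fiberwise_of_maps_to fun v hv => Finset.mem_image_of_mem κ hv]
      exact hx.2.2
  · ext c
    simp only [hgf]
    by_cases hc : ι c ∈ V1
    · rw [Finset.sum_eq_single (ι c)]
      · exact hf'ι x c
      · intro b hb hne
        refine hf'0 x b ?_
        rintro ⟨w, rfl⟩
        have := (Finset.mem_filter.1 hb).2
        rw [hκ] at this; exact hne (by rw [this])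
      · intro h; exact absurd (Finset.mem_filter.2 ⟨hc, hκ c⟩) h
    · rw [Finset.sum_eq_zero]
      · by_contra h
        exact hc (Finset.mem_union_right _ (Finset.mem_image_of_mem _ (hfs x c (Ne.symm h))))
      · intro b hb
        refine hf'0 x b ?_
        rintro ⟨w, rfl⟩
        have := Finset.mem_filter.1 hb
        rw [hκ] at this; exact hc (this.2 ▸ this.1)

def HasSection (s n : ℕ) (P : Fin n → ℂ) : Prop :=
  ∃ sec : ArcClass s n P → ColoredArc s n P, (∀ c, (Quot.mk _ (sec c) : ArcClass s n P) = c) ∧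
    ∀ α β : ColoredArc s n P, (Quot.mk _ α : ArcClass s n P) ≠ Quot.mk _ β → ArcsDisjoint α β →
      ArcsDisjoint (sec (Quot.mk _ α)) (sec (Quot.mk _ β))

theorem assembly (s n : ℕ) (hs : 1 ≤ s) (P : Fin n → ℂ) (hinj : Function.Injective P)
    (hint : ∀ i, P i ∈ Metric.ball (0 : ℂ) 1) (hsec : 2 ≤ n → HasSection s n P) :
    NConnectedSpace (nuZ n - 1) (sMA s n P).realization := by
  apply nconn_realization
  intro d hd
  have hdn : 3 * d + 2 ≤ n := by
    have : (d : ℤ) ≤ nuZ n := by linarith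
    unfold nuZ at this
    rw [Int.fdiv_eq_ediv_of_nonneg _ (by norm_num)] at this
    omega
  obtain ⟨sec, hsec1, hsec2⟩ := hsec (by omega)
  have hcard : (range P).ncard = n := by
    rw [← image_univ, ncard_image_of_injective _ hinj, ncard_univ, Nat.card_fin]
  have hM : ∀ j, 3 * j + 2 ≤ n → EP j (RR (XX s (ball 0 1) (range P))) := fun j hj =>
    main_all hs j _ _ isOpen_ball (convex_ball _ _).isPreconnected (finite_range P)
      (by rintro _ ⟨i, rfl⟩; exact hint i) (by rw [hcard]; exact hj)
  let mk' : ∀ a : Arc s, a.ok (ball 0 1) (range P) → ColoredArc s n P := fun a ha =>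
    { color := a.col, toFun := a.fn, inj := a.inj, mem_ball := fun t => ha.1 ⟨t, rfl⟩
      src := by obtain ⟨i, hi⟩ := ha.2.1; exact ⟨i, hi.symm⟩
      tgt := by obtain ⟨i, hi⟩ := ha.2.2.1; exact ⟨i, hi.symm⟩
      ends_ne := fun h => by have := a.inj h; simp at this
      middle := ha.2.2.2 }
  have hne : Nonempty (ArcClass s n P) := by
    obtain ⟨g, -, hg, -⟩ := hM 0 (by omega) (fun x => by
      exfalso
      have := mem_sphere_zero_iff_norm.1 x.2
      rw [show (x : Fin 0 → ℝ) = 0 from Subsingleton.elim _ _, norm_zero] at this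
      norm_num at this) (by
        have : IsEmpty (Sph 0) := ⟨fun x => by
          have := mem_sphere_zero_iff_norm.1 x.2
          rw [show (x : Fin 0 → ℝ) = 0 from Subsingleton.elim _ _, norm_zero] at this
          norm_num at this⟩
        exact continuous_of_discreteTopology) (fun x => by
          have := mem_sphere_zero_iff_norm.1 x.2
          rw [show (x : Fin 0 → ℝ) = 0 from Subsingleton.elim _ _, norm_zero] at this
          norm_num at this)
    obtain ⟨σ, hσ, -⟩ := hg 0
    obtain ⟨a, ha⟩ := hσ.1
    exact ⟨Quot.mk _ (mk' a (hσ.2.1 a ha))⟩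
  let c0 : ArcClass s n P := Classical.choice hne
  let ι : ArcClass s n P → Arc s := fun c => ⟨(sec c).color, (sec c).toFun, (sec c).inj⟩
  let κ : Arc s → ArcClass s n P := fun a => if h : a.ok (ball 0 1) (range P) then Quot.mk _ (mk' a h) else c0
  have hιok : ∀ c, (ι c).ok (ball 0 1) (range P) := by
    intro c
    refine ⟨?_, ?_, ?_, (sec c).middle⟩
    · rintro _ ⟨t, rfl⟩; exact (sec c).mem_ball t
    · obtain ⟨i, hi⟩ := (sec c).src; exact ⟨i, hi.symm⟩
    · obtain ⟨i, hi⟩ := (sec c).tgt; exact ⟨i, hi.symm⟩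
  have hκι : ∀ c, κ (ι c) = c := by
    intro c
    exact (dif_pos (hιok c)).trans (hsec1 c)
  have hdown : DownC (sMA s n P).faces := by
    refine ⟨fun σ h => h.1, fun σ h τ hτ hn => ⟨hn, ?_⟩⟩
    obtain ⟨-, rep, h1, h2⟩ := h
    refine ⟨fun x => rep ⟨x.1, hτ x.2⟩, fun x => h1 _, fun x y hxy => h2 _ _ fun h => hxy ?_⟩
    exact Subtype.ext (by simpa using h)
  refine EP.retract hdown (XX_down (ball 0 1) (range P)) ι κ hκι ?_ ?_ (hM d hdn)
  · rintro σ ⟨hσ, rep, h1, h2⟩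
    refine ⟨hσ.image _, fun a ha => ?_, fun a ha b hb hab => ?_⟩
    · obtain ⟨c, hc, rfl⟩ := Finset.mem_image.1 ha
      exact hιok c
    · obtain ⟨c, hc, rfl⟩ := Finset.mem_image.1 ha
      obtain ⟨c', hc', rfl⟩ := Finset.mem_image.1 hb
      have hcc : c ≠ c' := fun h => hab (by rw [h])
      have h3 := h2 ⟨c, hc⟩ ⟨c', hc'⟩ fun h => hcc (congrArg Subtype.val h)
      have h4 := hsec2 _ _ (by rw [h1, h1]; exact hcc) h3
      rw [h1, h1] at h4
      rw [Set.disjoint_left]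
      rintro _ ⟨t, rfl⟩ ⟨u, hu⟩
      exact h4 t u hu.symm
  · rintro τ hτ
    refine ⟨hτ.1.image _, ?_⟩
    have hch : ∀ x : {x // x ∈ τ.image κ}, ∃ a ∈ τ, κ a = x.1 := fun x => Finset.mem_image.1 x.2
    choose r hr hκr using hch
    refine ⟨fun x => mk' (r x) (hτ.2.1 _ (hr x)), fun x => ?_, fun x y hxy => ?_⟩
    · exact (dif_pos (hτ.2.1 _ (hr x))).symm.trans (hκr x)
    · have hne : r x ≠ r y := fun h => hxy (Subtype.ext (by rw [← hκr, ← hκr, h]))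
      intro t u htu
      exact Set.disjoint_left.1 (hτ.2.2 _ (hr x) _ (hr y) hne) ⟨t, rfl⟩ ⟨u, htu.symm⟩
end MA

open scoped Classical
namespace MA
open Set Topology Metric

/-- the upper half plane -/
abbrev Hh := {z : ℂ // 0 < z.im}

/-- squared distance to a real centre -/
noncomputable def qq (c : ℝ) (z : ℂ) : ℝ := (z.re - c) ^ 2 + z.im ^ 2

lemma qq_pos (c : ℝ) {z : ℂ} (hz : 0 < z.im) : 0 < qq c z := by unfold qq; positivity

/-- reflection in the circle with centre c, radius 1/2 -/
noncomputable def rf (c : ℝ) (z : ℂ) : ℂ :=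
  ⟨c + (z.re - c) / (4 * qq c z), z.im / (4 * qq c z)⟩

lemma rf_im_pos (c : ℝ) {z : ℂ} (hz : 0 < z.im) : 0 < (rf c z).im := by
  have := qq_pos c hz
  simp only [rf]; positivity

lemma qq_rf (c : ℝ) {z : ℂ} (hz : 0 < z.im) : qq c (rf c z) = 1 / (16 * qq c z) := by
  have := (qq_pos c hz).ne'
  have h : qq c (rf c z) = qq c z / (4 * qq c z) ^ 2 := by
    have h1 : qq c (rf c z) = ((z.re - c) / (4 * qq c z)) ^ 2 + (z.im / (4 * qq c z)) ^ 2 := by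
      rw [qq]; simp only [rf]; ring
    rw [h1]
    generalize 4 * qq c z = Q
    rw [qq]; ring
  rw [h]; field_simp; norm_num

lemma rf_rf (c : ℝ) {z : ℂ} (hz : 0 < z.im) : rf c (rf c z) = z := by
  have h := (qq_pos c hz).ne'
  apply Complex.ext
  · have : (rf c (rf c z)).re = c + ((rf c z).re - c) / (4 * qq c (rf c z)) := rfl
    rw [this, qq_rf c hz]; simp only [rf]; field_simp; ring
  · have : (rf c (rf c z)).im = (rf c z).im / (4 * qq c (rf c z)) := rfl
    rw [this, qq_rf c hz]; simp only [rf]; field_simp; ring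

lemma qq_cont (c : ℝ) : Continuous (qq c) := by unfold qq; fun_prop

lemma rf_cont (c : ℝ) : Continuous (fun z : Hh => (⟨rf c z, rf_im_pos c z.2⟩ : Hh)) := by
  refine Continuous.subtype_mk ?_ _
  have h : ∀ z : Hh, 4 * qq c z ≠ 0 := fun z => by have := qq_pos c z.2; positivity
  have hq : Continuous fun z : Hh => 4 * qq c z :=
    continuous_const.mul ((qq_cont c).comp continuous_subtype_val)
  have h1 : Continuous fun z : Hh => c + (z.1.re - c) / (4 * qq c z) :=
    continuous_const.add (((Complex.continuous_re.comp continuous_subtype_val).sub continuous_const).div hq h)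
  have h2 : Continuous fun z : Hh => z.1.im / (4 * qq c z) :=
    (Complex.continuous_im.comp continuous_subtype_val).div hq h
  exact Complex.equivRealProdCLM.symm.continuous.comp (h1.prodMk h2)

noncomputable def rr (c : ℝ) : Hh ≃ₜ Hh where
  toFun z := ⟨rf c z, rf_im_pos c z.2⟩
  invFun z := ⟨rf c z, rf_im_pos c z.2⟩
  left_inv z := Subtype.ext (rf_rf c z.2)
  right_inv z := Subtype.ext (rf_rf c z.2)
  continuous_toFun := rf_cont c
  continuous_invFun := rf_cont c

lemma rr_mul (c : ℝ) : rr c * rr c = 1 := by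
  ext z; exact rf_rf c z.2

variable {n : ℕ}

noncomputable def ck (k : Fin (n + 1)) : ℝ := (k : ℕ) + 1 / 2

noncomputable def act (l : List (Fin (n + 1))) : Hh ≃ₜ Hh := (l.map fun k => rr (ck k)).prod

@[simp] lemma act_nil : act ([] : List (Fin (n + 1))) = 1 := rfl
@[simp] lemma act_cons (k : Fin (n + 1)) (l) : act (k :: l) = rr (ck k) * act l := by simp [act]
lemma act_append (l l' : List (Fin (n + 1))) : act (l ++ l') = act l * act l' := by simp [act]
lemma act_reverse (l : List (Fin (n + 1))) : act l.reverse = (act l)⁻¹ := by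
  induction l with
  | nil => simp
  | cons k l ih =>
    rw [List.reverse_cons, act_append, ih, act_cons k l, mul_inv_rev]
    congr 1

/-- the fundamental polygon -/
def Pg (n : ℕ) : Set Hh := {z | ∀ k : Fin (n + 1), 1 / 4 ≤ qq (ck k) z}

lemma ck_sep {k j : Fin (n + 1)} (h : k ≠ j) : ck k + 1 ≤ ck j ∨ ck j + 1 ≤ ck k := by
  have h' : (k : ℕ) ≠ j := fun h' => h (Fin.ext h')
  unfold ck
  rcases lt_or_gt_of_ne h' with h1 | h1
  · left; have : ((k : ℕ) : ℝ) + 1 ≤ (j : ℕ) := by exact_mod_cast h1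
    linarith
  · right; have : ((j : ℕ) : ℝ) + 1 ≤ (k : ℕ) := by exact_mod_cast h1
    linarith

lemma disj_of_sep {a b : ℝ} (h : a + 1 ≤ b) {z : ℂ} (hz : 0 < z.im) (ha : qq a z ≤ 1 / 4)
    (hb : qq b z ≤ 1 / 4) : False := by
  unfold qq at *
  have h1 : (z.re - a) < 1 / 2 := by nlinarith
  have h2 : -(1 / 2) < (z.re - b) := by nlinarith
  linarith

lemma disj_closed {k j : Fin (n + 1)} (h : k ≠ j) {z : ℂ} (hz : 0 < z.im)
    (hk : qq (ck k) z ≤ 1 / 4) : 1 / 4 < qq (ck j) z := by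
  by_contra hc
  push Not at hc
  rcases ck_sep h with h | h
  · exact disj_of_sep h hz hk hc
  · exact disj_of_sep h hz hc hk

lemma rf_le {c : ℝ} {z : ℂ} (hz : 0 < z.im) (h : 1 / 4 ≤ qq c z) : qq c (rf c z) ≤ 1 / 4 := by
  rw [qq_rf c hz, div_le_div_iff₀ (by linarith) (by norm_num)]; linarith

lemma rf_lt {c : ℝ} {z : ℂ} (hz : 0 < z.im) (h : 1 / 4 < qq c z) : qq c (rf c z) < 1 / 4 := by
  rw [qq_rf c hz, div_lt_div_iff₀ (by linarith) (by norm_num)]; linarith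

lemma rf_gt {c : ℝ} {z : ℂ} (hz : 0 < z.im) (h : qq c z < 1 / 4) : 1 / 4 < qq c (rf c z) := by
  have := qq_pos c hz
  rw [qq_rf c hz, div_lt_div_iff₀ (by norm_num) (by linarith)]; linarith

lemma rf_eq_self {c : ℝ} {z : ℂ} (h : qq c z = 1 / 4) : rf c z = z := by
  apply Complex.ext <;> simp [rf, h]

lemma ping {l : List (Fin (n + 1))} (hl : l.IsChain (· ≠ ·)) {z : Hh} (hz : z ∈ Pg n) :
    ∀ k ∈ l.head?, qq (ck k) (act l z) ≤ 1 / 4 ∧ (2 ≤ l.length → qq (ck k) (act l z) < 1 / 4) := by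
  induction l with
  | nil => simp
  | cons k l ih =>
    intro k' hk'
    simp only [List.head?_cons, Option.mem_def, Option.some.injEq] at hk'
    subst hk'
    rw [act_cons]
    show qq (ck k) (rf (ck k) (act l z)) ≤ _ ∧ (_ → qq (ck k) (rf (ck k) (act l z)) < _)
    rcases l with _ | ⟨j, l⟩
    · refine ⟨rf_le z.2 (hz k), fun h => by simp at h⟩
    · have h1 := ih (List.IsChain.tail hl) j (by simp)
      have hkj : k ≠ j := (List.isChain_cons_cons.1 hl).1
      have h2 := disj_closed hkj.symm (act (j :: l) z).2 h1.1
      have h3 := rf_lt (act (j :: l) z).2 h2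
      exact ⟨h3.le, fun _ => h3⟩

lemma reduce (l : List (Fin (n + 1))) : ∃ l' : List (Fin (n + 1)), l'.IsChain (· ≠ ·) ∧
    act l' = act l ∧ (Even l'.length ↔ Even l.length) := by
  induction l with
  | nil => exact ⟨[], by simp, rfl, Iff.rfl⟩
  | cons k l ih =>
    obtain ⟨l', h1, h2, h3⟩ := ih
    rcases l' with _ | ⟨j, l''⟩
    · refine ⟨[k], by simp, by rw [act_cons, h2, act_cons], ?_⟩
      simp only [List.length_cons, Nat.even_add_one, ← h3]
    · by_cases hkj : k = j
      · subst hkj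
        refine ⟨l'', List.IsChain.tail h1, ?_, ?_⟩
        · rw [act_cons k l, ← h2, act_cons, ← mul_assoc, rr_mul, one_mul]
        · simp only [List.length_cons, Nat.even_add_one, ← h3, not_not]
      · refine ⟨k :: j :: l'', List.isChain_cons_cons.2 ⟨hkj, h1⟩, by rw [act_cons, h2, act_cons], ?_⟩
        rw [List.length_cons, List.length_cons (as := l), Nat.even_add_one, Nat.even_add_one, h3]

lemma fund {l : List (Fin (n + 1))} {z : Hh} (hz : z ∈ Pg n) (hl : act l z ∈ Pg n) :
    (act l = 1 ∧ Even l.length) ∨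
      ∃ k : Fin (n + 1), act l = rr (ck k) ∧ ¬ Even l.length ∧ qq (ck k) z = 1 / 4 := by
  obtain ⟨l', h1, h2, h3⟩ := reduce l
  rw [← h2] at hl ⊢
  rw [← h3]
  rcases l' with _ | ⟨k, l'⟩
  · left; simp
  · right
    have h4 := ping h1 hz k (by simp)
    have h5 := hl k
    have h6 : ¬ 2 ≤ (k :: l').length := fun h => absurd (h4.2 h) (not_lt.2 h5)
    have h7 : l' = [] := by
      rcases l' with _ | _
      · rfl
      · simp at h6
    subst h7
    refine ⟨k, by simp, by simp, ?_⟩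
    have h8 : qq (ck k) (rf (ck k) z) = 1 / 4 := le_antisymm h4.1 h5
    rw [qq_rf _ z.2] at h8
    have := qq_pos (ck k) z.2
    field_simp at h8
    linarith

/-- termination measure -/
def muS (z : Hh) : Set (ℤ × ℤ) := {p | Complex.normSq (p.1 * z.1 + p.2) < 1}

lemma muS_finite (z : Hh) : (muS z).Finite := by
  have hy := z.2
  obtain ⟨M, hM⟩ := exists_nat_gt (1 / z.1.im)
  obtain ⟨M', hM'⟩ := exists_nat_gt (1 + M * |z.1.re|)
  refine ((Set.finite_Icc (-(M : ℤ)) M).prod (Set.finite_Icc (-(M' : ℤ)) M')).subset ?_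
  rintro ⟨c, d⟩ h
  simp only [muS, Set.mem_ofPred_eq, Complex.normSq_apply, Complex.add_re, Complex.mul_re,
    Complex.intCast_re, Complex.intCast_im, Complex.add_im, Complex.mul_im, zero_mul, sub_zero,
    add_zero] at h
  have h1 : |(c : ℝ) * z.1.im| < 1 := by rw [abs_lt]; constructor <;> nlinarith
  have h2 : |(c : ℝ) * z.1.re + d| < 1 := by rw [abs_lt]; constructor <;> nlinarith
  rw [abs_mul, abs_of_pos hy, ← lt_div_iff₀ hy] at h1
  have h3 : |(c : ℝ)| ≤ M := (h1.trans hM).le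
  have h4 : |(d : ℝ)| ≤ M' := by
    have : |(d : ℝ)| ≤ |(c : ℝ) * z.1.re + d| + |(c : ℝ) * z.1.re| := by
      have := abs_sub ((c : ℝ) * z.1.re + d) ((c : ℝ) * z.1.re)
      rwa [add_sub_cancel_left] at this
    rw [abs_mul] at this
    have := mul_le_mul_of_nonneg_right h3 (abs_nonneg z.1.re)
    linarith
  rw [abs_le] at h3 h4
  refine ⟨⟨?_, ?_⟩, ⟨?_, ?_⟩⟩ <;> simp only [] 
  · have := h3.1; exact_mod_cast this
  · have := h3.2; exact_mod_cast this
  · have := h4.1; exact_mod_cast this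
  · have := h4.2; exact_mod_cast this

lemma muS_lt (k : Fin (n + 1)) (z : Hh) (h : qq (ck k) z < 1 / 4) :
    (muS (rr (ck k) z)).ncard < (muS z).ncard := by
  have hq := qq_pos (ck k) z.2
  let f : ℤ × ℤ → ℤ × ℤ := fun p => (p.1 * (2 * k + 1) + 2 * p.2, -(2 * k * (k + 1)) * p.1 - (2 * k + 1) * p.2)
  have hf : Function.Injective f := by
    rintro ⟨a, b⟩ ⟨a', b'⟩ hh
    simp only [f, Prod.mk.injEq] at hh
    obtain ⟨e1, e2⟩ := hh
    have ea : a = a' := by linear_combination (2 * (k : ℤ) + 1) * e1 + 2 * e2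
    have eb : b = b' := by rw [ea] at e1; linarith
    rw [ea, eb]
  have key : ∀ p : ℤ × ℤ, Complex.normSq (p.1 * (rr (ck k) z).1 + p.2) * (4 * qq (ck k) z) =
      Complex.normSq ((f p).1 * z.1 + (f p).2) := by
    rintro ⟨a, b⟩
    have e : ((rr (ck k) z).1 : ℂ) = rf (ck k) z := rfl
    have hq' : qq (ck k) z = (z.1.re - ((k : ℕ) + 1 / 2)) ^ 2 + z.1.im ^ 2 := rfl
    have hq0 := hq.ne'
    simp only [f, e, Complex.normSq_apply, Complex.add_re, Complex.mul_re,
      Complex.intCast_re, Complex.intCast_im, Complex.add_im, Complex.mul_im, zero_mul, sub_zero,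
      add_zero, rf]
    push_cast
    field_simp
    rw [hq']
    simp only [ck]
    ring
  have hsub : f '' (muS (rr (ck k) z)) ⊆ muS z \ {((2, -(2 * (k : ℕ) + 1)) : ℤ × ℤ)} := by
    rintro _ ⟨p, hp, rfl⟩
    have hp' : Complex.normSq (p.1 * (rr (ck k) z).1 + p.2) < 1 := hp
    have h1 := key p
    have h2 := Complex.normSq_nonneg (p.1 * (rr (ck k) z).1 + p.2)
    refine ⟨?_, ?_⟩
    · show Complex.normSq ((f p).1 * z.1 + (f p).2) < 1
      rw [← h1]; nlinarith
    · intro he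
      simp only [mem_singleton_iff] at he
      rw [he] at h1
      have : Complex.normSq (((2 : ℤ) : ℂ) * z.1 + ((-(2 * k + 1) : ℤ) : ℂ)) = 4 * qq (ck k) z := by
        simp only [Complex.normSq_apply, Complex.add_re, Complex.mul_re,
          Complex.intCast_re, Complex.intCast_im, Complex.add_im, Complex.mul_im, zero_mul, sub_zero,
          add_zero, qq, ck]
        push_cast; ring
      rw [this] at h1
      nlinarith
  have hmem : ((2, -(2 * k + 1)) : ℤ × ℤ) ∈ muS z := by
    show Complex.normSq (((2 : ℤ) : ℂ) * z.1 + ((-(2 * k + 1) : ℤ) : ℂ)) < 1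
    have : Complex.normSq (((2 : ℤ) : ℂ) * z.1 + ((-(2 * k + 1) : ℤ) : ℂ)) = 4 * qq (ck k) z := by
      simp only [Complex.normSq_apply, Complex.add_re, Complex.mul_re,
        Complex.intCast_re, Complex.intCast_im, Complex.add_im, Complex.mul_im, zero_mul, sub_zero,
        add_zero, qq, ck]
      push_cast; ring
    rw [this]; linarith
  rw [← Set.ncard_image_of_injective _ hf]
  calc _ ≤ (muS z \ {((2, -(2 * (k : ℕ) + 1)) : ℤ × ℤ)}).ncard := Set.ncard_le_ncard hsub ((muS_finite z).sdiff)
    _ < _ := Set.ncard_sdiff_singleton_lt_of_mem hmem (muS_finite z)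

/-- induction principle: reflect into the polygon -/
lemma mu_ind {C : Hh → Prop} (h0 : ∀ z ∈ Pg n, C z)
    (h1 : ∀ (z : Hh) (k : Fin (n + 1)), qq (ck k) z < 1 / 4 → C (rr (ck k) z) → C z) (z : Hh) : C z := by
  induction hm : (muS z).ncard using Nat.strong_induction_on generalizing z with
  | _ m ih =>
    by_cases hz : z ∈ Pg n
    · exact h0 z hz
    · simp only [Pg, Set.mem_ofPred_eq, not_forall, not_le] at hz
      obtain ⟨k, hk⟩ := hz
      exact h1 z k hk (ih _ (hm ▸ muS_lt k z hk) _ rfl)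

lemma exists_word (n : ℕ) (z : Hh) : ∃ l : List (Fin (n + 1)), act l z ∈ Pg n := by
  induction z using mu_ind (n := n) with
  | h0 z hz => exact ⟨[], hz⟩
  | h1 z k hk ih =>
    obtain ⟨l, hl⟩ := ih
    refine ⟨l ++ [k], ?_⟩
    rw [act_append]; simpa using hl
end MA

open scoped Classical
namespace MA
open Set Topology Metric Filter

variable {n : ℕ}

noncomputable def gg (n : ℕ) (x : ℝ) : ℝ := ∑ k : Fin (n + 1), Real.sqrt (1 / 4 - (x - ck k) ^ 2)

lemma gg_cont (n : ℕ) : Continuous (gg n) := by unfold gg; fun_prop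

lemma gg_nonneg (x : ℝ) : 0 ≤ gg n x := Finset.sum_nonneg fun _ _ => Real.sqrt_nonneg _

lemma gg_eq {k : Fin (n + 1)} {x : ℝ} (h : (x - ck k) ^ 2 ≤ 1 / 4) :
    gg n x = Real.sqrt (1 / 4 - (x - ck k) ^ 2) := by
  unfold gg
  rw [Finset.sum_eq_single k _ (by simp)]
  intro j _ hj
  apply Real.sqrt_eq_zero_of_nonpos
  have h1 : x - ck k ≤ 1 / 2 := by nlinarith
  have h2 : -(1 / 2) ≤ x - ck k := by nlinarith
  rcases ck_sep hj with h | h <;> nlinarith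

lemma gg_zero {x : ℝ} (h : ∀ k : Fin (n + 1), 1 / 4 ≤ (x - ck k) ^ 2) : gg n x = 0 :=
  Finset.sum_eq_zero fun k _ => Real.sqrt_eq_zero_of_nonpos (by linarith [h k])

lemma gg_pos {x : ℝ} : 0 < gg n x ↔ ∃ k : Fin (n + 1), (x - ck k) ^ 2 < 1 / 4 := by
  constructor
  · intro h
    by_contra hc
    push Not at hc
    exact h.ne' (gg_zero hc)
  · rintro ⟨k, hk⟩
    rw [gg_eq hk.le]
    exact Real.sqrt_pos.2 (by linarith)

lemma Pg_iff (z : Hh) : z ∈ Pg n ↔ gg n z.1.re ≤ z.1.im := by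
  constructor
  · intro h
    by_cases hc : ∃ k : Fin (n + 1), (z.1.re - ck k) ^ 2 < 1 / 4
    · obtain ⟨k, hk⟩ := hc
      rw [gg_eq hk.le]
      apply Real.sqrt_le_iff.2 ⟨z.2.le, ?_⟩
      have := h k
      unfold qq at this; linarith
    · push Not at hc
      rw [gg_zero hc]; exact z.2.le
  · intro h k
    by_cases hk : (z.1.re - ck k) ^ 2 ≤ 1 / 4
    · rw [gg_eq hk, Real.sqrt_le_iff] at h
      unfold qq; linarith [h.2]
    · push Not at hk
      unfold qq; nlinarith [z.2]

lemma wall_iff {k : Fin (n + 1)} {z : Hh} (h : qq (ck k) z = 1 / 4) : gg n z.1.re = z.1.im := by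
  have hz := z.2
  unfold qq at h
  rw [gg_eq (k := k) (by nlinarith), show 1 / 4 - (z.1.re - ck k) ^ 2 = z.1.im ^ 2 by linarith,
    Real.sqrt_sq hz.le]

lemma wall_of {z : Hh} (h : gg n z.1.re = z.1.im) : ∃ k : Fin (n + 1), qq (ck k) z = 1 / 4 := by
  have hp : 0 < gg n z.1.re := h ▸ z.2
  obtain ⟨k, hk⟩ := gg_pos.1 hp
  refine ⟨k, ?_⟩
  rw [gg_eq hk.le] at h
  unfold qq
  rw [← h, Real.sq_sqrt (by linarith)]; ring

noncomputable def rhoH (n : ℕ) (z : ℂ) : ℂ := ⟨z.re, z.im - gg n z.re⟩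
noncomputable def upm (n : ℕ) (z : ℂ) : ℂ := ⟨z.re, z.im + gg n z.re⟩

lemma mk_cont {X : Type*} [TopologicalSpace X] {f g : X → ℝ} (hf : Continuous f) (hg : Continuous g) :
    Continuous fun x => (⟨f x, g x⟩ : ℂ) :=
  Complex.equivRealProdCLM.symm.continuous.comp (hf.prodMk hg)

lemma rho_cont (n : ℕ) : Continuous (rhoH n) := by
  have := gg_cont n
  exact mk_cont Complex.continuous_re (by fun_prop)
lemma upm_cont (n : ℕ) : Continuous (upm n) := by
  have := gg_cont n
  exact mk_cont Complex.continuous_re (by fun_prop)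
lemma rho_upm (z : ℂ) : rhoH n (upm n z) = z := by apply Complex.ext <;> simp [rhoH, upm]
lemma upm_rho (z : ℂ) : upm n (rhoH n z) = z := by apply Complex.ext <;> simp [rhoH, upm]
lemma rho_inj : Function.Injective (rhoH n) := Function.LeftInverse.injective upm_rho
lemma rho_im_nonneg {z : Hh} (h : z ∈ Pg n) : 0 ≤ (rhoH n z).im := by
  rw [Pg_iff] at h; simp only [rhoH]; linarith
lemma rho_wall {k : Fin (n + 1)} {z : Hh} (h : qq (ck k) z = 1 / 4) : (rhoH n z).im = 0 := by
  have := wall_iff h; simp only [rhoH]; linarith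
lemma conj_eq_of_im {w : ℂ} (h : w.im = 0) : (starRingEnd ℂ) w = w := Complex.conj_eq_iff_im.2 h

noncomputable def cj (b : ℕ) (w : ℂ) : ℂ := if Even b then w else (starRingEnd ℂ) w

lemma cj_add (a b : ℕ) (w : ℂ) : cj (a + b) w = cj a (cj b w) := by
  unfold cj
  by_cases ha : Even a <;> by_cases hb : Even b <;> simp [ha, hb, Nat.even_add]
lemma cj_cj (a : ℕ) (w : ℂ) : cj a (cj a w) = w := by
  unfold cj
  by_cases ha : Even a <;> simp [ha]
lemma cj_one (w : ℂ) : cj 1 w = (starRingEnd ℂ) w := by simp [cj]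
lemma cj_cont (a : ℕ) : Continuous (cj a) := by
  unfold cj
  by_cases ha : Even a <;> simp [ha, Complex.continuous_conj, continuous_id']

lemma pz_wd {l l' : List (Fin (n + 1))} {z : Hh} (h : act l z ∈ Pg n) (h' : act l' z ∈ Pg n) :
    act l z = act l' z ∧ cj l.length (rhoH n (act l z)) = cj l'.length (rhoH n (act l' z)) := by
  have e : act (l' ++ l.reverse) (act l z) = act l' z := by
    rw [act_append, act_reverse, Homeomorph.mul_apply]; simp
  have := fund (l := l' ++ l.reverse) h (by rw [e]; exact h')
  rcases this with ⟨h1, h2⟩ | ⟨k, h1, h2, h3⟩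
  · rw [h1] at e
    have e' : act l z = act l' z := e
    rw [List.length_append, List.length_reverse, Nat.even_add] at h2
    refine ⟨e', ?_⟩
    rw [e', cj, cj]; simp [h2]
  · rw [h1] at e
    have e' : act l z = act l' z := by
      rw [← e]; exact Subtype.ext (rf_eq_self h3).symm
    refine ⟨e', ?_⟩
    have := conj_eq_of_im (rho_wall h3)
    rw [← e', cj, cj, this]; simp

noncomputable def wd (n : ℕ) (z : Hh) : List (Fin (n + 1)) := (exists_word n z).choose
lemma wd_spec (n : ℕ) (z : Hh) : act (wd n z) z ∈ Pg n := (exists_word n z).choose_spec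

/-- representative in the fundamental polygon -/
noncomputable def Fd (n : ℕ) (z : Hh) : Hh := act (wd n z) z
/-- the covering map -/
noncomputable def pp (n : ℕ) (z : Hh) : ℂ := cj (wd n z).length (rhoH n (Fd n z))

lemma Fd_eq {l : List (Fin (n + 1))} {z : Hh} (h : act l z ∈ Pg n) : Fd n z = act l z :=
  (pz_wd (wd_spec n z) h).1
lemma pp_eq {l : List (Fin (n + 1))} {z : Hh} (h : act l z ∈ Pg n) :
    pp n z = cj l.length (rhoH n (act l z)) :=
  (pz_wd (wd_spec n z) h).2
lemma Fd_mem (z : Hh) : Fd n z ∈ Pg n := wd_spec n z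
lemma Fd_act (l : List (Fin (n + 1))) (z : Hh) : Fd n (act l z) = Fd n z := by
  have e : act (wd n z ++ l.reverse) (act l z) = act (wd n z) z := by
    rw [act_append, act_reverse, Homeomorph.mul_apply]; simp
  rw [Fd_eq (l := wd n z ++ l.reverse) (by rw [e]; exact wd_spec n z), e]; rfl
lemma pp_act (l : List (Fin (n + 1))) (z : Hh) : pp n (act l z) = cj l.length (pp n z) := by
  have e : act (wd n z ++ l.reverse) (act l z) = act (wd n z) z := by
    rw [act_append, act_reverse, Homeomorph.mul_apply]; simp
  rw [pp_eq (l := wd n z ++ l.reverse) (by rw [e]; exact wd_spec n z), e, List.length_append,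
    List.length_reverse, add_comm, cj_add]; rfl
lemma pp_Pg {z : Hh} (h : z ∈ Pg n) : pp n z = rhoH n z := by
  rw [pp_eq (l := []) (by simpa using h)]; simp [cj]
lemma Fd_Pg {z : Hh} (h : z ∈ Pg n) : Fd n z = z := by
  rw [Fd_eq (l := []) (by simpa using h)]; simp
lemma pp_rr (k : Fin (n + 1)) (z : Hh) : pp n (rr (ck k) z) = (starRingEnd ℂ) (pp n z) := by
  have := pp_act [k] z
  simpa [cj_one] using this

lemma pp_fiber {z z' : Hh} : pp n z = pp n z' ↔
    ∃ l : List (Fin (n + 1)), Even l.length ∧ act l z' = z := by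
  constructor
  · intro h
    have key : ∀ (hp : Even ((wd n z).length + (wd n z').length) ↔ True) (he : Fd n z = Fd n z'),
        ∃ l : List (Fin (n + 1)), Even l.length ∧ act l z' = z := by
      intro hp he
      refine ⟨(wd n z).reverse ++ wd n z', by simpa using hp, ?_⟩
      rw [act_append, act_reverse, Homeomorph.mul_apply, Homeomorph.inv_apply,
        Homeomorph.symm_apply_eq]
      exact he.symm
    have hz := rho_im_nonneg (Fd_mem (n := n) z)
    have hz' := rho_im_nonneg (Fd_mem (n := n) z')
    unfold pp at h
    by_cases hp : Even ((wd n z).length + (wd n z').length)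
    · refine key (by simpa using hp) ?_
      rw [Nat.even_add] at hp
      unfold cj at h
      rw [Subtype.ext_iff]
      by_cases hh : Even (wd n z).length
      · simp only [hh, hp.1 hh, if_true] at h; exact rho_inj h
      · have : ¬ Even (wd n z').length := fun h' => hh (hp.2 h')
        simp only [hh, this, if_false] at h
        exact rho_inj ((starRingEnd ℂ).injective h)
    · have h1 : rhoH n (Fd n z) = (starRingEnd ℂ) (rhoH n (Fd n z')) := by
        rw [Nat.even_add] at hp
        unfold cj at h
        by_cases hh : Even (wd n z).length
        · have : ¬ Even (wd n z').length := fun h' => hp (by simp [hh, h'])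
          simpa [hh, this] using h
        · have : Even (wd n z').length := by by_contra h'; exact hp (by simp [hh, h'])
          simp only [hh, this, if_true, if_false] at h
          rw [← h]; simp
      have h2 : (rhoH n (Fd n z)).im = 0 := by
        have := congrArg Complex.im h1
        rw [Complex.conj_im] at this; linarith
      have h3 : (rhoH n (Fd n z')).im = 0 := by
        have := congrArg Complex.im h1
        rw [Complex.conj_im] at this; linarith
      rw [conj_eq_of_im h3] at h1
      have he : Fd n z = Fd n z' := Subtype.ext (rho_inj h1)
      obtain ⟨k, hk⟩ := wall_of (n := n) (z := Fd n z') (by simp only [rhoH] at h3; linarith)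
      refine ⟨(wd n z).reverse ++ k :: wd n z', ?_, ?_⟩
      · rw [List.length_append, List.length_reverse, List.length_cons, ← add_assoc, Nat.even_add_one]
        exact hp
      · rw [act_append, act_reverse, Homeomorph.mul_apply, Homeomorph.inv_apply,
          Homeomorph.symm_apply_eq, act_cons, Homeomorph.mul_apply]
        show rr (ck k) (Fd n z') = Fd n z
        rw [he]; exact Subtype.ext (rf_eq_self hk)
  · rintro ⟨l, hl, rfl⟩
    rw [pp_act]; simp [cj, hl]

/-- the image -/
def YY (n : ℕ) : Set ℂ := {w | w.im ≠ 0 ∨ ∃ k : Fin (n + 1), (w.re - ck k) ^ 2 < 1 / 4}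

lemma cj_YY {w : ℂ} (a : ℕ) (h : w ∈ YY n) : cj a w ∈ YY n := by
  unfold cj
  split_ifs
  · exact h
  · simpa [YY] using h

lemma pp_mem (z : Hh) : pp n z ∈ YY n := by
  refine cj_YY _ ?_
  by_cases h : (rhoH n (Fd n z)).im = 0
  · right
    have : gg n (Fd n z).1.re = (Fd n z).1.im := by simp only [rhoH] at h; linarith
    exact gg_pos.1 (this ▸ (Fd n z).2)
  · exact Or.inl h

lemma upm_pos {w : ℂ} (h : w ∈ YY n) (h0 : 0 ≤ w.im) : 0 < (upm n w).im := by
  simp only [upm]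
  rcases h with h | h
  · have := lt_of_le_of_ne h0 h.symm
    have := gg_nonneg (n := n) w.re
    linarith
  · have := gg_pos.2 h
    linarith

lemma upm_Pg {w : ℂ} (h : 0 < (upm n w).im) (h0 : 0 ≤ w.im) : (⟨upm n w, h⟩ : Hh) ∈ Pg n := by
  rw [Pg_iff]; simp only [upm]; linarith

lemma pp_upm {w : ℂ} (h : 0 < (upm n w).im) (h0 : 0 ≤ w.im) : pp n ⟨upm n w, h⟩ = w := by
  rw [pp_Pg (upm_Pg h h0)]; exact rho_upm w

lemma pp_surj {w : ℂ} (h : w ∈ YY n) : ∃ z, pp n z = w := by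
  rcases le_or_gt 0 w.im with h0 | h0
  · exact ⟨_, pp_upm (upm_pos h h0) h0⟩
  · have h1 : (starRingEnd ℂ) w ∈ YY n := by have := cj_YY 1 h; rwa [cj_one] at this
    have h2 : 0 ≤ ((starRingEnd ℂ) w).im := by simp; linarith
    refine ⟨rr (ck (0 : Fin (n + 1))) ⟨_, upm_pos h1 h2⟩, ?_⟩
    rw [pp_rr, pp_upm _ h2]; simp

lemma Uk (e : Hh) (he : e ∈ Pg n) : ∃ k : Fin (n + 1), ∀ᶠ z : Hh in 𝓝 e,
    (z ∈ Pg n ∧ pp n z = rhoH n z) ∨ (rr (ck k) z ∈ Pg n ∧ pp n z = (starRingEnd ℂ) (rhoH n (rr (ck k) z)) ∧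
      0 < (rhoH n (rr (ck k) z)).im ∧ qq (ck k) e = 1 / 4) := by
  by_cases hw : ∃ k : Fin (n + 1), qq (ck k) e = 1 / 4
  · obtain ⟨k, hk⟩ := hw
    refine ⟨k, ?_⟩
    have h1 : ∀ᶠ z : Hh in 𝓝 e, ∀ j : Fin (n + 1), j ≠ k → 1 / 4 < qq (ck j) z := by
      rw [eventually_all]; intro j
      by_cases hj : j = k
      · simp [hj]
      · have := ((qq_cont (ck j)).comp continuous_subtype_val).continuousAt.eventually_const_lt
          (disj_closed (Ne.symm hj) e.2 hk.le)
        exact this.mono fun z hz _ => hz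
    have hek : rr (ck k) e = e := Subtype.ext (rf_eq_self hk)
    have h2 : ∀ᶠ z : Hh in 𝓝 e, ∀ j : Fin (n + 1), j ≠ k → 1 / 4 < qq (ck j) (rr (ck k) z) := by
      have : Tendsto (rr (ck k)) (𝓝 e) (𝓝 e) := by
        have := (rr (ck k)).continuous.tendsto e; rwa [hek] at this
      exact this.eventually h1
    filter_upwards [h1, h2] with z h1 h2
    by_cases hz : 1 / 4 ≤ qq (ck k) z
    · left
      have : z ∈ Pg n := fun j => by
        by_cases hj : j = k
        · rw [hj]; exact hz
        · exact (h1 j hj).le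
      exact ⟨this, pp_Pg this⟩
    · right
      push Not at hz
      have hg := rf_gt z.2 hz
      have : rr (ck k) z ∈ Pg n := fun j => by
        by_cases hj : j = k
        · rw [hj]; exact hg.le
        · exact (h2 j hj).le
      refine ⟨this, ?_, ?_, hk⟩
      · rw [← pp_Pg this, pp_rr]; simp
      · refine lt_of_le_of_ne (rho_im_nonneg this) fun hh => ?_
        obtain ⟨j, hj⟩ := wall_of (n := n) (z := rr (ck k) z) (by simp only [rhoH] at hh; linarith)
        by_cases hjk : j = k
        · rw [hjk] at hj; exact hg.ne' hj
        · exact (h2 j hjk).ne' hj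
  · push Not at hw
    refine ⟨0, ?_⟩
    have h1 : ∀ᶠ z : Hh in 𝓝 e, ∀ j : Fin (n + 1), 1 / 4 < qq (ck j) z := by
      rw [eventually_all]; intro j
      exact ((qq_cont (ck j)).comp continuous_subtype_val).continuousAt.eventually_const_lt
          (lt_of_le_of_ne (he j) (hw j).symm)
    filter_upwards [h1] with z h1
    left
    have : z ∈ Pg n := fun j => (h1 j).le
    exact ⟨this, pp_Pg this⟩

lemma pp_conj_formula (l : List (Fin (n + 1))) : pp n = fun z => cj l.length (pp n (act l z)) := by
  funext z; rw [pp_act, cj_cj]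

lemma pp_cont : Continuous (pp n) := by
  have h0 : ∀ e ∈ Pg n, ContinuousAt (pp n) e := by
    intro e he
    obtain ⟨k, hk⟩ := Uk e he
    intro V hV
    rw [pp_Pg he] at hV
    have h1 : ∀ᶠ z : Hh in 𝓝 e, rhoH n z ∈ V :=
      ((rho_cont n).comp continuous_subtype_val).continuousAt hV
    have h2 : ∀ᶠ z : Hh in 𝓝 e, qq (ck k) e = 1 / 4 → (starRingEnd ℂ) (rhoH n (rr (ck k) z)) ∈ V := by
      by_cases hw : qq (ck k) e = 1 / 4
      · have : Continuous fun z : Hh => (starRingEnd ℂ) (rhoH n (rr (ck k) z)) :=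
          Complex.continuous_conj.comp ((rho_cont n).comp (continuous_subtype_val.comp (rr (ck k)).continuous))
        have h3 := this.continuousAt (x := e)
        rw [ContinuousAt, show rr (ck k) e = e from Subtype.ext (rf_eq_self hw),
          conj_eq_of_im (rho_wall hw)] at h3
        exact Filter.mem_of_superset (h3 hV) fun z hz _ => hz
      · exact Eventually.of_forall fun z h => absurd h hw
    show ∀ᶠ z in 𝓝 e, pp n z ∈ V
    filter_upwards [hk, h1, h2] with z hk h1 h2
    rcases hk with hk | hk
    · rw [hk.2]; exact h1
    · rw [hk.2.1]; exact h2 hk.2.2.2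
  rw [continuous_iff_continuousAt]
  intro e
  rw [pp_conj_formula (wd n e)]
  refine (cj_cont _).continuousAt.comp ?_
  exact ContinuousAt.comp (h0 _ (wd_spec n e)) (act (wd n e)).continuous.continuousAt

lemma pp_locinj (e : Hh) : ∃ U ∈ 𝓝 e, InjOn (pp n) U := by
  have h0 : ∀ e ∈ Pg n, ∃ U ∈ 𝓝 e, InjOn (pp n) U := by
    intro e he
    obtain ⟨k, hk⟩ := Uk e he
    refine ⟨_, hk, ?_⟩
    intro z hz z' hz' hzz
    rcases hz with hz | hz <;> rcases hz' with hz' | hz'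
    · rw [hz.2, hz'.2] at hzz; exact Subtype.ext (rho_inj hzz)
    · exfalso
      rw [hz.2, hz'.2.1] at hzz
      have := congrArg Complex.im hzz
      rw [Complex.conj_im] at this
      linarith [hz'.2.2.1, rho_im_nonneg hz.1]
    · exfalso
      rw [hz'.2, hz.2.1] at hzz
      have := congrArg Complex.im hzz
      rw [Complex.conj_im] at this
      linarith [hz.2.2.1, rho_im_nonneg hz'.1]
    · rw [hz.2.1, hz'.2.1] at hzz
      exact (rr (ck k)).injective (Subtype.ext (rho_inj ((starRingEnd ℂ).injective hzz)))
  obtain ⟨U, hU, hUi⟩ := h0 _ (wd_spec n e)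
  refine ⟨act (wd n e) ⁻¹' U, (act (wd n e)).continuous.continuousAt hU, ?_⟩
  intro z hz z' hz' hzz
  have : pp n (act (wd n e) z) = pp n (act (wd n e) z') := by rw [pp_act, pp_act, hzz]
  exact (act (wd n e)).injective (hUi hz hz' this)

lemma pp_open (e : Hh) : 𝓝 (pp n e) ≤ map (pp n) (𝓝 e) := by
  have h0 : ∀ e ∈ Pg n, 𝓝 (pp n e) ≤ map (pp n) (𝓝 e) := by
    intro e he V hV
    rw [mem_map, nhds_induced, mem_comap] at hV
    obtain ⟨V', hV', hVV⟩ := hV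
    rw [pp_Pg he]
    obtain ⟨k, hk⟩ : ∃ k : Fin (n + 1), (rhoH n e).im = 0 → qq (ck k) e = 1 / 4 := by
      by_cases h : (rhoH n e).im = 0
      · obtain ⟨k, hk⟩ := wall_of (n := n) (z := e) (by simp only [rhoH] at h; linarith)
        exact ⟨k, fun _ => hk⟩
      · exact ⟨0, fun h' => absurd h' h⟩
    have hV'' : V' ∩ {z : ℂ | 0 < z.im} ∈ 𝓝 (e : ℂ) :=
      inter_mem hV' ((isOpen_lt continuous_const Complex.continuous_im).mem_nhds e.2)
    have h1 : ∀ᶠ w in 𝓝 (rhoH n e), upm n w ∈ V' ∩ {z : ℂ | 0 < z.im} := by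
      have := (upm_cont n).continuousAt (x := rhoH n e)
      rw [ContinuousAt, upm_rho] at this
      exact this hV''
    have h2 : ∀ᶠ w in 𝓝 (rhoH n e), w.im < 0 → 0 < (upm n ((starRingEnd ℂ) w)).im ∧
        rf (ck k) (upm n ((starRingEnd ℂ) w)) ∈ V' := by
      by_cases h : (rhoH n e).im = 0
      · have hc : Tendsto (fun w => upm n ((starRingEnd ℂ) w)) (𝓝 (rhoH n e)) (𝓝 (e : ℂ)) := by
          have := ((upm_cont n).comp Complex.continuous_conj).continuousAt (x := rhoH n e)
          rw [ContinuousAt, Function.comp_apply, conj_eq_of_im h, upm_rho] at this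
          exact this
        have h3 : ∀ᶠ z in 𝓝 (e : ℂ), 0 < z.im ∧ rf (ck k) z ∈ V' := by
          have hr := (continuous_subtype_val.comp (rr (ck k)).continuous).continuousAt (x := e)
          have e1 : ((Subtype.val : Hh → ℂ) ∘ (rr (ck k))) e = e := rf_eq_self (hk h)
          rw [ContinuousAt, e1] at hr
          have h4 := hr hV'
          rw [mem_map, nhds_induced, mem_comap] at h4
          obtain ⟨W, hW, hWV⟩ := h4
          filter_upwards [hW, (isOpen_lt continuous_const Complex.continuous_im).mem_nhds e.2] with z hz hz'
          exact ⟨hz', hWV (show (⟨z, hz'⟩ : Hh) ∈ Subtype.val ⁻¹' W from hz)⟩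
        exact (hc.eventually h3).mono fun w hw _ => hw
      · have h5 : 0 < (rhoH n e).im := lt_of_le_of_ne (rho_im_nonneg he) (Ne.symm h)
        filter_upwards [Complex.continuous_im.continuousAt.eventually_const_lt h5] with w hw hw'
        linarith
    filter_upwards [h1, h2] with w h1 h2
    rcases le_or_gt 0 w.im with h0 | h0
    · rw [← pp_upm h1.2 h0]
      exact hVV (show (⟨upm n w, h1.2⟩ : Hh) ∈ Subtype.val ⁻¹' V' from h1.1)
    · have h3 := h2 h0
      have h4 : w = pp n (rr (ck k) ⟨_, h3.1⟩) := by
        rw [pp_rr, pp_upm _ (by simp; linarith)]; simp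
      rw [h4]
      exact hVV (show rr (ck k) ⟨_, h3.1⟩ ∈ Subtype.val ⁻¹' V' from h3.2)
  have h1 := h0 _ (wd_spec n e)
  rw [pp_act] at h1
  intro V hV
  rw [mem_map] at hV
  have h2 : cj (wd n e).length ⁻¹' V ∈ 𝓝 (cj (wd n e).length (pp n e)) := by
    apply h1
    rw [mem_map]
    have h3 : act (wd n e) e = (act (wd n e)) e := rfl
    have h4 := (act (wd n e)).symm.continuous.continuousAt (x := act (wd n e) e)
    rw [ContinuousAt, Homeomorph.symm_apply_apply] at h4
    refine (h4 hV |> fun h => ?_)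
    filter_upwards [h] with z hz
    have : pp n ((act (wd n e)).symm z) ∈ V := hz
    rw [show z = act (wd n e) ((act (wd n e)).symm z) by simp]
    show cj _ (pp n _) ∈ V
    rw [pp_act, cj_cj]; exact this
  have h5 := (cj_cont (wd n e).length).continuousAt (x := pp n e) h2
  rw [mem_map] at h5
  filter_upwards [h5] with w hw
  have : cj (wd n e).length (cj (wd n e).length w) ∈ V := hw
  rwa [cj_cj] at this

/-- the deck group -/
noncomputable def GG (n : ℕ) : Subgroup (Hh ≃ₜ Hh) where
  carrier := {g | ∃ l : List (Fin (n + 1)), Even l.length ∧ act l = g}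
  one_mem' := ⟨[], by simp, rfl⟩
  mul_mem' := by
    rintro _ _ ⟨l, hl, rfl⟩ ⟨l', hl', rfl⟩
    exact ⟨l ++ l', by simpa using hl.add hl', act_append _ _⟩
  inv_mem' := by
    rintro _ ⟨l, hl, rfl⟩
    exact ⟨l.reverse, by simpa using hl, act_reverse _⟩

noncomputable instance homeoAct : MulAction (Hh ≃ₜ Hh) Hh where
  smul g z := g z
  one_smul _ := rfl
  mul_smul _ _ _ := rfl

lemma GG_free {g : Hh ≃ₜ Hh} (hg : g ∈ GG n) {z : Hh} (h : g z = z) : g = 1 := by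
  obtain ⟨l, hl, rfl⟩ := hg
  let w := wd n z
  have e : act (w ++ l ++ w.reverse) (act w z) = act w z := by
    rw [act_append, act_append, act_reverse, Homeomorph.mul_apply, Homeomorph.mul_apply]; simp [h]
  have := fund (l := w ++ l ++ w.reverse) (z := act w z) (wd_spec n z) (by rw [e]; exact wd_spec n z)
  rcases this with ⟨h1, -⟩ | ⟨k, -, h2, -⟩
  · rw [act_append, act_append, act_reverse] at h1
    have := congrArg (fun x => (act w)⁻¹ * x * act w) h1
    simpa [mul_assoc] using this
  · exfalso; apply h2
    simp only [List.length_append, List.length_reverse]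
    have : w.length + l.length + w.length = 2 * w.length + l.length := by ring
    rw [this]; exact (even_two_mul _).add hl

lemma pp_qcov (n : ℕ) : IsQuotientCoveringMap (fun z => (⟨pp n z, pp_mem z⟩ : YY n)) (GG n) := by
  have hc : Continuous (fun z => (⟨pp n z, pp_mem z⟩ : YY n)) := pp_cont.subtype_mk _
  have ho : IsOpenMap (fun z => (⟨pp n z, pp_mem z⟩ : YY n)) := by
    apply IsOpenMap.of_nhds_le
    intro e V hV
    rw [mem_nhds_subtype]
    refine ⟨Subtype.val '' (V ∩ range (fun z => (⟨pp n z, pp_mem z⟩ : YY n))), pp_open e ?_, ?_⟩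
    · rw [mem_map] at hV ⊢
      filter_upwards [hV] with z hz
      exact ⟨_, ⟨hz, z, rfl⟩, rfl⟩
    · rintro w ⟨w', hw', h⟩
      rw [← Subtype.ext h]; exact hw'.1
  have hs : Function.Surjective (fun z => (⟨pp n z, pp_mem z⟩ : YY n)) := by
    rintro ⟨w, hw⟩
    obtain ⟨z, hz⟩ := pp_surj hw
    exact ⟨z, Subtype.ext hz⟩
  refine { toIsQuotientMap := ho.isQuotientMap hc hs, continuous_const_smul := ?_,
           apply_eq_iff_mem_orbit := ?_, disjoint := ?_ }
  · intro g; exact g.1.continuous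
  · intro e1 e2
    rw [Subtype.mk.injEq, pp_fiber]
    constructor
    · rintro ⟨l, hl, h⟩
      exact ⟨⟨act l, l, hl, rfl⟩, h⟩
    · rintro ⟨⟨_, l, hl, rfl⟩, h⟩
      exact ⟨l, hl, h⟩
  · intro e
    obtain ⟨U, hU, hi⟩ := pp_locinj (n := n) e
    refine ⟨U, hU, ?_⟩
    rintro ⟨g, hg⟩ ⟨z, ⟨z', hz', h⟩, hz⟩
    have hz2 : g z' = z := h
    have : z = z' := hi hz hz' (by
      obtain ⟨l, hl, rfl⟩ := hg
      exact pp_fiber.2 ⟨l, hl, hz2⟩)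
    subst this
    exact Subtype.ext (GG_free hg hz2)
end MA

open scoped Classical
namespace MA
open Set Topology Metric Filter

variable {n : ℕ}

/-- horofunction at the real point ξ -/
noncomputable def bet (ξ : ℝ) (z : ℂ) : ℝ := qq ξ z / z.im

lemma bet_pos (ξ : ℝ) (z : Hh) : 0 < bet ξ z := div_pos (qq_pos ξ z.2) z.2

lemma bet_cont (ξ : ℝ) : Continuous fun z : Hh => bet ξ z :=
  ((qq_cont ξ).comp continuous_subtype_val).div (Complex.continuous_im.comp continuous_subtype_val)
    fun z => z.2.ne'

lemma bet_ge (ξ : ℝ) (z : Hh) : ‖(z : ℂ) - ξ‖ ≤ bet ξ z := by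
  rw [bet, le_div_iff₀ z.2]
  have h1 : qq ξ z = ‖(z : ℂ) - ξ‖ ^ 2 := by
    rw [← Complex.normSq_eq_norm_sq, Complex.normSq_apply, qq]; simp; ring
  have h2 : z.1.im ≤ ‖(z : ℂ) - ξ‖ := by
    have := Complex.abs_im_le_norm ((z : ℂ) - ξ)
    simp at this
    exact (le_abs_self _).trans this
  rw [h1]
  nlinarith [norm_nonneg ((z : ℂ) - ξ)]

lemma bet_ge_im (ξ : ℝ) (z : Hh) : z.1.im ≤ bet ξ z := by
  rw [bet, le_div_iff₀ z.2, qq]; nlinarith [sq_nonneg (z.1.re - ξ)]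

/-- reflection on the real line -/
noncomputable def rs (c ξ : ℝ) : ℝ := c + 1 / (4 * (ξ - c))

lemma bet_rr {c ξ : ℝ} (h : ξ ≠ c) (z : Hh) :
    bet (rs c ξ) (rr c z) = bet ξ z / (4 * (ξ - c) ^ 2) := by
  have hq := (qq_pos c z.2)
  have hz := z.2.ne'
  have h' : ξ - c ≠ 0 := sub_ne_zero.2 h
  have e : ((rr c z : Hh) : ℂ) = rf c z := rfl
  rw [e, bet, bet]
  have e1 : qq (rs c ξ) (rf c z) = qq ξ z / (16 * qq c z * (ξ - c) ^ 2) := by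
    have : qq (rs c ξ) (rf c z) =
      ((z.1.re - c) / (4 * qq c z) - 1 / (4 * (ξ - c))) ^ 2 + (z.1.im / (4 * qq c z)) ^ 2 := by
      rw [qq]; simp only [rf, rs]; ring
    rw [this]
    have hne := hq.ne'
    field_simp
    have e2 : qq c z = (z.1.re - c) ^ 2 + z.1.im ^ 2 := rfl
    have e3 : qq ξ z = (z.1.re - ξ) ^ 2 + z.1.im ^ 2 := rfl
    rw [e2, e3]; ring
  rw [e1]
  show _ / (z.1.im / (4 * qq c z)) = _
  have hne := hq.ne'
  field_simp
  norm_num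

/-- hyperbolic geodesic with real ends -/
def geo (ξ η : ℝ) (z : ℂ) : Prop := (z.re - ξ) * (z.re - η) + z.im ^ 2 = 0

lemma geo_rr {c ξ η : ℝ} (h : ξ ≠ c) (h2 : η ≠ c) (z : Hh) (hg : geo ξ η z) :
    geo (rs c ξ) (rs c η) (rr c z) := by
  have hq := (qq_pos c z.2)
  have h' : ξ - c ≠ 0 := sub_ne_zero.2 h
  have h2' : η - c ≠ 0 := sub_ne_zero.2 h2
  unfold geo at *
  have e : ((rr c z : Hh) : ℂ) = rf c z := rfl
  rw [e]
  have : ((rf c z).re - rs c ξ) * ((rf c z).re - rs c η) + (rf c z).im ^ 2 =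
    ((z.1.re - c) / (4 * qq c z) - 1 / (4 * (ξ - c))) * ((z.1.re - c) / (4 * qq c z) - 1 / (4 * (η - c)))
      + (z.1.im / (4 * qq c z)) ^ 2 := by
    simp only [rf, rs]; ring
  rw [this]
  have hne := hq.ne'
  have e2 : qq c z = (z.1.re - c) ^ 2 + z.1.im ^ 2 := rfl
  field_simp
  have e3 : qq c z = (z.1.re - c) ^ 2 - (z.1.re - ξ) * (z.1.re - η) := by rw [e2]; linarith
  have e4 : z.1.im ^ 2 = - ((z.1.re - ξ) * (z.1.re - η)) := by linarith
  rw [e3, e4]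
  ring

/-- real position of the marked points -/
noncomputable def mp (j : Fin n) : ℝ := (j : ℕ) + 1

noncomputable def tau (j : Fin n) (z : Hh) : ℝ := bet (mp j) (Fd n z)

lemma tau_act (j : Fin n) (l : List (Fin (n + 1))) (z : Hh) : tau j (act l z) = tau j z := by
  rw [tau, Fd_act]; rfl
lemma tau_rr (j : Fin n) (k : Fin (n + 1)) (z : Hh) : tau j (rr (ck k) z) = tau j z := by
  simpa using tau_act j [k] z

lemma Fd_formula (z : Hh) : (Fd n z : ℂ) = ⟨(pp n z).re, |(pp n z).im| + gg n (pp n z).re⟩ := by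
  have h := rho_im_nonneg (Fd_mem (n := n) z)
  have h1 : (pp n z).re = (Fd n z).1.re := by
    unfold pp cj; split_ifs <;> simp [rhoH]
  have h2 : |(pp n z).im| = (rhoH n (Fd n z)).im := by
    unfold pp cj; split_ifs
    · exact abs_of_nonneg h
    · rw [Complex.conj_im, abs_neg]; exact abs_of_nonneg h
  rw [h1, h2]
  apply Complex.ext <;> simp [rhoH]

lemma Fd_cont : Continuous (Fd n) := by
  rw [continuous_induced_rng]
  have : (Subtype.val ∘ Fd n) = fun z => (⟨(pp n z).re, |(pp n z).im| + gg n (pp n z).re⟩ : ℂ) := by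
    funext z; exact Fd_formula z
  rw [this]
  have h1 := pp_cont (n := n)
  have h2 := gg_cont n
  exact mk_cont (Complex.continuous_re.comp h1)
    ((Complex.continuous_im.comp h1).abs.add (h2.comp (Complex.continuous_re.comp h1)))

lemma tau_cont (j : Fin n) : Continuous (tau j) := (bet_cont _).comp Fd_cont

lemma tau_pos (j : Fin n) (z : Hh) : 0 < tau j z := bet_pos _ _

lemma near1 (j : Fin n) (z : Hh) : ‖pp n z - mp j‖ ≤ tau j z := by
  refine le_trans ?_ (bet_ge (mp j) (Fd n z))
  rw [Fd_formula, ← sq_le_sq₀ (norm_nonneg _) (norm_nonneg _), ← Complex.normSq_eq_norm_sq,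
    ← Complex.normSq_eq_norm_sq, Complex.normSq_apply, Complex.normSq_apply]
  simp only [Complex.sub_re, Complex.ofReal_re, Complex.sub_im, Complex.ofReal_im, sub_zero]
  have h1 := gg_nonneg (n := n) (pp n z).re
  have h2 := abs_nonneg (pp n z).im
  have h3 := abs_mul_abs_self (pp n z).im
  nlinarith

lemma mp_ck (j : Fin n) : ∃ k k' : Fin (n + 1), ck k = mp j - 1 / 2 ∧ ck k' = mp j + 1 / 2 := by
  refine ⟨⟨j, by omega⟩, ⟨j + 1, by omega⟩, ?_, ?_⟩ <;> simp only [ck, mp] <;> push_cast <;> ring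

lemma gg_near (j : Fin n) {x : ℝ} (h : |x - mp j| ≤ 1 / 2) : |x - mp j| ≤ gg n x := by
  obtain ⟨k, k', hk, hk'⟩ := mp_ck j
  rw [abs_le] at h
  rcases le_total x (mp j) with h1 | h1
  · rw [gg_eq (k := k) (by rw [hk]; nlinarith)]
    apply Real.le_sqrt_of_sq_le
    rw [sq_abs, hk]; nlinarith
  · rw [gg_eq (k := k') (by rw [hk']; nlinarith)]
    apply Real.le_sqrt_of_sq_le
    rw [sq_abs, hk']; nlinarith

lemma gg_mp (j : Fin n) : gg n (mp j) = 0 := by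
  obtain ⟨k, k', hk, hk'⟩ := mp_ck j
  rw [gg_eq (k := k) (by rw [hk]; norm_num), hk]; norm_num

lemma near2 (j : Fin n) {ε : ℝ} (hε : 0 < ε) :
    ∃ δ > 0, ∀ z, ‖pp n z - mp j‖ < δ → tau j z < ε := by
  have hc : Continuous fun w : ℂ => |w.re - mp j| + |w.im| + gg n w.re := by
    have := gg_cont n
    fun_prop
  have h0 := hc.continuousAt (x := ((mp j : ℝ) : ℂ))
  rw [ContinuousAt, Complex.ofReal_re, Complex.ofReal_im, gg_mp] at h0
  simp only [sub_self, abs_zero, add_zero] at h0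
  obtain ⟨δ, hδ, h1⟩ := Metric.eventually_nhds_iff.1 (h0.eventually_lt_const hε)
  refine ⟨min δ (1 / 2), by positivity, fun z hz => ?_⟩
  have h2 := h1 (y := pp n z) (by rw [dist_eq_norm]; exact hz.trans_le (min_le_left _ _))
  refine lt_of_le_of_lt ?_ h2
  have h3 : |(pp n z).re - mp j| ≤ 1 / 2 := by
    have := Complex.abs_re_le_norm (pp n z - mp j)
    simp only [Complex.sub_re, Complex.ofReal_re] at this
    exact this.trans (hz.le.trans (min_le_right _ _))
  have h4 := gg_near j h3
  have hp := (Fd n z).2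
  rw [Fd_formula] at hp
  simp only at hp
  rw [tau, Fd_formula, bet, div_le_iff₀ hp, qq]
  simp only
  have h5 := abs_nonneg (pp n z).im
  have h6 := abs_nonneg ((pp n z).re - mp j)
  rw [← sq_abs ((pp n z).re - mp j)]
  nlinarith

/-- ξ is a cusp over the j-th mark, with scale κ -/
def Cusp (j : Fin n) (ξ κ : ℝ) : Prop := 0 < κ ∧ ∀ z : Hh, κ * bet ξ z < 1 → tau j z = κ * bet ξ z

lemma cusp_base (j : Fin n) : Cusp j (mp j) 1 := by
  refine ⟨one_pos, fun z => ?_⟩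
  rw [one_mul]
  induction z using mu_ind (n := n) with
  | h0 z hz => intro _; rw [tau, Fd_Pg hz]
  | h1 z k hk ih =>
    intro hb
    have hc : ck k = mp j - 1 / 2 ∨ ck k = mp j + 1 / 2 := by
      have hb' : (z.1.re - mp j) ^ 2 + z.1.im ^ 2 < z.1.im := by
        rw [bet, div_lt_one z.2] at hb; exact hb
      have hk' : (z.1.re - ck k) ^ 2 + z.1.im ^ 2 < 1 / 4 := hk
      have h1 : (ck k : ℝ) - mp j = (((k : ℕ) : ℤ) - ((j : ℕ) : ℤ) : ℤ) - 1 / 2 := by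
        simp only [ck, mp]; push_cast; ring
      have hz := z.2
      have h2 : |ck k - mp j| < 3 / 2 := by
        rw [abs_lt]
        have a1 : z.1.re - mp j ≤ 1 / 2 := by nlinarith [sq_nonneg (z.1.im - 1 / 2)]
        have a2 : -(1 / 2) ≤ z.1.re - mp j := by nlinarith [sq_nonneg (z.1.im - 1 / 2)]
        have a3 : z.1.re - ck k < 1 / 2 := by nlinarith
        have a4 : -(1 / 2) < z.1.re - ck k := by nlinarith
        constructor <;> linarith
      rw [h1, abs_lt] at h2
      generalize ((k : ℕ) : ℤ) - ((j : ℕ) : ℤ) = m at h1 h2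
      have m1 : (-1 : ℤ) < m := by
        have : (-1 : ℝ) < m := by linarith [h2.1]
        exact_mod_cast this
      have m2 : m < 2 := by
        have : (m : ℝ) < 2 := by linarith [h2.2]
        exact_mod_cast this
      interval_cases m
      · left; push_cast at h1; linarith
      · right; push_cast at h1; linarith
    have key : bet (mp j) (rr (ck k) z) = bet (mp j) z := by
      have hne : mp j ≠ ck k := by rcases hc with h | h <;> rw [h] <;> linarith
      have e : rs (ck k) (mp j) = mp j := by
        rcases hc with h | h <;> rw [rs, h] <;> ring_nf
      have := bet_rr hne z
      rw [e] at this
      rw [this]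
      rcases hc with h | h <;> rw [h] <;> ring_nf
    rw [← tau_rr j k, ih (by rw [key]; exact hb), key]

lemma cusp_ne {j : Fin n} {ξ κ : ℝ} (h : Cusp j ξ κ) (k : Fin (n + 1)) : ξ ≠ ck k := by
  rintro rfl
  obtain ⟨hκ, h⟩ := h
  let T : ℝ := κ + 2
  have hT : 0 < T := by positivity
  let w : Hh := ⟨⟨ck k, T⟩, hT⟩
  have hw : w ∈ Pg n := fun j => by
    show 1 / 4 ≤ (ck k - ck j) ^ 2 + T ^ 2
    nlinarith [sq_nonneg (ck k - ck j)]
  have hb : bet (ck k) (rr (ck k) w) = 1 / (4 * T) := by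
    show qq (ck k) (rf (ck k) w) / (w.1.im / (4 * qq (ck k) w)) = _
    rw [qq_rf _ w.2]
    have : qq (ck k) w = T ^ 2 := by
      show (ck k - ck k) ^ 2 + T ^ 2 = _
      ring
    rw [this]
    show 1 / (16 * T ^ 2) / (T / (4 * T ^ 2)) = _
    field_simp
    norm_num
  have h1 : κ * bet (ck k) (rr (ck k) w) < 1 := by
    rw [hb, mul_one_div, div_lt_one (by positivity)]
    show κ < 4 * (κ + 2)
    linarith
  have h2 := h _ h1
  rw [tau_rr, tau, Fd_Pg hw] at h2
  have h3 := bet_ge_im (mp j) w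
  rw [h2] at h3
  have : w.1.im = κ + 2 := rfl
  linarith

lemma cusp_rr {j : Fin n} {ξ κ : ℝ} (h : Cusp j ξ κ) (k : Fin (n + 1)) :
    Cusp j (rs (ck k) ξ) (κ * (4 * (ξ - ck k) ^ 2)) := by
  have hne := cusp_ne h k
  have hne' : ξ - ck k ≠ 0 := sub_ne_zero.2 hne
  obtain ⟨hκ, h⟩ := h
  refine ⟨by positivity, fun z => ?_⟩
  have e : bet (rs (ck k) ξ) z = bet ξ (rr (ck k) z) / (4 * (ξ - ck k) ^ 2) := by
    have := bet_rr hne (rr (ck k) z)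
    rw [← this]
    congr 1
    exact (rf_rf _ z.2).symm
  have e2 : κ * (4 * (ξ - ck k) ^ 2) * bet (rs (ck k) ξ) z = κ * bet ξ (rr (ck k) z) := by
    rw [e]; field_simp
  rw [e2, ← tau_rr j k]
  exact h _

lemma cusp_exists (j : Fin n) (z : Hh) : tau j z < 1 → ∃ ξ κ, Cusp j ξ κ ∧ κ * bet ξ z < 1 := by
  induction z using mu_ind (n := n) with
  | h0 z hz =>
    intro h
    refine ⟨mp j, 1, cusp_base j, ?_⟩
    rw [tau, Fd_Pg hz] at h
    rwa [one_mul]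
  | h1 z k hk ih =>
    intro h
    obtain ⟨ξ, κ, h1, h2⟩ := ih (by rwa [tau_rr])
    refine ⟨_, _, cusp_rr h1 k, ?_⟩
    have hne := cusp_ne h1 k
    have hne' : ξ - ck k ≠ 0 := sub_ne_zero.2 hne
    have e : bet (rs (ck k) ξ) z = bet ξ (rr (ck k) z) / (4 * (ξ - ck k) ^ 2) := by
      have := bet_rr hne (rr (ck k) z)
      rw [← this]
      congr 1
      exact (rf_rf _ z.2).symm
    have e2 : κ * (4 * (ξ - ck k) ^ 2) * bet (rs (ck k) ξ) z = κ * bet ξ (rr (ck k) z) := by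
      rw [e]; field_simp
    rw [e2]; exact h2

lemma cusp_conn (j : Fin n) {S : Set Hh} (hS : IsPreconnected S) (hne : S.Nonempty)
    (ht : ∀ z ∈ S, tau j z < 1) : ∃ ξ κ, Cusp j ξ κ ∧ ∀ z ∈ S, κ * bet ξ z < 1 := by
  obtain ⟨z0, hz0⟩ := hne
  obtain ⟨ξ, κ, h1, h2⟩ := cusp_exists j z0 (ht z0 hz0)
  refine ⟨ξ, κ, h1, fun z hz => ?_⟩
  have hc : Continuous fun z : Hh => κ * bet ξ z := continuous_const.mul (bet_cont ξ)
  by_contra hn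
  have hV : z ∈ {z : Hh | κ * bet ξ z ≠ tau j z} := by
    intro h
    have h3 := ht z hz
    have h4 : κ * bet ξ z = tau j z := h
    rw [← h4] at h3; exact hn h3
  obtain ⟨w, -, hw1, hw2⟩ := hS {z : Hh | κ * bet ξ z < 1} {z : Hh | κ * bet ξ z ≠ tau j z}
    (isOpen_lt hc continuous_const) (isOpen_ne_fun hc (tau_cont j)) (by
      intro y hy
      by_cases h : κ * bet ξ y = tau j y
      · left; show κ * bet ξ y < 1
        rw [h]; exact ht y hy
      · exact Or.inr h) ⟨z0, hz0, h2⟩ ⟨z, hz, hV⟩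
  exact hw2 (h1.2 w hw1).symm

/-- transport of a pair of cusps by words -/
lemma cusp_act (l : List (Fin (n + 1))) {i j : Fin n} {ξ κ η lam : ℝ} (h : Cusp i ξ κ) (h' : Cusp j η lam) :
    ∃ ξ' κ' η' lam', Cusp i ξ' κ' ∧ Cusp j η' lam' ∧
      (∀ z : Hh, κ' * bet ξ' (act l z) = κ * bet ξ z) ∧ (∀ z : Hh, lam' * bet η' (act l z) = lam * bet η z) ∧
      (∀ z : Hh, geo ξ η z → geo ξ' η' (act l z)) := by
  induction l with
  | nil => exact ⟨ξ, κ, η, lam, h, h', fun z => rfl, fun z => rfl, fun z hz => hz⟩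
  | cons k l ih =>
    obtain ⟨ξ', κ', η', lam', h1, h2, h3, h4, h5⟩ := ih
    have n1 := cusp_ne h1 k
    have n2 := cusp_ne h2 k
    have n1' : ξ' - ck k ≠ 0 := sub_ne_zero.2 n1
    have n2' : η' - ck k ≠ 0 := sub_ne_zero.2 n2
    refine ⟨_, _, _, _, cusp_rr h1 k, cusp_rr h2 k, fun z => ?_, fun z => ?_, fun z hz => ?_⟩
    · rw [act_cons, Homeomorph.mul_apply, bet_rr n1, ← h3 z]; field_simp
    · rw [act_cons, Homeomorph.mul_apply, bet_rr n2, ← h4 z]; field_simp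
    · rw [act_cons, Homeomorph.mul_apply]
      exact geo_rr n1 n2 _ (h5 z hz)
end MA

open scoped Classical
namespace MA
open Set Topology Metric Filter

def SL : Set ℂ := {z : ℂ | z.im ≠ 0 ∨ (-1 < z.re ∧ z.re < 1)}

noncomputable def csq (u : ℂ) : ℂ := Complex.exp (Complex.log u / 2)

lemma csq_sq {u : ℂ} (h : u ≠ 0) : csq u ^ 2 = u := by
  rw [csq, ← Complex.exp_nat_mul]
  push_cast
  rw [mul_div_cancel₀ _ two_ne_zero, Complex.exp_log h]

lemma csq_re {u : ℂ} (h : u ∈ Complex.slitPlane) : 0 < (csq u).re := by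
  rw [csq, Complex.exp_re]
  apply mul_pos (Real.exp_pos _)
  have e : (Complex.log u / 2).im = u.arg / 2 := by
    rw [show (2 : ℂ) = ((2 : ℝ) : ℂ) by norm_num, Complex.div_ofReal_im, Complex.log_im]
  rw [e]
  have h1 := Complex.neg_pi_lt_arg u
  have h2 : u.arg < Real.pi := lt_of_le_of_ne (Complex.arg_le_pi u) (Complex.slitPlane_arg_ne_pi h)
  exact Real.cos_pos_of_mem_Ioo ⟨by linarith, by linarith⟩

lemma sq_unique {a b : ℂ} (ha : 0 < a.re) (hb : 0 < b.re) (h : a ^ 2 = b ^ 2) : a = b := by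
  rcases sq_eq_sq_iff_eq_or_eq_neg.1 h with h | h
  · exact h
  · rw [h] at ha; simp at ha; linarith

lemma slit_of_SL {z : ℂ} (h : z ∈ SL) : 1 - z ^ 2 ∈ Complex.slitPlane := by
  rw [Complex.mem_slitPlane_iff]
  simp only [sq, Complex.sub_re, Complex.one_re, Complex.mul_re, Complex.sub_im, Complex.one_im,
    Complex.mul_im]
  by_cases h0 : z.im = 0
  · left
    rcases h with h | h
    · exact absurd h0 h
    · rw [h0]; nlinarith
  · by_cases h1 : z.re = 0
    · left; rw [h1]
      have := mul_self_pos.2 h0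
      linarith
    · right
      intro h2
      have : z.re * z.im = 0 := by linarith
      rcases mul_eq_zero.1 this with h | h
      · exact h1 h
      · exact h0 h

lemma one_add_ne {s : ℂ} (h : 0 < s.re) : 1 + s ≠ 0 := by
  intro h0
  have := congrArg Complex.re h0
  simp at this; linarith

lemma one_add_sq_ne {w : ℂ} (h : ‖w‖ < 1) : 1 + w ^ 2 ≠ 0 := by
  intro h0
  have h1 : w ^ 2 = -1 := by linear_combination h0
  have h2 := congrArg norm h1
  rw [norm_pow, norm_neg, norm_one] at h2
  nlinarith [norm_nonneg w]

lemma cayley_re {w : ℂ} (h : ‖w‖ < 1) : 0 < ((1 - w ^ 2) / (1 + w ^ 2)).re := by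
  have h1 := one_add_sq_ne h
  have h2 : ‖w ^ 2‖ < 1 := by rw [norm_pow]; nlinarith [norm_nonneg w]
  generalize w ^ 2 = v at *
  rw [Complex.div_re, ← add_div]
  apply div_pos _ (Complex.normSq_pos.2 h1)
  have h3 : v.re ^ 2 + v.im ^ 2 < 1 := by
    have : ‖v‖ ^ 2 < 1 := by nlinarith [norm_nonneg v]
    rw [← Complex.normSq_eq_norm_sq, Complex.normSq_apply] at this
    linarith
  simp
  nlinarith

lemma inv_lt_one {s z : ℂ} (hs : 0 < s.re) (h : s ^ 2 = 1 - z ^ 2) : ‖z / (1 + s)‖ < 1 := by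
  have h1 := one_add_ne hs
  have h2 : (z / (1 + s)) ^ 2 = (1 - s) / (1 + s) := by
    rw [div_pow, div_eq_div_iff (pow_ne_zero _ h1) h1]
    linear_combination (1 + s) * h
  have h3 : ‖(1 - s) / (1 + s)‖ < 1 := by
    rw [norm_div, div_lt_one (norm_pos_iff.2 h1), ← sq_lt_sq₀ (norm_nonneg _) (norm_nonneg _),
      ← Complex.normSq_eq_norm_sq, ← Complex.normSq_eq_norm_sq, Complex.normSq_apply, Complex.normSq_apply]
    simp
    nlinarith
  rw [← h2, norm_pow] at h3
  by_contra hc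
  push Not at hc
  nlinarith

lemma fwd_SL {w : ℂ} (h : ‖w‖ < 1) : 2 * w / (1 + w ^ 2) ∈ SL := by
  have h1 := one_add_sq_ne h
  set z := 2 * w / (1 + w ^ 2) with hz
  have h2 : 1 - z ^ 2 = ((1 - w ^ 2) / (1 + w ^ 2)) ^ 2 := by
    rw [hz]; field_simp; ring
  have h3 := cayley_re h
  generalize (1 - w ^ 2) / (1 + w ^ 2) = s at h2 h3
  by_contra hc
  simp only [SL, Set.mem_ofPred_eq, not_or, not_not, not_and_or, not_lt] at hc
  have h4 := congrArg Complex.re h2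
  have h5 := congrArg Complex.im h2
  simp only [sq, Complex.sub_re, Complex.one_re, Complex.mul_re, Complex.sub_im, Complex.one_im,
    Complex.mul_im, hc.1] at h4 h5
  have h6 : s.im = 0 := by
    have : s.re * s.im = 0 := by linarith
    rcases mul_eq_zero.1 this with h | h
    · exact absurd h h3.ne'
    · exact h
  rw [h6] at h4
  rcases hc.2 with h | h <;> nlinarith

noncomputable def slitHomeo : (ball (0 : ℂ) 1) ≃ₜ SL where
  toFun w := ⟨2 * w / (1 + w.1 ^ 2), fwd_SL (mem_ball_zero_iff.1 w.2)⟩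
  invFun z := ⟨z / (1 + csq (1 - z.1 ^ 2)), by
    have h := slit_of_SL z.2
    simpa using inv_lt_one (csq_re h) (csq_sq (Complex.slitPlane_ne_zero h))⟩
  left_inv w := by
    apply Subtype.ext
    have hw : ‖w.1‖ < 1 := mem_ball_zero_iff.1 w.2
    have h1 := one_add_sq_ne hw
    have hS := slit_of_SL (fwd_SL hw)
    have e : csq (1 - (2 * w.1 / (1 + w.1 ^ 2)) ^ 2) = (1 - w.1 ^ 2) / (1 + w.1 ^ 2) := by
      apply sq_unique (csq_re hS) (cayley_re hw)
      rw [csq_sq (Complex.slitPlane_ne_zero hS)]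
      field_simp; ring
    show 2 * w.1 / (1 + w.1 ^ 2) / (1 + csq (1 - (2 * w.1 / (1 + w.1 ^ 2)) ^ 2)) = w
    rw [e]
    have h2 : 1 + (1 - w.1 ^ 2) / (1 + w.1 ^ 2) = 2 / (1 + w.1 ^ 2) := by field_simp; ring
    rw [h2]; field_simp
  right_inv z := by
    apply Subtype.ext
    have h := slit_of_SL z.2
    have hs := csq_re h
    have hq := csq_sq (Complex.slitPlane_ne_zero h)
    show 2 * (z.1 / (1 + csq (1 - z.1 ^ 2))) / (1 + (z.1 / (1 + csq (1 - z.1 ^ 2))) ^ 2) = z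
    generalize csq (1 - z.1 ^ 2) = s at hs hq
    have h1 := one_add_ne hs
    have h2 : 1 + (z.1 / (1 + s)) ^ 2 = 2 / (1 + s) := by
      field_simp; linear_combination hq
    rw [h2]; field_simp
  continuous_toFun := by
    refine Continuous.subtype_mk ?_ _
    refine Continuous.div (by fun_prop) (by fun_prop) fun w => one_add_sq_ne (mem_ball_zero_iff.1 w.2)
  continuous_invFun := by
    refine Continuous.subtype_mk ?_ _
    have hc : Continuous fun z : SL => csq (1 - z.1 ^ 2) := by
      unfold csq
      refine Complex.continuous_exp.comp (Continuous.div_const ?_ _)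
      exact Continuous.clog (by fun_prop) fun z => slit_of_SL z.2
    exact continuous_subtype_val.div (continuous_const.add hc) fun z => one_add_ne (csq_re (slit_of_SL z.2))

/-- moving a point inside a connected open set -/
lemma move_one {O : Set ℂ} (hO : IsOpen O) (hc : IsPreconnected O) {x y : ℂ} (hx : x ∈ O) (hy : y ∈ O) :
    ∃ φ : ℂ ≃ₜ ℂ, φ x = y ∧ ∀ z ∉ O, φ z = z := by
  refine hc.induction₂ (fun x y => ∃ φ : ℂ ≃ₜ ℂ, φ x = y ∧ ∀ z ∉ O, φ z = z) ?_ ?_ ?_ hx hy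
  · intro x hx
    obtain ⟨r, hr, hb⟩ := Metric.isOpen_iff.1 hO x hx
    refine mem_nhdsWithin_of_mem_nhds (Filter.mem_of_superset (ball_mem_nhds x hr) fun y hy => ?_)
    obtain ⟨φ, h1, h2⟩ := ball_homeo (x := x) (y := y) (y' := x) hy (mem_ball_self hr)
    exact ⟨φ, h1, fun z hz => h2 z fun h => hz (hb h)⟩
  · rintro x y z - - - ⟨φ, h1, h2⟩ ⟨ψ, h3, h4⟩
    refine ⟨φ.trans ψ, by simp [h1, h3], fun w hw => by simp [h2 w hw, h4 w hw]⟩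
  · rintro x y - - ⟨φ, h1, h2⟩
    refine ⟨φ.symm, by simp [← h1], fun w hw => ?_⟩
    rw [Homeomorph.symm_apply_eq, h2 w hw]

lemma maps_of_fix {O : Set ℂ} {φ : ℂ ≃ₜ ℂ} (h : ∀ z ∉ O, φ z = z) {z : ℂ} : φ z ∈ O ↔ z ∈ O := by
  constructor
  · intro hz; by_contra hn; rw [h z hn] at hz; exact hn hz
  · intro hz; by_contra hn
    have := h _ hn
    rw [φ.injective.eq_iff] at this
    rw [this] at hn; exact hn hz

lemma move_many {O : Set ℂ} (hO : IsOpen O) (hc : IsPreconnected O) (m : ℕ) (a b : Fin m → ℂ)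
    (ha : Function.Injective a) (hb : Function.Injective b) (haO : ∀ i, a i ∈ O) (hbO : ∀ i, b i ∈ O) :
    ∃ φ : ℂ ≃ₜ ℂ, (∀ i, φ (a i) = b i) ∧ ∀ z ∉ O, φ z = z := by
  induction m with
  | zero => exact ⟨Homeomorph.refl _, fun i => i.elim0, fun z _ => rfl⟩
  | succ m ih =>
    obtain ⟨φ, h1, h2⟩ := ih (fun i => a i.castSucc) (fun i => b i.castSucc)
      (ha.comp (Fin.castSucc_injective m)) (hb.comp (Fin.castSucc_injective m))
      (fun i => haO _) (fun i => hbO _)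
    let K : Set ℂ := range fun i : Fin m => b i.castSucc
    have hK : K.Finite := Set.finite_range _
    have hx : φ (a (Fin.last m)) ∈ O \ K := by
      refine ⟨(maps_of_fix h2).2 (haO _), ?_⟩
      rintro ⟨i, hi⟩
      have hi' : b i.castSucc = φ (a (Fin.last m)) := hi
      rw [← h1 i] at hi'
      exact (Fin.castSucc_lt_last i).ne (ha (φ.injective hi'))
    have hy : b (Fin.last m) ∈ O \ K := by
      refine ⟨hbO _, ?_⟩
      rintro ⟨i, hi⟩
      exact (Fin.castSucc_lt_last i).ne (hb hi)
    obtain ⟨ψ, h3, h4⟩ := move_one (hO.sdiff hK.isClosed) (preconn_diff_finite hO hc hK (by rintro _ ⟨i, rfl⟩; exact hbO _)) hx hy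
    refine ⟨φ.trans ψ, fun i => ?_, fun z hz => ?_⟩
    · refine Fin.lastCases ?_ (fun i => ?_) i
      · exact h3
      · show ψ (φ _) = _
        rw [h1 i]
        exact h4 _ fun h => h.2 ⟨i, rfl⟩
    · show ψ (φ z) = z
      rw [h2 z hz]; exact h4 z fun h => hz h.1

def Om (n : ℕ) : Set ℂ := {w | w.im ≠ 0 ∨ (0 < w.re ∧ w.re < n + 1)}

noncomputable def affA (n : ℕ) : ℂ ≃ₜ ℂ where
  toFun z := ((n + 1 : ℝ) / 2 : ℝ) * (z + 1)
  invFun w := ((2 / (n + 1 : ℝ) : ℝ)) * w - 1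
  left_inv z := by
    have : (n + 1 : ℂ) ≠ 0 := by exact_mod_cast Nat.succ_ne_zero n
    push_cast; field_simp; ring
  right_inv z := by
    have : (n + 1 : ℂ) ≠ 0 := by exact_mod_cast Nat.succ_ne_zero n
    push_cast; field_simp; ring
  continuous_toFun := by fun_prop
  continuous_invFun := by fun_prop

lemma affA_mem (n : ℕ) (z : ℂ) : z ∈ SL ↔ affA n z ∈ Om n := by
  have h : (0 : ℝ) < (n + 1 : ℝ) / 2 := by positivity
  have e1 : (affA n z).re = (n + 1 : ℝ) / 2 * (z.re + 1) := by
    show (((n + 1 : ℝ) / 2 : ℝ) * (z + 1)).re = _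
    rw [Complex.re_ofReal_mul]; simp
  have e2 : (affA n z).im = (n + 1 : ℝ) / 2 * z.im := by
    show (((n + 1 : ℝ) / 2 : ℝ) * (z + 1)).im = _
    rw [Complex.im_ofReal_mul]; simp
  simp only [SL, Om, Set.mem_ofPred_eq, e1, e2]
  refine or_congr ?_ (and_congr ?_ ?_)
  · rw [Ne, Ne, mul_eq_zero, or_iff_right h.ne']
  · rw [mul_pos_iff_of_pos_left h]; constructor <;> intro <;> linarith
  · constructor <;> intro <;> nlinarith

lemma Om_open (n : ℕ) : IsOpen (Om n) := by
  have : Om n = {w : ℂ | w.im ≠ 0} ∪ ({w : ℂ | 0 < w.re} ∩ {w : ℂ | w.re < n + 1}) := by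
    ext w; simp [Om]
  rw [this]
  refine IsOpen.union ?_ (IsOpen.inter ?_ ?_)
  · exact isOpen_ne_fun Complex.continuous_im continuous_const
  · exact isOpen_lt continuous_const Complex.continuous_re
  · exact isOpen_lt Complex.continuous_re continuous_const

noncomputable def bOm (n : ℕ) : (ball (0 : ℂ) 1) ≃ₜ Om n :=
  slitHomeo.trans ((affA n).subtype (affA_mem n))

lemma Om_conn (n : ℕ) : IsPreconnected (Om n) := by
  have h : IsPreconnected (ball (0 : ℂ) 1) := (convex_ball 0 1).isPreconnected
  have h2 := isPreconnected_iff_preconnectedSpace.1 h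
  have h3 := isPreconnected_range (continuous_subtype_val.comp (bOm n).continuous)
  have e : range (Subtype.val ∘ (bOm n)) = Om n := by
    rw [Set.range_comp, (bOm n).surjective.range_eq, Set.image_univ, Subtype.range_coe]
  rwa [e] at h3

lemma mp_inj {n : ℕ} : Function.Injective fun j : Fin n => ((mp j : ℝ) : ℂ) := by
  intro i j h
  have h' : mp i = mp j := Complex.ofReal_injective h
  simp only [mp, add_left_inj, Nat.cast_inj] at h'
  exact Fin.ext h'

lemma mp_Om {n : ℕ} (j : Fin n) : ((mp j : ℝ) : ℂ) ∈ Om n := by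
  right
  have : ((j : ℕ) : ℝ) < n := by exact_mod_cast j.2
  simp only [Complex.ofReal_re, mp]
  constructor
  · positivity
  · linarith

lemma exists_Phi {n : ℕ} (P : Fin n → ℂ) (hinj : Function.Injective P)
    (hint : ∀ i, P i ∈ ball (0 : ℂ) 1) :
    ∃ Φ : (ball (0 : ℂ) 1) ≃ₜ Om n, ∀ j, (Φ ⟨P j, hint j⟩ : ℂ) = mp j := by
  obtain ⟨φ, h1, h2⟩ := move_many (Om_open n) (Om_conn n) n (fun j => (bOm n ⟨P j, hint j⟩ : ℂ))
    (fun j => (mp j : ℂ))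
    (fun i j h => hinj (by simpa using (bOm n).injective (Subtype.ext h)))
    mp_inj (fun i => (bOm n ⟨P i, hint i⟩).2) mp_Om
  exact ⟨(bOm n).trans (φ.subtype fun z => (maps_of_fix h2).symm), h1⟩

lemma YY_iff {n : ℕ} (w : ℂ) : w ∈ YY n ↔ w ∈ Om n ∧ w ∉ range fun j : Fin n => ((mp j : ℝ) : ℂ) := by
  by_cases him : w.im = 0
  · constructor
    · rintro (h | ⟨k, hk⟩)
      · exact absurd him h
      have h1 : w.re - ck k < 1 / 2 := by nlinarith
      have h2 : -(1 / 2) < w.re - ck k := by nlinarith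
      have hk' : ((k : ℕ) : ℝ) < n + 1 := by exact_mod_cast k.2
      have hk'' : ((k : ℕ) : ℝ) ≤ n := by exact_mod_cast Nat.lt_succ_iff.1 k.2
      have hk0 : (0 : ℝ) ≤ ((k : ℕ) : ℝ) := by positivity
      unfold ck at h1 h2
      refine ⟨Or.inr ⟨by linarith, by linarith⟩, ?_⟩
      rintro ⟨j, rfl⟩
      simp only [Complex.ofReal_re, mp] at h1 h2
      have h3 : ((j : ℕ) : ℝ) < (k : ℕ) := by linarith
      have h4 : ((k : ℕ) : ℝ) < (j : ℕ) + 1 := by linarith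
      have h3' : (j : ℕ) < (k : ℕ) := by exact_mod_cast h3
      have h4' : (k : ℕ) < (j : ℕ) + 1 := by exact_mod_cast h4
      omega
    · rintro ⟨h | ⟨h1, h2⟩, hn⟩
      · exact absurd him h
      right
      have f1 := Nat.floor_le h1.le
      have f2 := Nat.lt_floor_add_one w.re
      have f3 : ⌊w.re⌋₊ < n + 1 := by
        rw [Nat.floor_lt h1.le]; push_cast; exact h2
      refine ⟨⟨⌊w.re⌋₊, f3⟩, ?_⟩
      have f4 : w.re ≠ ⌊w.re⌋₊ := by
        intro he
        have hpos : ⌊w.re⌋₊ ≠ 0 := by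
          intro h0; rw [h0] at he; simp at he; linarith
        refine hn ⟨⟨⌊w.re⌋₊ - 1, by omega⟩, ?_⟩
        apply Complex.ext
        · simp only [mp, Complex.ofReal_re]
          rw [Nat.cast_sub (Nat.one_le_iff_ne_zero.2 hpos)]
          push_cast; linarith
        · simp [him]
      have f5 := lt_of_le_of_ne f1 f4.symm
      simp only [ck]
      nlinarith
  · constructor
    · intro _
      refine ⟨Or.inl him, ?_⟩
      rintro ⟨j, rfl⟩
      exact him (by simp)
    · intro _; exact Or.inl him

structure Cov (n : ℕ) (P : Fin n → ℂ) where
  p : Hh → ℂ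
  hm : ∀ z, p z ∈ ball (0 : ℂ) 1 \ range P
  cov : IsCoveringMap (fun z => (⟨p z, hm z⟩ : (ball (0 : ℂ) 1 \ range P : Set ℂ)))
  surj : ∀ w ∈ ball (0 : ℂ) 1 \ range P, ∃ z, p z = w
  fiber : ∀ z z', p z = p z' ↔ ∃ l : List (Fin (n + 1)), Even l.length ∧ act l z' = z
  near1 : ∀ j, ∀ ε > 0, ∃ δ > 0, ∀ z, tau j z < δ → dist (p z) (P j) < ε
  near2 : ∀ j, ∀ ε > 0, ∃ δ > 0, ∀ z, dist (p z) (P j) < δ → tau j z < ε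

lemma exists_Cov {n : ℕ} (P : Fin n → ℂ) (hinj : Function.Injective P)
    (hint : ∀ i, P i ∈ ball (0 : ℂ) 1) : Nonempty (Cov n P) := by
  obtain ⟨Φ, hΦ⟩ := exists_Phi P hinj hint
  have hYO : ∀ w, w ∈ YY n → w ∈ Om n := fun w h => ((YY_iff w).1 h).1
  have hS : ∀ j, Φ.symm ⟨mp j, mp_Om j⟩ = ⟨P j, hint j⟩ := fun j => by
    rw [Homeomorph.symm_apply_eq]; exact Subtype.ext (hΦ j).symm
  have a1 : ∀ w : YY n, (Φ.symm ⟨w, hYO _ w.2⟩ : ℂ) ∈ ball (0 : ℂ) 1 \ range P := by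
    intro w
    refine ⟨(Φ.symm _).2, ?_⟩
    rintro ⟨j, hj⟩
    have e : (⟨P j, hint j⟩ : ball (0:ℂ) 1) = Φ.symm ⟨w, hYO _ w.2⟩ := Subtype.ext hj
    rw [← hS, Φ.symm.injective.eq_iff] at e
    exact ((YY_iff _).1 w.2).2 ⟨j, congrArg Subtype.val e⟩
  have a2 : ∀ w : (ball (0 : ℂ) 1 \ range P : Set ℂ), (Φ ⟨w, w.2.1⟩ : ℂ) ∈ YY n := by
    intro w
    rw [YY_iff]
    refine ⟨(Φ _).2, ?_⟩
    rintro ⟨j, hj⟩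
    have hj' : (mp j : ℂ) = Φ ⟨w, w.2.1⟩ := hj
    rw [← hΦ, Subtype.val_injective.eq_iff, Φ.injective.eq_iff] at hj'
    exact w.2.2 ⟨j, congrArg Subtype.val hj'⟩
  let Ψ : YY n ≃ₜ (ball (0 : ℂ) 1 \ range P : Set ℂ) :=
    { toFun := fun w => ⟨Φ.symm ⟨w, hYO _ w.2⟩, a1 w⟩
      invFun := fun w => ⟨Φ ⟨w, w.2.1⟩, a2 w⟩
      left_inv := fun w => by apply Subtype.ext; simp
      right_inv := fun w => by apply Subtype.ext; simp
      continuous_toFun := by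
        refine Continuous.subtype_mk (continuous_subtype_val.comp (Φ.symm.continuous.comp ?_)) _
        exact Continuous.subtype_mk continuous_subtype_val _
      continuous_invFun := by
        refine Continuous.subtype_mk (continuous_subtype_val.comp (Φ.continuous.comp ?_)) _
        exact Continuous.subtype_mk continuous_subtype_val _ }
  have hq := ((pp_qcov n).isCoveringMap).homeomorph_comp Ψ
  refine ⟨⟨fun z => Ψ ⟨pp n z, pp_mem z⟩, fun z => (Ψ _).2, ?_, ?_, ?_, ?_, ?_⟩⟩
  · exact hq
  · intro w hw
    obtain ⟨z, hz⟩ := pp_surj (Ψ.symm ⟨w, hw⟩).2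
    refine ⟨z, ?_⟩
    have : (⟨pp n z, pp_mem z⟩ : YY n) = Ψ.symm ⟨w, hw⟩ := Subtype.ext hz
    rw [this]; simp
  · intro z z'
    rw [← pp_fiber, Subtype.val_injective.eq_iff, Ψ.injective.eq_iff, Subtype.mk.injEq]
  · intro j ε hε
    obtain ⟨δ, hδ, h⟩ := Metric.continuous_iff.1 Φ.symm.continuous ⟨mp j, mp_Om j⟩ ε hε
    refine ⟨δ, hδ, fun z hz => ?_⟩
    have := h ⟨pp n z, hYO _ (pp_mem z)⟩ (by
      rw [Subtype.dist_eq, dist_eq_norm]; exact (MA.near1 j z).trans_lt hz)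
    rw [hS] at this
    exact this
  · intro j ε hε
    obtain ⟨δ, hδ, h⟩ := MA.near2 j hε
    obtain ⟨δ', hδ', h'⟩ := Metric.continuous_iff.1 Φ.continuous ⟨P j, hint j⟩ δ hδ
    refine ⟨δ', hδ', fun z hz => h z ?_⟩
    have := h' (Φ.symm ⟨pp n z, hYO _ (pp_mem z)⟩) hz
    rw [Subtype.dist_eq, dist_eq_norm, hΦ, Homeomorph.apply_symm_apply] at this
    exact this
end MA

open scoped Classical
namespace MA
open Set Topology Metric Filter

/-! crossing lemma -/

lemma up_slit {z : ℂ} (h0 : z ≠ 0) (h : 0 ≤ z.im) : -Complex.I * z ∈ Complex.slitPlane := by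
  rw [Complex.mem_slitPlane_iff]
  simp only [neg_mul, Complex.neg_re, Complex.I_mul_re, neg_neg, Complex.neg_im, Complex.I_mul_im]
  by_cases h1 : z.im = 0
  · right; intro h2; exact h0 (Complex.ext (by simpa using h2) (by simpa using h1))
  · left; exact lt_of_le_of_ne h (Ne.symm h1)

lemma up_change {h w : ℝ → ℂ} (hh : Continuous h) (hw : Continuous w) (he : ∀ t, Complex.exp (w t) = h t)
    (him : ∀ t, 0 ≤ (h t).im) :
    (w 1).im - (w 0).im = (-Complex.I * h 1).arg - (-Complex.I * h 0).arg := by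
  have h0 : ∀ t, h t ≠ 0 := fun t => by rw [← he]; exact Complex.exp_ne_zero _
  have hs : ∀ t, -Complex.I * h t ∈ Complex.slitPlane := fun t => up_slit (h0 t) (him t)
  have hc := const_of_exp_one (isPreconnected_univ (α := ℝ))
    (f := fun t : ℝ => w t - Complex.log (-Complex.I * h t) - Complex.log Complex.I)
    (by
      apply Continuous.continuousOn
      refine (hw.sub (Continuous.clog (by fun_prop) hs)).sub continuous_const)
    (fun t _ => by
      rw [Complex.exp_sub, Complex.exp_sub, he, Complex.exp_log (Complex.slitPlane_ne_zero (hs t)),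
        Complex.exp_log Complex.I_ne_zero]
      have := h0 t
      have := Complex.I_ne_zero
      field_simp
      simp)
    1 (mem_univ _) 0 (mem_univ _)
  have := congrArg Complex.im hc
  simp only [Complex.sub_im, Complex.log_im] at this
  linarith

lemma dn_change {h w : ℝ → ℂ} (hh : Continuous h) (hw : Continuous w) (he : ∀ t, Complex.exp (w t) = h t)
    (him : ∀ t, (h t).im ≤ 0) :
    (w 1).im - (w 0).im = (Complex.I * h 1).arg - (Complex.I * h 0).arg := by
  have := up_change (h := fun t => - h t) (w := fun t => w t + Real.pi * Complex.I) hh.neg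
    (by fun_prop) (fun t => by rw [Complex.exp_add, he, Complex.exp_pi_mul_I]; ring)
    (fun t => by simpa using him t)
  simpa using this

lemma arg_up_neg {r : ℝ} (h : r < 0) : (-Complex.I * (r : ℂ)).arg = Real.pi / 2 := by
  rw [show -Complex.I * (r : ℂ) = ((-r : ℝ) : ℂ) * Complex.I by push_cast; ring,
    Complex.arg_real_mul _ (by linarith), Complex.arg_I]
lemma arg_up_pos {r : ℝ} (h : 0 < r) : (-Complex.I * (r : ℂ)).arg = -(Real.pi / 2) := by
  rw [show -Complex.I * (r : ℂ) = (r : ℂ) * (-Complex.I) by ring,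
    Complex.arg_real_mul _ h, Complex.arg_neg_I]
lemma arg_dn_neg {r : ℝ} (h : r < 0) : (Complex.I * (r : ℂ)).arg = -(Real.pi / 2) := by
  rw [show Complex.I * (r : ℂ) = ((-r : ℝ) : ℂ) * (-Complex.I) by push_cast; ring,
    Complex.arg_real_mul _ (by linarith), Complex.arg_neg_I]
lemma arg_dn_pos {r : ℝ} (h : 0 < r) : (Complex.I * (r : ℂ)).arg = Real.pi / 2 := by
  rw [show Complex.I * (r : ℂ) = (r : ℂ) * Complex.I by ring,
    Complex.arg_real_mul _ h, Complex.arg_I]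

lemma cross0 (F G : C(unitInterval, ℂ)) (hF : ∀ t, 0 ≤ (F t).im) (hG : ∀ t, 0 ≤ (G t).im)
    {a b c d : ℝ} (h1 : a < c) (h2 : c < b) (h3 : b < d) (F0 : F 0 = a) (F1 : F 1 = b)
    (G0 : G 0 = c) (G1 : G 1 = d) : ∃ t u, F t = G u := by
  by_contra hc
  push Not at hc
  let pr : ℝ → unitInterval := Set.projIcc 0 1 zero_le_one
  have hpr : Continuous pr := continuous_projIcc
  have pr0 : pr 0 = 0 := Set.projIcc_left _
  have pr1 : pr 1 = 1 := Set.projIcc_right _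
  obtain ⟨w, hw, he⟩ := log_lift (E := ℝ × ℝ) (fun x => F (pr x.1) - G (pr x.2)) (by fun_prop)
    (fun x => sub_ne_zero.2 (hc _ _))
  have e1 := dn_change (h := fun u => a - G (pr u)) (w := fun u => w (0, u)) (by fun_prop) (by fun_prop)
    (fun u => by rw [he]; simp [pr0, F0]) (fun u => by simpa using hG _)
  have e2 := up_change (h := fun t => F (pr t) - d) (w := fun t => w (t, 1)) (by fun_prop) (by fun_prop)
    (fun u => by rw [he]; simp [pr1, G1]) (fun u => by simpa using hF _)
  have e3 := dn_change (h := fun u => b - G (pr u)) (w := fun u => w (1, u)) (by fun_prop) (by fun_prop)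
    (fun u => by rw [he]; simp [pr1, F1]) (fun u => by simpa using hG _)
  have e4 := up_change (h := fun t => F (pr t) - c) (w := fun t => w (t, 0)) (by fun_prop) (by fun_prop)
    (fun u => by rw [he]; simp [pr0, G0]) (fun u => by simpa using hF _)
  simp only [pr0, pr1, F0, F1, G0, G1, ← Complex.ofReal_sub] at e1 e2 e3 e4
  rw [arg_dn_neg (by linarith), arg_dn_neg (by linarith)] at e1
  rw [arg_up_neg (by linarith), arg_up_neg (by linarith)] at e2
  rw [arg_dn_neg (by linarith), arg_dn_pos (by linarith)] at e3
  rw [arg_up_pos (by linarith), arg_up_neg (by linarith)] at e4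
  have := Real.pi_pos
  linarith

def Jn (F : C(unitInterval, ℂ)) (a b : ℝ) : Prop := (F 0 = a ∧ F 1 = b) ∨ (F 0 = b ∧ F 1 = a)

lemma cross1 (F G : C(unitInterval, ℂ)) (hF : ∀ t, 0 ≤ (F t).im) (hG : ∀ t, 0 ≤ (G t).im)
    {a b c d : ℝ} (h1 : a < c) (h2 : c < b) (h3 : b < d) (hJ : Jn F a b) (hK : Jn G c d) :
    ∃ t u, F t = G u := by
  let sg : C(unitInterval, unitInterval) := ⟨unitInterval.symm, unitInterval.continuous_symm⟩
  have key : ∀ (F : C(unitInterval, ℂ)) (a b : ℝ), Jn F a b → ∃ F' : C(unitInterval, ℂ),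
      F' 0 = a ∧ F' 1 = b ∧ ∀ t, ∃ t', F' t = F t' := by
    rintro F a b (⟨h, h'⟩ | ⟨h, h'⟩)
    · exact ⟨F, h, h', fun t => ⟨t, rfl⟩⟩
    · exact ⟨F.comp sg, by simpa [sg] using h', by simpa [sg] using h, fun t => ⟨sg t, rfl⟩⟩
  obtain ⟨F', f0, f1, hf⟩ := key F a b hJ
  obtain ⟨G', g0, g1, hg⟩ := key G c d hK
  obtain ⟨t, u, h⟩ := cross0 F' G' (fun t => by obtain ⟨t', h⟩ := hf t; rw [h]; exact hF _)
    (fun t => by obtain ⟨t', h⟩ := hg t; rw [h]; exact hG _) h1 h2 h3 f0 f1 g0 g1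
  obtain ⟨t', ht⟩ := hf t
  obtain ⟨u', hu⟩ := hg u
  exact ⟨t', u', by rw [← ht, ← hu, h]⟩

lemma Jn_symm {F : C(unitInterval, ℂ)} {a b : ℝ} (h : Jn F a b) : Jn F b a := h.elim (fun h => Or.inr h) (fun h => Or.inl h)

lemma geo_symm {a b : ℝ} {z : ℂ} (h : geo a b z) : geo b a z := by unfold geo at *; linarith

/-- two geodesics through a common point -/
lemma cross_geo_aux (F G : C(unitInterval, ℂ)) (hF : ∀ t, 0 ≤ (F t).im) (hG : ∀ t, 0 ≤ (G t).im)
    {a b c d : ℝ} {z : Hh} (hab : geo a b z) (hcd : geo c d z) (h1 : a < b) (h2 : c < d)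
    (hJ : Jn F a b) (hK : Jn G c d) : (∃ t u, F t = G u) ∨ (a = c ∧ b = d) := by
  have hy := z.2
  unfold geo at hab hcd
  set x := z.1.re
  set y := z.1.im
  have hy2 : 0 < y ^ 2 := by positivity
  have a1 : a < x := by by_contra h; push Not at h; nlinarith
  have a2 : x < b := by by_contra h; push Not at h; nlinarith
  have a3 : c < x := by by_contra h; push Not at h; nlinarith
  have a4 : x < d := by by_contra h; push Not at h; nlinarith
  have e : (x - a) * (b - x) = (x - c) * (d - x) := by linarith
  rcases lt_trichotomy a c with h | h | h
  · left
    exact cross1 F G hF hG h (a3.trans a2) (by by_contra hh; push Not at hh; nlinarith) hJ hK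
  · right
    refine ⟨h, ?_⟩
    subst h
    have := mul_left_cancel₀ (sub_pos.2 a1).ne' e
    linarith
  · left
    obtain ⟨t, u, h⟩ := cross1 G F hG hF h (a1.trans a4) (by by_contra hh; push Not at hh; nlinarith) hK hJ
    exact ⟨u, t, h.symm⟩

lemma cross_geo (F G : C(unitInterval, ℂ)) (hF : ∀ t, 0 ≤ (F t).im) (hG : ∀ t, 0 ≤ (G t).im)
    {a b c d : ℝ} {z : Hh} (hab : geo a b z) (hcd : geo c d z)
    (F0 : F 0 = a) (F1 : F 1 = b) (G0 : G 0 = c) (G1 : G 1 = d) :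
    (∃ t u, F t = G u) ∨ (a = c ∧ b = d) ∨ (a = d ∧ b = c) := by
  have ne : ∀ {a b : ℝ}, geo a b z → a ≠ b := by
    rintro a b h rfl
    have hy := z.2
    unfold geo at h
    nlinarith [mul_self_nonneg (z.1.re - a)]
  have J1 : Jn F a b := Or.inl ⟨F0, F1⟩
  have J2 : Jn G c d := Or.inl ⟨G0, G1⟩
  rcases lt_or_gt_of_ne (ne hab) with h1 | h1 <;> rcases lt_or_gt_of_ne (ne hcd) with h2 | h2
  · rcases cross_geo_aux F G hF hG hab hcd h1 h2 J1 J2 with h | h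
    · exact Or.inl h
    · exact Or.inr (Or.inl h)
  · rcases cross_geo_aux F G hF hG hab (geo_symm hcd) h1 h2 J1 (Jn_symm J2) with h | h
    · exact Or.inl h
    · exact Or.inr (Or.inr h)
  · rcases cross_geo_aux F G hF hG (geo_symm hab) hcd h1 h2 (Jn_symm J1) J2 with h | h
    · exact Or.inl h
    · exact Or.inr (Or.inr h.symm)
  · rcases cross_geo_aux F G hF hG (geo_symm hab) (geo_symm hcd) h1 h2 (Jn_symm J1) (Jn_symm J2) with h | h
    · exact Or.inl h
    · exact Or.inr (Or.inl h.symm)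

/-- a point of a geodesic is determined by its two horocyclic coordinates -/
lemma bet_det {a b : ℝ} {z w : Hh} (hz : geo a b z) (hw : geo a b w) (h1 : bet a z = bet a w)
    (h2 : bet b z = bet b w) : z = w := by
  have hzy := z.2
  have hwy := w.2
  have key : ∀ z : Hh, geo a b z → bet a z * z.1.im = (z.1.re - a) * (b - a) ∧
      bet b z * z.1.im = (z.1.re - b) * (a - b) ∧ a ≠ b := by
    intro z h
    have hy := z.2
    unfold geo at h
    have e : ∀ c, bet c z * z.1.im = (z.1.re - c) ^ 2 + z.1.im ^ 2 := fun c => by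
      unfold bet qq; field_simp
    refine ⟨by rw [e]; linarith, by rw [e]; linarith, ?_⟩
    rintro rfl
    nlinarith [mul_self_nonneg (z.1.re - a)]
  obtain ⟨k1, k2, hab⟩ := key z hz
  obtain ⟨k3, k4, -⟩ := key w hw
  rw [← h1] at k3
  rw [← h2] at k4
  have hA := bet_pos a z
  have hB := bet_pos b z
  set A := bet a z
  set B := bet b z
  have hd : b - a ≠ 0 := sub_ne_zero.2 hab.symm
  have s1 : (A + B) * z.1.im = (b - a) ^ 2 := by linear_combination k1 + k2
  have s2 : (A + B) * w.1.im = (b - a) ^ 2 := by linear_combination k3 + k4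
  have him : z.1.im = w.1.im := mul_left_cancel₀ (by positivity : A + B ≠ 0) (s1.trans s2.symm)
  have hre : z.1.re = w.1.re := by
    have : (z.1.re - a) * (b - a) = (w.1.re - a) * (b - a) := by rw [← k1, ← k3, him]
    have := mul_right_cancel₀ hd this
    linarith
  exact Subtype.ext (Complex.ext hre him)

lemma cusp_unique {n : ℕ} {i j : Fin n} {ξ κ lam : ℝ} (h : Cusp i ξ κ) (h' : Cusp j ξ lam) :
    i = j ∧ κ = lam := by
  obtain ⟨hk, h⟩ := h
  obtain ⟨hl, h'⟩ := h'
  have hpos : 0 < κ + lam := by linarith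
  let y : ℝ := 1 / (4 * (κ + lam))
  have hy : 0 < y := by positivity
  have hy' : (κ + lam) * y = 1 / 4 := by simp only [y]; field_simp
  let z : Hh := ⟨⟨ξ, y⟩, hy⟩
  have hb : bet ξ z = y := by simp only [bet, qq, z]; field_simp; ring
  have e1 := h z (by rw [hb]; nlinarith)
  have e2 := h' z (by rw [hb]; nlinarith)
  rw [hb] at e1 e2
  have hij : i = j := by
    have n1 := near1 i z
    have n2 := near1 j z
    have : ‖((mp i : ℝ) : ℂ) - (mp j : ℝ)‖ < 1 := by
      have := norm_sub_le (pp n z - mp j) (pp n z - mp i)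
      rw [show (pp n z - mp j) - (pp n z - mp i) = ((mp i : ℝ) : ℂ) - (mp j : ℝ) by ring] at this
      have : κ * y + lam * y = 1 / 4 := by linarith
      nlinarith
    rw [← Complex.ofReal_sub, Complex.norm_real, Real.norm_eq_abs] at this
    simp only [mp] at this
    have t2 : |((i : ℕ) : ℤ) - ((j : ℕ) : ℤ)| < 1 := by
      have : |(((i : ℕ) : ℤ) : ℝ) - (((j : ℕ) : ℤ) : ℝ)| < 1 := by
        convert this using 2; push_cast; ring
      exact_mod_cast this
    rw [Int.abs_lt_one_iff] at t2
    exact Fin.ext (by omega)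
  refine ⟨hij, ?_⟩
  subst hij
  rw [e1] at e2
  exact mul_right_cancel₀ hy.ne' e2
end MA

open scoped Classical
namespace MA
open Set Topology Metric Filter

abbrev MI : Set unitInterval := Ioo 0 1

lemma MI_iff {t : unitInterval} : t ∈ MI ↔ t ≠ 0 ∧ t ≠ 1 :=
  ⟨fun h => ⟨h.1.ne', h.2.ne⟩, fun h => ⟨unitInterval.pos_iff_ne_zero.2 h.1, unitInterval.lt_one_iff_ne_one.2 h.2⟩⟩

lemma end_basis {e : unitInterval} (he : e = 0 ∨ e = 1) {U : Set unitInterval} (hU : U ∈ 𝓝[MI] e) :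
    ∃ V ⊆ U, V ⊆ MI ∧ V.Nonempty ∧ IsPreconnected V ∧ V ∈ 𝓝[MI] e := by
  have h01 : (0 : unitInterval) < 1 := zero_lt_one
  rcases he with rfl | rfl
  · rw [nhdsWithin_Ioo_eq_nhdsGT h01] at hU ⊢
    obtain ⟨u, hu, h⟩ := (mem_nhdsGT_iff_exists_Ioo_subset' h01).1 hU
    refine ⟨Ioo 0 u, h, Ioo_subset_Ioo_right unitInterval.le_one', nonempty_Ioo.2 hu, isPreconnected_Ioo, ?_⟩
    exact Ioo_mem_nhdsGT hu
  · rw [nhdsWithin_Ioo_eq_nhdsLT h01] at hU ⊢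
    obtain ⟨u, hu, h⟩ := (mem_nhdsLT_iff_exists_Ioo_subset' h01).1 hU
    refine ⟨Ioo u 1, h, Ioo_subset_Ioo_left unitInterval.nonneg', nonempty_Ioo.2 hu, isPreconnected_Ioo, ?_⟩
    exact Ioo_mem_nhdsLT hu

lemma end_neBot {e : unitInterval} (he : e = 0 ∨ e = 1) : (𝓝[MI] e).NeBot := by
  rw [← forall_mem_nonempty_iff_neBot]
  intro U hU
  obtain ⟨V, h1, -, h2, -⟩ := end_basis he hU
  exact h2.mono h1

variable {n : ℕ} {P : Fin n → ℂ}

def UT (e : unitInterval) (i : Fin n) (G : unitInterval × unitInterval → Hh) : Prop :=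
  ∀ ε > 0, ∀ᶠ t in 𝓝[MI] e, ∀ u, tau i (G (u, t)) < ε

lemma fam_cusp {i : Fin n} {e : unitInterval} (he : e = 0 ∨ e = 1) {G : unitInterval × unitInterval → Hh}
    (hG : ContinuousOn G (univ ×ˢ MI)) (ht : UT e i G) :
    ∃ ξ κ, Cusp i ξ κ ∧ ∀ᶠ t in 𝓝[MI] e, ∀ u, κ * bet ξ (G (u, t)) < 1 := by
  obtain ⟨V, h1, h2, h3, h4, h5⟩ := end_basis he (ht 1 one_pos)
  have hS : IsPreconnected (G '' (univ ×ˢ V)) :=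
    (isPreconnected_univ.prod h4).image G (hG.mono (prod_mono_right h2))
  obtain ⟨ξ, κ, hc, hb⟩ := cusp_conn i hS ((univ_nonempty.prod h3).image G) (by
    rintro _ ⟨⟨u, t⟩, ⟨-, ht⟩, rfl⟩; exact h1 ht u)
  refine ⟨ξ, κ, hc, ?_⟩
  filter_upwards [h5] with t ht u
  exact hb _ ⟨(u, t), ⟨mem_univ _, ht⟩, rfl⟩

lemma bet_tend {T : Type*} {l : Filter T} {i : Fin n} {ξ κ : ℝ} {f : T → Hh} (hc : Cusp i ξ κ)
    (h : ∀ᶠ t in l, κ * bet ξ (f t) < 1) (ht : Tendsto (fun t => tau i (f t)) l (𝓝 0)) :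
    Tendsto (fun t => bet ξ (f t)) l (𝓝 0) := by
  have : Tendsto (fun t => tau i (f t) / κ) l (𝓝 0) := by simpa using ht.div_const κ
  refine this.congr' ?_
  filter_upwards [h] with t ht
  rw [hc.2 _ ht, mul_div_cancel_left₀ _ hc.1.ne']

lemma bet_lim {T : Type*} {l : Filter T} {ξ : ℝ} {f : T → Hh}
    (h : Tendsto (fun t => bet ξ (f t)) l (𝓝 0)) : Tendsto (fun t => (f t : ℂ)) l (𝓝 ξ) := by
  rw [tendsto_iff_norm_sub_tendsto_zero]
  exact squeeze_zero (fun _ => norm_nonneg _) (fun t => bet_ge ξ (f t)) h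

lemma bet_uniq {T : Type*} {l : Filter T} [l.NeBot] {ξ η : ℝ} {f : T → Hh}
    (h : Tendsto (fun t => bet ξ (f t)) l (𝓝 0)) (h' : Tendsto (fun t => bet η (f t)) l (𝓝 0)) : ξ = η :=
  Complex.ofReal_injective (tendsto_nhds_unique (bet_lim h) (bet_lim h'))

lemma UT_tend {e : unitInterval} {i : Fin n} {G : unitInterval × unitInterval → Hh} (h : UT e i G) (u) :
    Tendsto (fun t => tau i (G (u, t))) (𝓝[MI] e) (𝓝 0) := by
  rw [Metric.tendsto_nhds]
  intro ε hε
  filter_upwards [h ε hε] with t ht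
  rw [Real.dist_eq, sub_zero, abs_of_pos (tau_pos _ _)]
  exact ht u

lemma UT_of (C : Cov n P) {e : unitInterval} {i : Fin n} {G : unitInterval × unitInterval → Hh}
    (H : C(unitInterval × unitInterval, ℂ)) (hp : ∀ u, ∀ t ∈ MI, C.p (G (u, t)) = H (u, t))
    (hH : ∀ u, H (u, e) = P i) : UT e i G := by
  intro ε hε
  obtain ⟨δ, hδ, h⟩ := C.near2 i ε hε
  have : ∀ᶠ t in 𝓝 e, ∀ u ∈ (univ : Set unitInterval), dist (H (u, t)) (P i) < δ := by
    refine isCompact_univ.eventually_forall_of_forall_eventually fun u _ => ?_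
    have hc : Continuous fun z : unitInterval × unitInterval => dist (H (z.2, z.1)) (P i) := by fun_prop
    refine hc.continuousAt.eventually_lt continuousAt_const ?_
    simpa [hH] using hδ
  filter_upwards [nhdsWithin_le_nhds this, self_mem_nhdsWithin] with t ht hm u
  refine h _ ?_
  rw [hp u t hm]; exact ht u (mem_univ _)

/-- a lift of an arc, with its two ideal endpoints -/
structure Ends (C : Cov n P) (α : C(unitInterval, ℂ)) (i j : Fin n) (ξ κ η lam : ℝ)
    (f : unitInterval → Hh) : Prop where
  a0 : α 0 = P i
  a1 : α 1 = P j
  c0 : Cusp i ξ κ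
  c1 : Cusp j η lam
  cont : ContinuousOn f MI
  proj : ∀ t ∈ MI, C.p (f t) = α t
  b0 : Tendsto (fun t => bet ξ (f t)) (𝓝[MI] 0) (𝓝 0)
  b1 : Tendsto (fun t => bet η (f t)) (𝓝[MI] 1) (𝓝 0)

lemma fam_cont {f : unitInterval → Hh} (h : ContinuousOn f MI) :
    ContinuousOn (fun x : unitInterval × unitInterval => f x.2) (univ ×ˢ MI) :=
  h.comp continuousOn_snd fun x hx => hx.2

lemma lift_raw (C : Cov n P) (α : C(unitInterval, ℂ)) (hα : ∀ t ∈ MI, α t ∈ ball (0 : ℂ) 1 \ range P) :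
    ∃ f : unitInterval → Hh, ContinuousOn f MI ∧ ∀ t ∈ MI, C.p (f t) = α t := by
  let A := Ioo (0 : ℝ) 1
  have : ContractibleSpace A := (convex_Ioo 0 1).contractibleSpace ⟨1 / 2, by norm_num, by norm_num⟩
  have : LocallyPathConnectedSpace A := isOpen_Ioo.locallyPathConnectedSpace
  have hm : ∀ t : A, (⟨t.1, t.2.1.le, t.2.2.le⟩ : unitInterval) ∈ MI := fun t => ⟨t.2.1, t.2.2⟩
  let g : C(A, (ball (0 : ℂ) 1 \ range P : Set ℂ)) :=
    ⟨fun t => ⟨α ⟨t.1, t.2.1.le, t.2.2.le⟩, hα _ (hm t)⟩, by fun_prop⟩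
  let a0 : A := ⟨1 / 2, by norm_num, by norm_num⟩
  obtain ⟨e0, he⟩ := C.surj _ (g a0).2
  obtain ⟨F, ⟨-, hF⟩, -⟩ := C.cov.existsUnique_continuousMap_lifts g a0 e0 (Subtype.ext he)
  have hA : ∀ t : unitInterval, t ∈ MI → t.1 ∈ A := fun t h => ⟨h.1, h.2⟩
  let f : unitInterval → Hh := fun t => if h : t ∈ MI then F ⟨t.1, hA t h⟩ else e0
  have hv : ∀ t (h : t ∈ MI), f t = F ⟨t.1, hA t h⟩ := fun t h => dif_pos h
  refine ⟨f, ?_, ?_⟩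
  · rw [continuousOn_iff_continuous_domRestrict]
    have : MI.domRestrict f = fun t : MI => F ⟨t.1.1, hA _ t.2⟩ := funext fun t => hv _ t.2
    rw [this]
    exact F.continuous.comp (by fun_prop)
  · intro t ht
    rw [hv t ht]
    exact congrArg Subtype.val (congrFun hF ⟨t.1, hA t ht⟩)

lemma lift_exists (C : Cov n P) (α : C(unitInterval, ℂ)) (hα : ∀ t ∈ MI, α t ∈ ball (0 : ℂ) 1 \ range P)
    {i j : Fin n} (h0 : α 0 = P i) (h1 : α 1 = P j) : ∃ ξ κ η lam f, Ends C α i j ξ κ η lam f := by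
  obtain ⟨f, hf, hp⟩ := lift_raw C α hα
  let H : C(unitInterval × unitInterval, ℂ) := ⟨fun x => α x.2, by fun_prop⟩
  have u0 : UT 0 i (fun x => f x.2) := UT_of C H (fun _ t ht => hp t ht) (fun _ => h0)
  have u1 : UT 1 j (fun x => f x.2) := UT_of C H (fun _ t ht => hp t ht) (fun _ => h1)
  obtain ⟨ξ, κ, c0, b0⟩ := fam_cusp (Or.inl rfl) (fam_cont hf) u0
  obtain ⟨η, lam, c1, b1⟩ := fam_cusp (Or.inr rfl) (fam_cont hf) u1
  exact ⟨ξ, κ, η, lam, f, h0, h1, c0, c1, hf, hp,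
    bet_tend c0 (b0.mono fun t h => h 0) (UT_tend u0 0),
    bet_tend c1 (b1.mono fun t h => h 0) (UT_tend u1 0)⟩

lemma htpy_end {e : unitInterval} (he : e = 0 ∨ e = 1) {i : Fin n} {ξ : ℝ} {f g : unitInterval → Hh}
    {G : unitInterval × unitInterval → Hh} (hG : ContinuousOn G (univ ×ˢ MI)) (ht : UT e i G)
    (h0 : ∀ t ∈ MI, G (0, t) = f t) (h1 : ∀ t ∈ MI, G (1, t) = g t)
    (hb : Tendsto (fun t => bet ξ (f t)) (𝓝[MI] e) (𝓝 0)) :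
    Tendsto (fun t => bet ξ (g t)) (𝓝[MI] e) (𝓝 0) := by
  obtain ⟨ξ', κ', c, b⟩ := fam_cusp he hG ht
  have t0 := bet_tend c (b.mono fun t h => h 0) (UT_tend ht 0)
  have t1 := bet_tend c (b.mono fun t h => h 1) (UT_tend ht 1)
  have e0 : (fun t => bet ξ' (G (0, t))) =ᶠ[𝓝[MI] e] fun t => bet ξ' (f t) := by
    filter_upwards [self_mem_nhdsWithin] with t ht
    rw [h0 t ht]
  have e1 : (fun t => bet ξ' (G (1, t))) =ᶠ[𝓝[MI] e] fun t => bet ξ' (g t) := by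
    filter_upwards [self_mem_nhdsWithin] with t ht
    rw [h1 t ht]
  have := end_neBot he
  have hx : ξ' = ξ := bet_uniq (t0.congr' e0) hb
  rw [← hx]
  exact t1.congr' e1

lemma lift_htpy (C : Cov n P) {α β : C(unitInterval, ℂ)} (H : C(unitInterval × unitInterval, ℂ))
    (h0 : ∀ t, H (0, t) = α t) (h1 : ∀ t, H (1, t) = β t) (hs : ∀ u, H (u, 0) = α 0) (ht : ∀ u, H (u, 1) = α 1)
    (hm : ∀ u, ∀ t ∈ MI, H (u, t) ∈ ball (0 : ℂ) 1 \ range P)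
    {i j : Fin n} {ξ κ η lam : ℝ} {f : unitInterval → Hh} (hE : Ends C α i j ξ κ η lam f) :
    ∃ g, Ends C β i j ξ κ η lam g := by
  let H' : C(unitInterval × MI, (ball (0 : ℂ) 1 \ range P : Set ℂ)) :=
    ⟨fun x => ⟨H (x.1, x.2.1), hm _ _ x.2.2⟩, by fun_prop⟩
  let f' : C(MI, Hh) := ⟨fun t => f t, continuousOn_iff_continuous_domRestrict.1 hE.cont⟩
  have hz : ∀ a, H' (0, a) = (⟨C.p (f' a), C.hm _⟩ : (ball (0 : ℂ) 1 \ range P : Set ℂ)) := fun a =>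
    Subtype.ext ((h0 a.1).trans (hE.proj a.1 a.2).symm)
  let K := C.cov.liftHomotopy H' f' hz
  have K1 := C.cov.liftHomotopy_lifts H' f' hz
  have K0 := C.cov.liftHomotopy_zero H' f' hz
  let G : unitInterval × unitInterval → Hh := fun x => if h : x.2 ∈ MI then K (x.1, ⟨x.2, h⟩) else f 0
  have hGv : ∀ u t (h : t ∈ MI), G (u, t) = K (u, ⟨t, h⟩) := fun u t h => dif_pos h
  have hG : ContinuousOn G (univ ×ˢ MI) := by
    rw [continuousOn_iff_continuous_domRestrict]
    have : ((univ ×ˢ MI).domRestrict G) = fun x : (univ ×ˢ MI : Set (unitInterval × unitInterval)) =>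
        K (x.1.1, ⟨x.1.2, x.2.2⟩) := by
      funext x
      exact hGv _ _ x.2.2
    rw [this]
    exact K.continuous.comp (by fun_prop)
  have hp : ∀ u, ∀ t ∈ MI, C.p (G (u, t)) = H (u, t) := fun u t ht => by
    rw [hGv u t ht]
    exact congrArg Subtype.val (congrFun K1 (u, ⟨t, ht⟩))
  have g0 : ∀ t ∈ MI, G (0, t) = f t := fun t ht => by
    rw [hGv _ _ ht]; exact K0 ⟨t, ht⟩
  have u0 : UT 0 i G := UT_of C H hp (fun u => (hs u).trans hE.a0)
  have u1 : UT 1 j G := UT_of C H hp (fun u => (ht u).trans hE.a1)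
  refine ⟨fun t => G (1, t), ?_, ?_, hE.c0, hE.c1, ?_, ?_, ?_, ?_⟩
  · rw [← h1, hs, hE.a0]
  · rw [← h1, ht, hE.a1]
  · exact hG.comp (by fun_prop) fun t ht => ⟨mem_univ _, ht⟩
  · intro t ht; rw [hp _ _ ht, h1]
  · exact htpy_end (Or.inl rfl) hG u0 g0 (fun t _ => rfl) hE.b0
  · exact htpy_end (Or.inr rfl) hG u1 g0 (fun t _ => rfl) hE.b1

lemma arc_mid {s : ℕ} (α : ColoredArc s n P) : ∀ t ∈ MI, α.toFun t ∈ ball (0 : ℂ) 1 \ range P := fun t ht =>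
  ⟨α.mem_ball t, α.middle t (MI_iff.1 ht).1 (MI_iff.1 ht).2⟩

lemma arcH_symm {s : ℕ} {α β : ColoredArc s n P} (h : ArcHomotopic α β) : ArcHomotopic β α := by
  obtain ⟨hc, H, h0, h1, hs, ht, hb, hm⟩ := h
  refine ⟨hc.symm, ⟨fun x => H (unitInterval.symm x.1, x.2), by fun_prop⟩, fun t => ?_, fun t => ?_, fun u => ?_,
    fun u => ?_, fun u t => hb _ _, fun u t => hm _ _⟩
  · simpa using h1 t
  · simpa using h0 t
  · show H _ = _
    rw [hs, ← h1, hs]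
  · show H _ = _
    rw [ht, ← h1, ht]

lemma ends_htpy (C : Cov n P) {s : ℕ} {α β : ColoredArc s n P} (h : ArcHomotopic α β) {i j : Fin n}
    {ξ κ η lam : ℝ} (hE : ∃ f, Ends C α.toFun i j ξ κ η lam f) : ∃ f, Ends C β.toFun i j ξ κ η lam f := by
  obtain ⟨f, hE⟩ := hE
  obtain ⟨-, H, h0, h1, hs, ht, hb, hm⟩ := h
  exact lift_htpy C H h0 h1 hs ht (fun u t ht => ⟨hb u t, hm u t (MI_iff.1 ht).1 (MI_iff.1 ht).2⟩) hE

lemma ends_class (C : Cov n P) {s : ℕ} {α β : ColoredArc s n P}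
    (h : (Quot.mk _ α : ArcClass s n P) = Quot.mk _ β) {i j : Fin n}
    {ξ κ η lam : ℝ} (hE : ∃ f, Ends C α.toFun i j ξ κ η lam f) : ∃ f, Ends C β.toFun i j ξ κ η lam f := by
  have key := Quot.eqvGen_exact h
  have : (∃ f, Ends C α.toFun i j ξ κ η lam f) ↔ (∃ f, Ends C β.toFun i j ξ κ η lam f) := by
    clear hE h
    induction key with
    | rel a b h => exact ⟨ends_htpy C h, ends_htpy C (arcH_symm h)⟩
    | refl a => exact Iff.rfl
    | symm a b _ ih => exact ih.symm
    | trans a b c _ _ h1 h2 => exact h1.trans h2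
  exact this.1 hE
end MA

open scoped Classical
namespace MA
open Set Topology Metric Filter

variable {n : ℕ} {P : Fin n → ℂ}

lemma glueF {q : unitInterval × unitInterval → ℂ} (hq : ContinuousOn q (univ ×ˢ MI)) {A B : ℂ}
    (hA : ∀ ε > 0, ∀ᶠ t in 𝓝[MI] (0 : unitInterval), ∀ u, dist (q (u, t)) A < ε)
    (hB : ∀ ε > 0, ∀ᶠ t in 𝓝[MI] (1 : unitInterval), ∀ u, dist (q (u, t)) B < ε) :
    ∃ H : C(unitInterval × unitInterval, ℂ), (∀ u, ∀ t ∈ MI, H (u, t) = q (u, t)) ∧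
      (∀ u, H (u, 0) = A) ∧ ∀ u, H (u, 1) = B := by
  let H : unitInterval × unitInterval → ℂ := fun x => if x.2 = 0 then A else if x.2 = 1 then B else q x
  have h0 : ∀ u, H (u, 0) = A := fun u => if_pos rfl
  have h1 : ∀ u, H (u, 1) = B := fun u => by
    show (if (1 : unitInterval) = 0 then A else if (1 : unitInterval) = 1 then B else _) = B
    rw [if_neg one_ne_zero, if_pos rfl]
  have hm : ∀ u, ∀ t ∈ MI, H (u, t) = q (u, t) := fun u t ht => by
    show (if t = 0 then A else if t = 1 then B else _) = _
    rw [if_neg (MI_iff.1 ht).1, if_neg (MI_iff.1 ht).2]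
  refine ⟨⟨H, ?_⟩, hm, h0, h1⟩
  rw [continuous_iff_continuousAt]
  rintro ⟨u, t⟩
  by_cases ht : t ∈ MI
  · have hop : (univ ×ˢ MI : Set (unitInterval × unitInterval)) ∈ 𝓝 (u, t) :=
      (isOpen_univ.prod isOpen_Ioo).mem_nhds ⟨mem_univ _, ht⟩
    refine (hq.continuousAt hop).congr ?_
    filter_upwards [hop] with x hx
    exact (hm x.1 x.2 hx.2).symm
  · rw [MI_iff, not_and_or, not_not, not_not] at ht
    rw [ContinuousAt, Metric.tendsto_nhds]
    intro ε hε
    rcases ht with rfl | rfl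
    · rw [h0]
      have e1 : ∀ᶠ t in 𝓝 (0 : unitInterval), t ∈ MI → ∀ u, dist (q (u, t)) A < ε :=
        eventually_nhdsWithin_iff.1 (hA ε hε)
      have e2 : ∀ᶠ t in 𝓝 (0 : unitInterval), t ≠ 1 := isOpen_ne.mem_nhds zero_ne_one
      have := (continuous_snd (X := unitInterval) (Y := unitInterval)).continuousAt (x := (u, 0)) |>.eventually (e1.and e2)
      filter_upwards [this] with x hx
      obtain ⟨x1, x2⟩ := x
      by_cases hx0 : x2 = 0
      · subst hx0; rw [h0]; simpa using hε
      · rw [hm _ _ (MI_iff.2 ⟨hx0, hx.2⟩)]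
        exact hx.1 (MI_iff.2 ⟨hx0, hx.2⟩) _
    · rw [h1]
      have e1 : ∀ᶠ t in 𝓝 (1 : unitInterval), t ∈ MI → ∀ u, dist (q (u, t)) B < ε :=
        eventually_nhdsWithin_iff.1 (hB ε hε)
      have e2 : ∀ᶠ t in 𝓝 (1 : unitInterval), t ≠ 0 := isOpen_ne.mem_nhds one_ne_zero
      have := (continuous_snd (X := unitInterval) (Y := unitInterval)).continuousAt (x := (u, 1)) |>.eventually (e1.and e2)
      filter_upwards [this] with x hx
      obtain ⟨x1, x2⟩ := x
      by_cases hx0 : x2 = 1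
      · subst hx0; rw [h1]; simpa using hε
      · rw [hm _ _ (MI_iff.2 ⟨hx.2, hx0⟩)]
        exact hx.1 (MI_iff.2 ⟨hx.2, hx0⟩) _

lemma Ends.close {C : Cov n P} {α : C(unitInterval, ℂ)} {i j : Fin n} {ξ κ η lam : ℝ}
    {f : unitInterval → Hh} (h : Ends C α i j ξ κ η lam f) :
    ∃ F : C(unitInterval, ℂ), (∀ t ∈ MI, F t = f t) ∧ F 0 = ξ ∧ F 1 = η := by
  obtain ⟨H, h1, h2, h3⟩ := glueF (q := fun x => (f x.2 : ℂ)) (A := ξ) (B := η)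
    (continuous_subtype_val.comp_continuousOn (fam_cont h.cont))
    (fun ε hε => ((Metric.tendsto_nhds.1 (bet_lim h.b0)) ε hε).mono fun t ht _ => ht)
    (fun ε hε => ((Metric.tendsto_nhds.1 (bet_lim h.b1)) ε hε).mono fun t ht _ => ht)
  exact ⟨H.comp ⟨fun t => (0, t), by fun_prop⟩, fun t ht => h1 0 t ht, h2 0, h3 0⟩

lemma Ends.translate {C : Cov n P} {α : C(unitInterval, ℂ)} {i j : Fin n} {ξ κ η lam : ℝ}
    {f : unitInterval → Hh} (h : Ends C α i j ξ κ η lam f) (l : List (Fin (n + 1))) (hl : Even l.length) :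
    ∃ ξ' κ' η' lam', Ends C α i j ξ' κ' η' lam' (fun t => act l (f t)) ∧
      (∀ z, κ' * bet ξ' (act l z) = κ * bet ξ z) ∧ (∀ z, lam' * bet η' (act l z) = lam * bet η z) ∧
      (∀ z : Hh, geo ξ η z → geo ξ' η' (act l z)) := by
  obtain ⟨ξ', κ', η', lam', c0, c1, s0, s1, hg⟩ := cusp_act l h.c0 h.c1
  refine ⟨ξ', κ', η', lam', ⟨h.a0, h.a1, c0, c1, (act l).continuous.comp_continuousOn h.cont, ?_, ?_, ?_⟩, s0, s1, hg⟩
  · intro t ht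
    rw [← h.proj t ht, C.fiber]
    exact ⟨l, hl, rfl⟩
  · have : Tendsto (fun t => κ / κ' * bet ξ (f t)) (𝓝[MI] 0) (𝓝 0) := by simpa using h.b0.const_mul (κ / κ')
    refine this.congr fun t => ?_
    have := s0 (f t)
    have hk := c0.1.ne'
    field_simp
    linarith
  · have : Tendsto (fun t => lam / lam' * bet η (f t)) (𝓝[MI] 1) (𝓝 0) := by simpa using h.b1.const_mul (lam / lam')
    refine this.congr fun t => ?_
    have := s1 (f t)
    have hk := c1.1.ne'
    field_simp
    linarith

lemma geo_share {a b d : ℝ} {z : Hh} (h : geo a b z) (h' : geo a d z) : b = d := by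
  have hy := z.2
  unfold geo at h h'
  have hne : z.1.re - a ≠ 0 := by
    intro h0; rw [h0] at h; nlinarith
  have : (z.1.re - a) * (z.1.re - b) = (z.1.re - a) * (z.1.re - d) := by linarith
  have := mul_left_cancel₀ hne this
  linarith

lemma Ends.cross {C : Cov n P} {α β : C(unitInterval, ℂ)} {i j i' j' : Fin n} {ξ κ η lam ξ' κ' η' lam' : ℝ}
    {f g : unitInterval → Hh} (h : Ends C α i j ξ κ η lam f) (h' : Ends C β i' j' ξ' κ' η' lam' g)
    {z : Hh} (hz : geo ξ η z) (hz' : geo ξ' η' z) :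
    (∃ t ∈ MI, ∃ u ∈ MI, f t = g u) ∨ (ξ = ξ' ∧ η = η') ∨ (ξ = η' ∧ η = ξ') := by
  by_cases e1 : ξ = ξ'
  · subst e1; exact Or.inr (Or.inl ⟨rfl, geo_share hz hz'⟩)
  by_cases e2 : ξ = η'
  · subst e2; exact Or.inr (Or.inr ⟨rfl, geo_share hz (geo_symm hz')⟩)
  by_cases e3 : η = ξ'
  · subst e3; exact absurd (geo_share (geo_symm hz) hz') e2
  by_cases e4 : η = η'
  · subst e4; exact absurd (geo_share (geo_symm hz) (geo_symm hz')) e1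
  left
  obtain ⟨F, Fm, F0, F1⟩ := h.close
  obtain ⟨G, Gm, G0, G1⟩ := h'.close
  have im : ∀ (F : C(unitInterval, ℂ)) (f : unitInterval → Hh) (a b : ℝ), (∀ t ∈ MI, F t = f t) → F 0 = a →
      F 1 = b → ∀ t, 0 ≤ (F t).im ∧ (t ∈ MI ∨ (F t = a ∨ F t = b) ∧ (F t).im = 0) := by
    intro F f a b hm h0 h1 t
    by_cases ht : t ∈ MI
    · refine ⟨?_, Or.inl ht⟩
      rw [hm t ht]; exact (f t).2.le
    · rw [MI_iff, not_and_or, not_not, not_not] at ht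
      rcases ht with rfl | rfl
      · rw [h0]; simp
      · rw [h1]; simp
  have iF := im F f ξ η Fm F0 F1
  have iG := im G g ξ' η' Gm G0 G1
  rcases cross_geo F G (fun t => (iF t).1) (fun t => (iG t).1) hz hz' F0 F1 G0 G1 with ⟨t, u, e⟩ | e | e
  · rcases (iF t).2 with ht | ⟨ht, hti⟩
    · rcases (iG u).2 with hu | ⟨hu, hui⟩
      · refine ⟨t, ht, u, hu, Subtype.ext ?_⟩
        rw [← Fm t ht, ← Gm u hu, e]
      · rw [← e, Fm t ht] at hui
        exact absurd hui (f t).2.ne'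
    · rcases (iG u).2 with hu | ⟨hu, hui⟩
      · rw [e, Gm u hu] at hti
        exact absurd hti (g u).2.ne'
      · exfalso
        rw [e] at ht
        rcases ht with ht | ht <;> rcases hu with hu | hu <;> rw [ht] at hu <;>
          have := Complex.ofReal_injective hu <;> contradiction
  · exact absurd e.1 e1
  · exact absurd e.1 e2

lemma arc_geo_inj {s : ℕ} {C : Cov n P} {α : ColoredArc s n P} {i j : Fin n} {ξ κ η lam : ℝ}
    {f : unitInterval → Hh} (h : Ends C α.toFun i j ξ κ η lam f) {z w : Hh} (hz : geo ξ η z) (hw : geo ξ η w)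
    (hp : C.p z = C.p w) : z = w := by
  obtain ⟨l, hl, rfl⟩ := (C.fiber z w).1 hp
  obtain ⟨ξ', κ', η', lam', h', s0, s1, hg⟩ := h.translate l hl
  rcases h.cross h' hz (hg w hw) with ⟨t, ht, u, hu, e⟩ | ⟨e1, e2⟩ | ⟨e1, e2⟩
  · have : α.toFun t = α.toFun u := by rw [← h.proj t ht, e]; exact h'.proj u hu
    have := α.inj this
    subst this
    have hG : act l ∈ GG n := ⟨l, hl, rfl⟩
    rw [GG_free hG e.symm]; rfl
  · subst e1 e2
    have k0 := (cusp_unique h.c0 h'.c0).2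
    have k1 := (cusp_unique h.c1 h'.c1).2
    subst k0 k1
    exact bet_det hz hw (mul_left_cancel₀ h.c0.1.ne' (s0 w)) (mul_left_cancel₀ h.c1.1.ne' (s1 w))
  · subst e1
    have := (cusp_unique h.c0 h'.c1).1
    exfalso
    apply α.ends_ne
    rw [h.a0, h.a1, this]

lemma arc_geo_disj {s : ℕ} {C : Cov n P} {α β : ColoredArc s n P} {i j i' j' : Fin n} {ξ κ η lam ξ' κ' η' lam' : ℝ}
    {f g : unitInterval → Hh} (h : Ends C α.toFun i j ξ κ η lam f) (h2 : Ends C β.toFun i' j' ξ' κ' η' lam' g)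
    (hd : ArcsDisjoint α β)
    {z w : Hh} (hz : geo ξ η z) (hw : geo ξ' η' w) : C.p z ≠ C.p w := by
  intro hp
  obtain ⟨l, hl, rfl⟩ := (C.fiber z w).1 hp
  obtain ⟨ξ', κ', η', lam', h', s0, s1, hg⟩ := h2.translate l hl
  rcases h.cross h' hz (hg w hw) with ⟨t, ht, u, hu, e⟩ | ⟨e1, e2⟩ | ⟨e1, e2⟩
  · apply hd t u
    rw [← h.proj t ht, e]; exact h'.proj u hu
  · subst e1
    have := (cusp_unique h.c0 h'.c0).1
    apply hd 0 0
    rw [h.a0, h'.a0, this]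
  · subst e1
    have := (cusp_unique h.c0 h'.c1).1
    apply hd 0 1
    rw [h.a0, h'.a1, this]

/-! geodesics -/

noncomputable def gamC (ξ η t : ℝ) : ℂ :=
  ⟨((1 - t) ^ 2 * ξ + t ^ 2 * η) / ((1 - t) ^ 2 + t ^ 2), |η - ξ| * (t * (1 - t)) / ((1 - t) ^ 2 + t ^ 2)⟩

lemma gamD (t : ℝ) : 0 < (1 - t) ^ 2 + t ^ 2 := by nlinarith [sq_nonneg (1 - 2 * t)]

lemma gamC_cont (ξ η : ℝ) : Continuous (gamC ξ η) := by
  unfold gamC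
  refine mk_cont ?_ ?_
  · exact Continuous.div (by fun_prop) (by fun_prop) fun t => (gamD t).ne'
  · exact Continuous.div (by fun_prop) (by fun_prop) fun t => (gamD t).ne'

lemma gamC_im {ξ η t : ℝ} (h : ξ ≠ η) (h0 : 0 < t) (h1 : t < 1) : 0 < (gamC ξ η t).im := by
  have := gamD t
  have h2 : 0 < |η - ξ| := abs_pos.2 (sub_ne_zero.2 h.symm)
  have h3 : 0 < 1 - t := by linarith
  show 0 < |η - ξ| * (t * (1 - t)) / ((1 - t) ^ 2 + t ^ 2)
  positivity

lemma gamC_geo (ξ η t : ℝ) : geo ξ η (gamC ξ η t) := by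
  have := (gamD t).ne'
  simp only [geo, gamC]
  rw [div_pow, mul_pow, sq_abs]
  field_simp
  ring

lemma gamC_bet {ξ η t : ℝ} (h : ξ ≠ η) (h0 : 0 < t) (h1 : t < 1) :
    bet ξ (gamC ξ η t) = |η - ξ| * t / (1 - t) ∧ bet η (gamC ξ η t) = |η - ξ| * (1 - t) / t := by
  have hD := (gamD t).ne'
  have h2 : |η - ξ| ≠ 0 := (abs_pos.2 (sub_ne_zero.2 h.symm)).ne'
  have h3 : 1 - t ≠ 0 := by linarith
  have hs := sq_abs (η - ξ)
  simp only [bet, qq, gamC]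
  generalize |η - ξ| = m at *
  constructor
  · rw [div_eq_div_iff (div_ne_zero (mul_ne_zero h2 (mul_ne_zero h0.ne' h3)) hD) h3]
    have e : ((1 - t) ^ 2 * ξ + t ^ 2 * η) / ((1 - t) ^ 2 + t ^ 2) - ξ = t ^ 2 * (η - ξ) / ((1 - t) ^ 2 + t ^ 2) := by
      field_simp; ring
    rw [e, div_pow, div_pow, mul_pow, ← hs]
    field_simp
    ring
  · rw [div_eq_div_iff (div_ne_zero (mul_ne_zero h2 (mul_ne_zero h0.ne' h3)) hD) h0.ne']
    have e : ((1 - t) ^ 2 * ξ + t ^ 2 * η) / ((1 - t) ^ 2 + t ^ 2) - η = (1 - t) ^ 2 * (-(η - ξ)) / ((1 - t) ^ 2 + t ^ 2) := by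
      field_simp; ring
    rw [e, div_pow, div_pow, mul_pow, neg_sq, ← hs]
    field_simp

noncomputable def gam (ξ η : ℝ) (t : unitInterval) : Hh :=
  if h : 0 < (gamC ξ η t).im then ⟨gamC ξ η t, h⟩ else ⟨Complex.I, by simp⟩

lemma gam_val {ξ η : ℝ} (h : ξ ≠ η) {t : unitInterval} (ht : t ∈ MI) : (gam ξ η t : ℂ) = gamC ξ η t := by
  rw [gam, dif_pos (gamC_im h ht.1 ht.2)]

lemma gam_cont {ξ η : ℝ} (h : ξ ≠ η) : ContinuousOn (gam ξ η) MI := by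
  have hi : IsInducing (Subtype.val : Hh → ℂ) := IsInducing.subtypeVal
  rw [hi.continuousOn_iff]
  refine ((gamC_cont ξ η).comp continuous_subtype_val).continuousOn.congr fun t ht => gam_val h ht

lemma gam_geo {ξ η : ℝ} (h : ξ ≠ η) {t : unitInterval} (ht : t ∈ MI) : geo ξ η (gam ξ η t) := by
  rw [gam_val h ht]; exact gamC_geo _ _ _

lemma gam_inj {ξ η : ℝ} (h : ξ ≠ η) {t u : unitInterval} (ht : t ∈ MI) (hu : u ∈ MI)
    (e : gam ξ η t = gam ξ η u) : t = u := by
  have e1 := (gamC_bet h ht.1 ht.2).1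
  have e2 := (gamC_bet h hu.1 hu.2).1
  rw [← gam_val h ht, e, gam_val h hu, e2] at e1
  have h2 : |η - ξ| ≠ 0 := (abs_pos.2 (sub_ne_zero.2 h.symm)).ne'
  have a1 : (1 : ℝ) - t ≠ 0 := by have : (t : ℝ) < 1 := ht.2; linarith
  have a2 : (1 : ℝ) - u ≠ 0 := by have : (u : ℝ) < 1 := hu.2; linarith
  rw [div_eq_div_iff a2 a1] at e1
  have : |η - ξ| * (u : ℝ) = |η - ξ| * (t : ℝ) := by linarith
  exact Subtype.ext (mul_left_cancel₀ h2 this).symm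

lemma gam_b0 {ξ η : ℝ} (h : ξ ≠ η) : Tendsto (fun t => bet ξ (gam ξ η t)) (𝓝[MI] 0) (𝓝 0) := by
  have : Tendsto (fun t : unitInterval => |η - ξ| * (t : ℝ) / (1 - t)) (𝓝 0) (𝓝 0) := by
    have hc : ContinuousAt (fun t : unitInterval => |η - ξ| * (t : ℝ) / (1 - t)) 0 :=
      ContinuousAt.div (by fun_prop) (by fun_prop) (by simp)
    simpa [ContinuousAt] using hc
  refine (this.mono_left nhdsWithin_le_nhds).congr' ?_
  filter_upwards [self_mem_nhdsWithin] with t ht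
  rw [gam_val h ht, (gamC_bet h ht.1 ht.2).1]

lemma gam_b1 {ξ η : ℝ} (h : ξ ≠ η) : Tendsto (fun t => bet η (gam ξ η t)) (𝓝[MI] 1) (𝓝 0) := by
  have : Tendsto (fun t : unitInterval => |η - ξ| * (1 - t : ℝ) / t) (𝓝 1) (𝓝 0) := by
    have hc : ContinuousAt (fun t : unitInterval => |η - ξ| * (1 - t : ℝ) / t) 1 :=
      ContinuousAt.div (by fun_prop) (by fun_prop) (by simp)
    simpa [ContinuousAt] using hc
  refine (this.mono_left nhdsWithin_le_nhds).congr' ?_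
  filter_upwards [self_mem_nhdsWithin] with t ht
  rw [gam_val h ht, (gamC_bet h ht.1 ht.2).2]

/-! straight-line homotopy -/

noncomputable def comb (u : unitInterval) (z w : Hh) : Hh :=
  ⟨((1 - u : ℝ) : ℂ) * z + ((u : ℝ) : ℂ) * w, by
    have hz := z.2
    have hw := w.2
    have h0 := u.2.1
    have h1 := u.2.2
    rw [Complex.add_im, Complex.im_ofReal_mul, Complex.im_ofReal_mul]
    rcases h0.eq_or_lt with h | h
    · rw [← h]; simpa using hz
    · have := mul_pos h hw
      have := mul_nonneg (sub_nonneg.2 h1) hz.le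
      linarith⟩

lemma comb_zero (z w : Hh) : comb 0 z w = z := by apply Subtype.ext; simp [comb]
lemma comb_one (z w : Hh) : comb 1 z w = w := by apply Subtype.ext; simp [comb]

lemma bet_lt {ξ δ : ℝ} {z : Hh} : bet ξ z < δ ↔ (z.1.re - ξ) ^ 2 + z.1.im ^ 2 < δ * z.1.im := by
  rw [bet, qq, div_lt_iff₀ z.2]

lemma comb_bet {ξ δ : ℝ} {z w : Hh} (u) (hz : bet ξ z < δ) (hw : bet ξ w < δ) : bet ξ (comb u z w) < δ := by
  rw [bet_lt] at *
  have h0 := u.2.1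
  have h1 := u.2.2
  have e1 : (comb u z w).1.re = (1 - u) * z.1.re + u * w.1.re := by
    simp only [comb, Complex.add_re, Complex.re_ofReal_mul]
  have e2 : (comb u z w).1.im = (1 - u) * z.1.im + u * w.1.im := by
    simp only [comb, Complex.add_im, Complex.im_ofReal_mul]
  rw [e1, e2]
  generalize (u : ℝ) = v at *
  generalize z.1.re = a at *
  generalize z.1.im = b at *
  generalize w.1.re = c at *
  generalize w.1.im = d at *
  have k1 : ((1 - v) * a + v * c - ξ) ^ 2 + ((1 - v) * b + v * d) ^ 2 =
      (1 - v) * ((a - ξ) ^ 2 + b ^ 2) + v * ((c - ξ) ^ 2 + d ^ 2) - v * (1 - v) * ((a - c) ^ 2 + (b - d) ^ 2) := by ring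
  have k2 : 0 ≤ v * (1 - v) * ((a - c) ^ 2 + (b - d) ^ 2) :=
    mul_nonneg (mul_nonneg h0 (sub_nonneg.2 h1)) (by positivity)
  rw [k1]
  have k3 : (1 - v) * ((a - ξ) ^ 2 + b ^ 2) + v * ((c - ξ) ^ 2 + d ^ 2) < δ * ((1 - v) * b + v * d) := by
    rcases h0.eq_or_lt with h | h
    · rw [← h]; linarith
    · have m1 := mul_lt_mul_of_pos_left hw h
      have m2 := mul_le_mul_of_nonneg_left hz.le (sub_nonneg.2 h1)
      linarith
  linarith

lemma comb_UT {e : unitInterval} {i : Fin n} {ξ κ : ℝ} (hc : Cusp i ξ κ) {f g : unitInterval → Hh}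
    (hf : Tendsto (fun t => bet ξ (f t)) (𝓝[MI] e) (𝓝 0)) (hg : Tendsto (fun t => bet ξ (g t)) (𝓝[MI] e) (𝓝 0)) :
    UT e i (fun x => comb x.1 (f x.2) (g x.2)) := by
  intro ε hε
  have hk := hc.1
  have hδ : 0 < min 1 ε / κ := by positivity
  filter_upwards [hf.eventually_lt_const hδ, hg.eventually_lt_const hδ] with t h1 h2 u
  have h3 := comb_bet u h1 h2
  rw [lt_div_iff₀ hk, mul_comm] at h3
  show tau i (comb u (f t) (g t)) < ε
  rw [hc.2 _ (h3.trans_le (min_le_left _ _))]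
  exact h3.trans_le (min_le_right _ _)

lemma comb_cont {f g : unitInterval → Hh} (hf : ContinuousOn f MI) (hg : ContinuousOn g MI) :
    ContinuousOn (fun x : unitInterval × unitInterval => comb x.1 (f x.2) (g x.2)) (univ ×ˢ MI) := by
  have hi : IsInducing (Subtype.val : Hh → ℂ) := IsInducing.subtypeVal
  rw [hi.continuousOn_iff]
  have h1 := continuous_subtype_val.comp_continuousOn (fam_cont hf)
  have h2 := continuous_subtype_val.comp_continuousOn (fam_cont hg)
  have c1 : Continuous fun x : unitInterval × unitInterval => ((1 - x.1 : ℝ) : ℂ) := by fun_prop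
  have c2 : Continuous fun x : unitInterval × unitInterval => ((x.1 : ℝ) : ℂ) := by fun_prop
  exact (c1.continuousOn.mul h1).add (c2.continuousOn.mul h2)

lemma Cov.cont (C : Cov n P) : Continuous C.p := continuous_subtype_val.comp C.cov.continuous

lemma Ends.ne {s : ℕ} {C : Cov n P} {α : ColoredArc s n P} {i j : Fin n} {ξ κ η lam : ℝ}
    {f : unitInterval → Hh} (h : Ends C α.toFun i j ξ κ η lam f) : ξ ≠ η := by
  rintro rfl
  apply α.ends_ne
  rw [h.a0, h.a1, (cusp_unique h.c0 h.c1).1]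

lemma sec_exists {s : ℕ} (C : Cov n P) {α : ColoredArc s n P} {i j : Fin n} {ξ κ η lam : ℝ}
    {f : unitInterval → Hh} (h : Ends C α.toFun i j ξ κ η lam f) :
    ∃ β : ColoredArc s n P, ArcHomotopic α β ∧ β.toFun 0 = P i ∧ β.toFun 1 = P j ∧
      ∀ t ∈ MI, β.toFun t = C.p (gam ξ η t) := by
  have hne := h.ne
  have u0 := comb_UT h.c0 h.b0 (gam_b0 hne)
  have u1 := comb_UT h.c1 h.b1 (gam_b1 hne)
  have hcont := C.cont.comp_continuousOn (comb_cont h.cont (gam_cont hne))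
  obtain ⟨H, Hm, H0, H1⟩ := glueF hcont (A := P i) (B := P j)
    (fun ε hε => by
      obtain ⟨δ, hδ, hh⟩ := C.near1 i ε hε
      exact (u0 δ hδ).mono fun t ht u => hh _ (ht u))
    (fun ε hε => by
      obtain ⟨δ, hδ, hh⟩ := C.near1 j ε hε
      exact (u1 δ hδ).mono fun t ht u => hh _ (ht u))
  have Hm' : ∀ u, ∀ t ∈ MI, H (u, t) = C.p (comb u (f t) (gam ξ η t)) := Hm
  have tri : ∀ t : unitInterval, t = 0 ∨ t = 1 ∨ t ∈ MI := fun t => by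
    by_cases h0 : t = 0
    · exact Or.inl h0
    by_cases h1 : t = 1
    · exact Or.inr (Or.inl h1)
    exact Or.inr (Or.inr (MI_iff.2 ⟨h0, h1⟩))
  have hi : P i ∈ ball (0 : ℂ) 1 := by rw [← h.a0]; exact α.mem_ball _
  have hj : P j ∈ ball (0 : ℂ) 1 := by rw [← h.a1]; exact α.mem_ball _
  have hij : P i ≠ P j := by rw [← h.a0, ← h.a1]; exact α.ends_ne
  have Hb : ∀ u t, H (u, t) ∈ ball (0 : ℂ) 1 := by
    intro u t
    rcases tri t with rfl | rfl | ht
    · rw [H0]; exact hi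
    · rw [H1]; exact hj
    · rw [Hm' u t ht]; exact (C.hm _).1
  have Hr : ∀ u, ∀ t ∈ MI, H (u, t) ∉ range P := fun u t ht => by rw [Hm' u t ht]; exact (C.hm _).2
  have val : ∀ t ∈ MI, H (1, t) = C.p (gam ξ η t) := fun t ht => by rw [Hm' 1 t ht, comb_one]
  let b : C(unitInterval, ℂ) := ⟨fun t => H (1, t), by fun_prop⟩
  have b0 : b 0 = P i := H0 1
  have b1 : b 1 = P j := H1 1
  have binj : Function.Injective b := by
    intro t u e
    have e' : H (1, t) = H (1, u) := e
    rcases tri t with rfl | rfl | ht <;> rcases tri u with rfl | rfl | hu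
    · rfl
    · rw [H0, H1] at e'; exact absurd e' hij
    · rw [H0] at e'; exact absurd ⟨i, e'⟩ (Hr 1 u hu)
    · rw [H0, H1] at e'; exact absurd e'.symm hij
    · rfl
    · rw [H1] at e'; exact absurd ⟨j, e'⟩ (Hr 1 u hu)
    · rw [H0] at e'; exact absurd ⟨i, e'.symm⟩ (Hr 1 t ht)
    · rw [H1] at e'; exact absurd ⟨j, e'.symm⟩ (Hr 1 t ht)
    · rw [val t ht, val u hu] at e'
      exact gam_inj hne ht hu (arc_geo_inj h (gam_geo hne ht) (gam_geo hne hu) e')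
  refine ⟨⟨α.color, b, binj, fun t => Hb 1 t, ⟨i, b0⟩, ⟨j, b1⟩, by rw [b0, b1]; exact hij,
    fun t h0 h1 => Hr 1 t (MI_iff.2 ⟨h0, h1⟩)⟩, ⟨rfl, H, ?_, fun t => rfl, ?_, ?_, Hb,
      fun u t h0 h1 => Hr u t (MI_iff.2 ⟨h0, h1⟩)⟩, b0, b1, val⟩
  · intro t
    rcases tri t with rfl | rfl | ht
    · rw [H0, h.a0]
    · rw [H1, h.a1]
    · rw [Hm' 0 t ht, comb_zero, h.proj t ht]
  · intro u; rw [H0, h.a0]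
  · intro u; rw [H1, h.a1]

lemma hasSection (s n : ℕ) (P : Fin n → ℂ) (hinj : Function.Injective P)
    (hint : ∀ i, P i ∈ ball (0 : ℂ) 1) : HasSection s n P := by
  obtain ⟨C⟩ := exists_Cov P hinj hint
  have key : ∀ c : ArcClass s n P, ∃ (α β : ColoredArc s n P) (i j : Fin n) (ξ κ η lam : ℝ),
      (Quot.mk _ α : ArcClass s n P) = c ∧ (∃ f, Ends C α.toFun i j ξ κ η lam f) ∧ ArcHomotopic α β ∧
      β.toFun 0 = P i ∧ β.toFun 1 = P j ∧ ∀ t ∈ MI, β.toFun t = C.p (gam ξ η t) := by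
    intro c
    obtain ⟨α, hα⟩ := Quot.exists_rep c
    obtain ⟨i, hi⟩ := α.src
    obtain ⟨j, hj⟩ := α.tgt
    obtain ⟨ξ, κ, η, lam, f, hE⟩ := lift_exists C α.toFun (arc_mid α) hi hj
    obtain ⟨β, h1, h2⟩ := sec_exists C hE
    exact ⟨α, β, i, j, ξ, κ, η, lam, hα, ⟨f, hE⟩, h1, h2⟩
  choose a b i j ξ κ η lam ha hE hab b0 b1 bm using key
  refine ⟨b, fun c => ?_, fun α β _ hd t u => ?_⟩
  · rw [← ha c]
    have := Quot.sound (hab c)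
    rw [ha c] at this ⊢
    exact this.symm
  · set c : ArcClass s n P := Quot.mk _ α with hc
    set d : ArcClass s n P := Quot.mk _ β with hd'
    obtain ⟨f, hf⟩ := ends_class C ((ha c).trans hc) (hE c)
    obtain ⟨g, hg⟩ := ends_class C ((ha d).trans hd') (hE d)
    have tri : ∀ t : unitInterval, t = 0 ∨ t = 1 ∨ t ∈ MI := fun t => by
      by_cases h0 : t = 0
      · exact Or.inl h0
      by_cases h1 : t = 1
      · exact Or.inr (Or.inl h1)
      exact Or.inr (Or.inr (MI_iff.2 ⟨h0, h1⟩))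
    intro e
    rcases tri t with rfl | rfl | ht <;> rcases tri u with rfl | rfl | hu
    · rw [b0, b0, ← hf.a0, ← hg.a0] at e; exact hd _ _ e
    · rw [b0, b1, ← hf.a0, ← hg.a1] at e; exact hd _ _ e
    · rw [b0, bm d u hu] at e; exact (C.hm _).2 ⟨_, e⟩
    · rw [b1, b0, ← hf.a1, ← hg.a0] at e; exact hd _ _ e
    · rw [b1, b1, ← hf.a1, ← hg.a1] at e; exact hd _ _ e
    · rw [b1, bm d u hu] at e; exact (C.hm _).2 ⟨_, e⟩
    · rw [b0, bm c t ht] at e; exact (C.hm _).2 ⟨_, e.symm⟩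
    · rw [b1, bm c t ht] at e; exact (C.hm _).2 ⟨_, e.symm⟩
    · rw [bm c t ht, bm d u hu] at e
      exact arc_geo_disj hf hg hd (gam_geo hf.ne ht) (gam_geo hg.ne hu) e
end MA



/-- For every `s ≥ 1` and `n ≥ 1`, the multicoloured matching
arc complex `sMA(K_n)` on the disk with `n` marked points is
`(⌊(n−2)/3⌋ − 1)`-connected. -/
theorem multicolored_matching_arc_complex_connectivity
    (s n : ℕ) (hs : 1 ≤ s) (hn : 1 ≤ n)
    (P : Fin n → ℂ) (hinj : Function.Injective P)
    (hint : ∀ i, P i ∈ Metric.ball (0 : ℂ) 1) :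
    NConnectedSpace (nuZ n - 1) (sMA s n P).realization := by
  exact MA.assembly s n hs P hinj hint (fun _ => MA.hasSection s n P hinj hint)
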